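/- Assume d ≥ 2, k ∈ {1,…,d−1}, and 2_⋆^k ≤ p < ∞ with p < 2_s^⋆. Let (g_ε) be (s,γ)-admissible for some s > d/(d+1) and γ > 1. Then there exists a constant C' < ∞, independent of ε, such that for every ε ∈ (0,1) and every G_k-symmetric function v ∈ L²(ℝ^d) whose Fourier transform v̂ is supported in the spherical shell {ξ ∈ ℝ^d : 1/2 ≤ |ξ| ≤ 3/2} and with q_ε(v) < ∞, one has ‖v‖_{L^p(ℝ^d)}² ≤ C' ε^{1/γ − 1} q_ε(v). -/

import Mathlib

open MeasureTheory Real Filter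
open scoped ENNReal FourierTransform RealInnerProductSpace Topology

noncomputable section

/-- Euclidean space `ℝ^d`. -/
abbrev Rd (d : ℕ) : Type := EuclideanSpace ℝ (Fin d)

/-- `U` is the (distributional, hence `L²`-) Fourier transform of `u`:
it pairs against Schwartz functions the way the Fourier transform of `u` must. -/
def IsFT {d : ℕ} (U u : Rd d → ℂ) : Prop :=
  ∀ φ : SchwartzMap (Rd d) ℂ, ∫ ξ, U ξ * φ ξ = ∫ x, u x * 𝓕 (⇑φ) x

/-- An element of `H^s(ℝ^d)`: an `L²` function `toFun` together with its Fourier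
transform `ft`, satisfying the `H^s` integrability condition. -/
structure HsFn (d : ℕ) (s : ℝ) where
  toFun : Rd d → ℂ
  ft : Rd d → ℂ
  memL2 : MemLp toFun 2 volume
  ft_memL2 : MemLp ft 2 volume
  isFT : IsFT ft toFun
  memHs : Integrable (fun ξ : Rd d => ‖ft ξ‖ ^ 2 * (1 + ‖ξ‖ ^ 2) ^ s) volume

/-- The quadratic form `q_ε(u) = ∫ |û(ξ)|² g(|ξ|) dξ` (for a fixed symbol `g`). -/
def qeps {d : ℕ} {s : ℝ} (g : ℝ → ℝ) (u : HsFn d s) : ℝ :=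
  ∫ ξ : Rd d, ‖u.ft ξ‖ ^ 2 * g ‖ξ‖

/-- The `L^p` norm (as a real number). -/
def LpN {d : ℕ} (p : ℝ) (f : Rd d → ℂ) : ℝ :=
  (eLpNorm f (ENNReal.ofReal p) volume).toReal

/-- The set of values of the Rayleigh quotient `q_ε(u)/‖u‖_p²` over nonzero
`u ∈ H^s` satisfying the symmetry constraint `P`. -/
def RayleighSet (d : ℕ) (s p : ℝ) (g : ℝ → ℝ) (P : (Rd d → ℂ) → Prop) : Set ℝ :=
  {t | ∃ u : HsFn d s, P u.toFun ∧ ¬ u.toFun =ᵐ[volume] (fun _ => (0 : ℂ)) ∧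
      MemLp u.toFun (ENNReal.ofReal p) volume ∧
      t = qeps g u / LpN p u.toFun ^ 2}

/-- The Rayleigh quotient infimum. -/
def Rayleigh (d : ℕ) (s p : ℝ) (g : ℝ → ℝ) (P : (Rd d → ℂ) → Prop) : ℝ :=
  sInf (RayleighSet d s p g P)

/-- The Rayleigh quotient infimum is attained. -/
def Attained (d : ℕ) (s p : ℝ) (g : ℝ → ℝ) (P : (Rd d → ℂ) → Prop) : Prop :=
  ∃ u : HsFn d s, P u.toFun ∧ ¬ u.toFun =ᵐ[volume] (fun _ => (0 : ℂ)) ∧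
      MemLp u.toFun (ENNReal.ofReal p) volume ∧
      qeps g u / LpN p u.toFun ^ 2 = Rayleigh d s p g P

/-- A radial function. -/
def Radial {d : ℕ} (f : Rd d → ℂ) : Prop := ∀ x y : Rd d, ‖x‖ = ‖y‖ → f x = f y

/-- The squared norm of the first block of coordinates (the first `d - k` ones),
under the identification `ℝ^d = ℝ^{d-k} × ℝ^k`. -/
def blockSq (d k : ℕ) (x : Rd d) : ℝ := ∑ i : Fin d, if (i : ℕ) < d - k then x i ^ 2 else 0

/-- A `G_k = O(d-k) × O(k)`-symmetric function: it depends only on the norms of the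
two blocks of coordinates. -/
def GkSymmetric (d k : ℕ) (f : Rd d → ℂ) : Prop :=
  ∀ x y : Rd d, blockSq d k x = blockSq d k y → ‖x‖ = ‖y‖ → f x = f y

/-- An `(s,γ)`-admissible family of symbols, with admissibility constants `c, C`. -/
def IsAdmissible (s γ c C : ℝ) (g : ℝ → ℝ → ℝ) : Prop :=
  (∀ ε ∈ Set.Ioo (0:ℝ) 1, Measurable (g ε)) ∧
  (∀ ε ∈ Set.Ioo (0:ℝ) 1, ∀ r : ℝ, 0 < g ε r) ∧
  (∀ ε ∈ Set.Ioo (0:ℝ) 1, ∀ r : ℝ, 1/2 ≤ |r - 1| →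
      c * (1 + |r| ^ (2*s)) ≤ g ε r ∧ g ε r ≤ C * (1 + |r| ^ (2*s))) ∧
  (∀ ε ∈ Set.Ioo (0:ℝ) 1, ∀ r : ℝ, |r - 1| ≤ 1/2 →
      c * (ε + |r - 1| ^ γ) ≤ g ε r ∧ g ε r ≤ C * (ε + |r - 1| ^ γ))

/-- The `G_k`-symmetric Stein–Tomas exponent `2_⋆^k`. -/
def twoStarK (d k : ℕ) : ℝ :=
  2 * ((d : ℝ) + (min k (d - k) : ℕ)) / ((d : ℝ) - 2 + (min k (d - k) : ℕ))

/-- The interpolation parameter `α_k`. -/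
def alphaK (d k : ℕ) (p : ℝ) : ℝ := (1/2 - 1/p) / (1/2 - 1/twoStarK d k)

/-- The spherical shell `A_{ε,δ}` around the unit sphere (with `I_{ε,δ}` scale `ε^{1/γ}`). -/
def Aset (d : ℕ) (γ ε δ : ℝ) : Set (Rd d) :=
  {ξ | δ * ε ^ (1/γ) ≤ |‖ξ‖ - 1| ∧ |‖ξ‖ - 1| ≤ δ⁻¹ * ε ^ (1/γ)}

set_option linter.unusedSectionVars false
set_option maxHeartbeats 1000000



section Bessel
open scoped Pointwise

variable {F : Type*} [NormedAddCommGroup F] [InnerProductSpace ℝ F] [FiniteDimensional ℝ F]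
  [MeasurableSpace F] [BorelSpace F]

/-- surface measure on the unit sphere -/
abbrev sph (F : Type*) [NormedAddCommGroup F] [InnerProductSpace ℝ F] [FiniteDimensional ℝ F]
  [MeasurableSpace F] [BorelSpace F] : Measure (Metric.sphere (0 : F) 1) :=
  (volume : Measure F).toSphere

lemma isoSphere_mem (A : F ≃ₗᵢ[ℝ] F) (ω : Metric.sphere (0 : F) 1) :
    A ω ∈ Metric.sphere (0 : F) 1 := by
  simp

/-- action of an isometry on the sphere -/
def isoSphere (A : F ≃ₗᵢ[ℝ] F) (ω : Metric.sphere (0 : F) 1) : Metric.sphere (0 : F) 1 :=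
  ⟨A ω, isoSphere_mem A ω⟩

lemma isoSphere_measurePreserving (A : F ≃ₗᵢ[ℝ] F) :
    MeasurePreserving (isoSphere A) (sph F) (sph F) := by
  have hc : Continuous (isoSphere A) := by
    unfold isoSphere
    exact Continuous.subtype_mk (A.continuous.comp continuous_subtype_val) _
  refine ⟨hc.measurable, ?_⟩
  ext s hs
  rw [Measure.map_apply hc.measurable hs, Measure.toSphere_apply' _ hs,
    Measure.toSphere_apply' _ (hc.measurable hs)]
  congr 1
  have : Set.Ioo (0:ℝ) 1 • (Subtype.val '' (isoSphere A ⁻¹' s)) =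
      A ⁻¹' (Set.Ioo (0:ℝ) 1 • (Subtype.val '' s)) := by
    ext x
    simp only [Set.mem_smul, Set.mem_image, Set.mem_preimage]
    constructor
    · rintro ⟨r, hr, _, ⟨ω, hω, rfl⟩, rfl⟩
      exact ⟨r, hr, _, ⟨_, hω, rfl⟩, by simp [isoSphere]⟩
    · rintro ⟨r, hr, _, ⟨ω, hω, rfl⟩, h⟩
      refine ⟨r, hr, _, ⟨isoSphere A.symm ω, ?_, rfl⟩, ?_⟩
      · have : isoSphere A (isoSphere A.symm ω) = ω := by ext; simp [isoSphere]
        rwa [this]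
      · apply A.injective
        rw [← h]; simp [isoSphere]
  rw [this]
  exact (A.measurePreserving).measure_preimage_emb A.toHomeomorph.measurableEmbedding _

lemma sph_integral_iso {G : Type*} [NormedAddCommGroup G] [NormedSpace ℝ G]
    (A : F ≃ₗᵢ[ℝ] F) (f : F → G) :
    ∫ ω, f (A ω) ∂(sph F) = ∫ ω, f ω ∂(sph F) := by
  have hc : Continuous (isoSphere A) := by
    unfold isoSphere
    exact Continuous.subtype_mk (A.continuous.comp continuous_subtype_val) _
  have hc' : Continuous (isoSphere A.symm) := by
    unfold isoSphere
    exact Continuous.subtype_mk (A.symm.continuous.comp continuous_subtype_val) _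
  let e : Metric.sphere (0:F) 1 ≃ₜ Metric.sphere (0:F) 1 :=
    { toFun := isoSphere A, invFun := isoSphere A.symm
      left_inv := fun ω => by ext; simp [isoSphere]
      right_inv := fun ω => by ext; simp [isoSphere]
      continuous_toFun := hc
      continuous_invFun := hc' }
  exact (isoSphere_measurePreserving A).integral_comp e.measurableEmbedding
    (fun ω : Metric.sphere (0:F) 1 => f ω)

lemma sph_integrable {G : Type*} [NormedAddCommGroup G]
    {f : Metric.sphere (0 : F) 1 → G} (hf : Continuous f) : Integrable f (sph F) :=
  hf.integrable_of_hasCompactSupport (HasCompactSupport.of_compactSpace f)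

lemma sph_hasDerivAt {g g' : ℝ → Metric.sphere (0 : F) 1 → ℝ}
    (hg : ∀ t, Continuous (g t)) (hg' : Continuous (Function.uncurry g'))
    (hd : ∀ t ω, HasDerivAt (fun t => g t ω) (g' t ω) t) (t : ℝ) :
    HasDerivAt (fun t => ∫ ω, g t ω ∂(sph F)) (∫ ω, g' t ω ∂(sph F)) t := by
  obtain ⟨C, hC⟩ := ((isCompact_closedBall t 1).prod
    (isCompact_univ : IsCompact (Set.univ : Set (Metric.sphere (0:F) 1)))).exists_bound_of_continuousOn
    hg'.continuousOn
  refine (hasDerivAt_integral_of_dominated_loc_of_deriv_le (F := g) (F' := g') (bound := fun _ => C)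
    (Metric.closedBall_mem_nhds t one_pos) ?_ (sph_integrable (hg t)) ?_ ?_ (integrable_const C) ?_).2
  · exact Eventually.of_forall fun x => (hg x).aestronglyMeasurable
  · exact (hg'.comp (by fun_prop : Continuous fun ω => (t, ω))).aestronglyMeasurable
  · exact Eventually.of_forall fun ω x hx => hC (x, ω) ⟨hx, trivial⟩
  · exact Eventually.of_forall fun ω x _ => hd x ω

/-- `φ_e(t) = ∫ cos (t ⟪e, ω⟫)` and its derivatives. -/
def bes0 (e : F) (t : ℝ) : ℝ := ∫ ω : Metric.sphere (0:F) 1, cos (t * ⟪e, (ω : F)⟫) ∂(sph F)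
def bes1 (e : F) (t : ℝ) : ℝ :=
  ∫ ω : Metric.sphere (0:F) 1, -(⟪e, (ω : F)⟫ * sin (t * ⟪e, (ω : F)⟫)) ∂(sph F)
def bes2 (e : F) (t : ℝ) : ℝ :=
  ∫ ω : Metric.sphere (0:F) 1, -(⟪e, (ω : F)⟫ ^ 2 * cos (t * ⟪e, (ω : F)⟫)) ∂(sph F)

lemma bes0_hasDerivAt (e : F) (t : ℝ) : HasDerivAt (bes0 e) (bes1 e t) t := by
  refine sph_hasDerivAt (g := fun t (ω : Metric.sphere (0:F) 1) => cos (t * ⟪e, (ω : F)⟫))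
    (g' := fun t (ω : Metric.sphere (0:F) 1) => -(⟪e, (ω : F)⟫ * sin (t * ⟪e, (ω : F)⟫)))
    (fun t => by fun_prop) (by unfold Function.uncurry; fun_prop) (fun t ω => ?_) t
  have := ((hasDerivAt_id' t).mul_const ⟪e, (ω : F)⟫).cos
  refine this.congr_deriv ?_
  ring

lemma bes1_hasDerivAt (e : F) (t : ℝ) : HasDerivAt (bes1 e) (bes2 e t) t := by
  refine sph_hasDerivAt (g := fun t (ω : Metric.sphere (0:F) 1) => -(⟪e, (ω : F)⟫ * sin (t * ⟪e, (ω : F)⟫)))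
    (g' := fun t (ω : Metric.sphere (0:F) 1) => -(⟪e, (ω : F)⟫ ^ 2 * cos (t * ⟪e, (ω : F)⟫)))
    (fun t => by fun_prop) (by unfold Function.uncurry; fun_prop) (fun t ω => ?_) t
  have := ((((hasDerivAt_id' t).mul_const ⟪e, (ω : F)⟫).sin).const_mul ⟪e, (ω : F)⟫).neg
  refine this.congr_deriv ?_
  ring

lemma sph_reflect {G : Type*} [NormedAddCommGroup G] [NormedSpace ℝ G]
    (w : F) (f : F → G) :
    ∫ ω, f ((Submodule.reflection (ℝ ∙ w)ᗮ : F ≃ₗᵢ[ℝ] F) ω) ∂(sph F) = ∫ ω, f ω ∂(sph F) :=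
  sph_integral_iso _ f

lemma inner_reflect_self (w x : F) :
    ⟪w, (Submodule.reflection (ℝ ∙ w)ᗮ : F ≃ₗᵢ[ℝ] F) x⟫ = -⟪w, x⟫ := by
  rw [← LinearIsometryEquiv.inner_map_map (Submodule.reflection (ℝ ∙ w)ᗮ) w,
    Submodule.reflection_reflection, Submodule.reflection_orthogonalComplement_singleton_eq_neg]
  simp

lemma inner_reflect_orth (w e x : F) (h : ⟪w, e⟫ = 0) :
    ⟪e, (Submodule.reflection (ℝ ∙ w)ᗮ : F ≃ₗᵢ[ℝ] F) x⟫ = ⟪e, x⟫ := by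
  rw [← LinearIsometryEquiv.inner_map_map (Submodule.reflection (ℝ ∙ w)ᗮ) e,
    Submodule.reflection_reflection, Submodule.reflection_mem_subspace_eq_self]
  exact Submodule.mem_orthogonal_singleton_iff_inner_right.2 h

lemma sph_odd (w e : F) (h : ⟪w, e⟫ = 0) (f : ℝ → ℝ) :
    ∫ ω : Metric.sphere (0:F) 1, ⟪w, (ω : F)⟫ * f ⟪e, (ω : F)⟫ ∂(sph F) = 0 := by
  have := sph_reflect w (fun x => ⟪w, x⟫ * f ⟪e, x⟫)
  simp only [inner_reflect_self, inner_reflect_orth w e _ h, neg_mul] at this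
  rw [integral_neg] at this
  linarith

lemma bes_key (w e : F) (h : ⟪w, e⟫ = 0) (he : ‖e‖ = 1) (t : ℝ) :
    t * ∫ ω : Metric.sphere (0:F) 1, ⟪w, (ω : F)⟫ ^ 2 * cos (t * ⟪e, (ω : F)⟫) ∂(sph F)
      = - (‖w‖ ^ 2 * bes1 e t) := by
  have hzero : ∀ x : ℝ, ∫ ω : Metric.sphere (0:F) 1,
      ⟪w - (x * ‖w‖ ^ 2) • e, (ω : F)⟫ * sin (t * ⟪e + x • w, (ω : F)⟫) ∂(sph F) = 0 := by
    intro x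
    refine sph_odd (w - (x * ‖w‖ ^ 2) • e) (e + x • w) ?_ (fun y => sin (t * y))
    have h' : ⟪e, w⟫ = 0 := by rw [real_inner_comm]; exact h
    simp only [inner_sub_left, inner_add_right, inner_smul_left, inner_smul_right, h, h',
      real_inner_self_eq_norm_sq, he]
    simp
  have hder := sph_hasDerivAt (F := F)
    (g := fun x ω => ⟪w - (x * ‖w‖ ^ 2) • e, (ω : F)⟫ * sin (t * ⟪e + x • w, (ω : F)⟫))
    (g' := fun x ω => - (‖w‖ ^ 2 * ⟪e, (ω : F)⟫) * sin (t * ⟪e + x • w, (ω : F)⟫)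
      + ⟪w - (x * ‖w‖ ^ 2) • e, (ω : F)⟫ * (cos (t * ⟪e + x • w, (ω : F)⟫) * (t * ⟪w, (ω : F)⟫)))
    (fun t => by fun_prop) (by unfold Function.uncurry; fun_prop) (fun x ω => by
      simp only [inner_sub_left, inner_add_left, inner_smul_left]
      simp only [conj_trivial]
      have h1 : HasDerivAt (fun x : ℝ => ⟪w, (ω : F)⟫ - x * ‖w‖ ^ 2 * ⟪e, (ω : F)⟫)
          (- (‖w‖ ^ 2 * ⟪e, (ω : F)⟫)) x := by
        have := (((hasDerivAt_id x).mul_const (‖w‖ ^ 2)).mul_const ⟪e, (ω : F)⟫).const_sub ⟪w, (ω : F)⟫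
        simpa using this
      have h2 : HasDerivAt (fun x : ℝ => t * (⟪e, (ω : F)⟫ + x * ⟪w, (ω : F)⟫))
          (t * ⟪w, (ω : F)⟫) x := by
        have := (((hasDerivAt_id x).mul_const ⟪w, (ω : F)⟫).const_add ⟪e, (ω : F)⟫).const_mul t
        simpa using this
      exact h1.mul h2.sin) 0
  rw [show (fun x : ℝ => ∫ ω : Metric.sphere (0:F) 1,
      ⟪w - (x * ‖w‖ ^ 2) • e, (ω : F)⟫ * sin (t * ⟪e + x • w, (ω : F)⟫) ∂(sph F)) = fun _ => 0 from
      funext hzero] at hder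
  have h0 := hder.unique (hasDerivAt_const 0 0)
  simp only [zero_mul, zero_smul, sub_zero, add_zero] at h0
  rw [integral_add (sph_integrable (by fun_prop)) (sph_integrable (by fun_prop))] at h0
  have e1 : ∫ ω : Metric.sphere (0:F) 1, -(‖w‖ ^ 2 * ⟪e, (ω : F)⟫) * sin (t * ⟪e, (ω : F)⟫) ∂(sph F)
      = ‖w‖ ^ 2 * bes1 e t := by
    rw [bes1, ← integral_const_mul]; congr 1; ext ω; ring
  have e2 : ∫ ω : Metric.sphere (0:F) 1,
      ⟪w, (ω : F)⟫ * (cos (t * ⟪e, (ω : F)⟫) * (t * ⟪w, (ω : F)⟫)) ∂(sph F)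
      = t * ∫ ω : Metric.sphere (0:F) 1, ⟪w, (ω : F)⟫ ^ 2 * cos (t * ⟪e, (ω : F)⟫) ∂(sph F) := by
    rw [← integral_const_mul]; congr 1; ext ω; ring
  rw [e1, e2] at h0
  linarith

end Bessel




section Bessel2
variable {F : Type*} [NormedAddCommGroup F] [InnerProductSpace ℝ F] [FiniteDimensional ℝ F]
  [MeasurableSpace F] [BorelSpace F]

lemma bes_ode (e : F) (he : ‖e‖ = 1) (t : ℝ) :
    t * (bes0 e t + bes2 e t) = -(((Module.finrank ℝ F : ℝ) - 1) * bes1 e t) := by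
  let W : Submodule ℝ F := (ℝ ∙ e)ᗮ
  let b := stdOrthonormalBasis ℝ W
  have hfin : (Module.finrank ℝ W : ℝ) = (Module.finrank ℝ F : ℝ) - 1 := by
    have h1 := Submodule.finrank_add_finrank_orthogonal (ℝ ∙ e)
    have h2 : Module.finrank ℝ (ℝ ∙ e) = 1 := finrank_span_singleton (by
      intro h; rw [h, norm_zero] at he; exact one_ne_zero he.symm)
    rw [h2] at h1
    have : (Module.finrank ℝ F : ℝ) = 1 + Module.finrank ℝ W := by exact_mod_cast h1.symm
    rw [this]; ring
  have hpt : ∀ ω : F, ‖ω‖ = 1 → ∑ i, ⟪(b i : F), ω⟫ ^ 2 = 1 - ⟪e, ω⟫ ^ 2 := by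
    intro ω hω
    have h1 := b.sum_sq_norm_inner_right (W.orthogonalProjectionOnto ω)
    have h2 : ∀ i, ⟪b i, W.orthogonalProjectionOnto ω⟫ = ⟪(b i : F), ω⟫ := fun i =>
      Submodule.inner_orthogonalProjectionOnto_eq_of_mem_left (b i) ω
    simp only [h2, Real.norm_eq_abs, sq_abs] at h1
    rw [h1]
    have h3 := Submodule.norm_sq_eq_add_norm_sq_projection ω (ℝ ∙ e)
    have h4 : ‖(ℝ ∙ e).orthogonalProjectionOnto ω‖ ^ 2 = ⟪e, ω⟫ ^ 2 := by
      have : ‖(ℝ ∙ e).orthogonalProjectionOnto ω‖ = ‖(ℝ ∙ e).starProjection ω‖ := rfl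
      rw [this, Submodule.starProjection_unit_singleton ℝ he, norm_smul, he]
      simp
    rw [hω, h4] at h3
    have : ‖W.orthogonalProjectionOnto ω‖ ^ 2 = ‖(ℝ ∙ e)ᗮ.orthogonalProjectionOnto ω‖ ^ 2 := rfl
    linarith
  have hsum : ∑ i, t * ∫ ω : Metric.sphere (0:F) 1, ⟪(b i : F), (ω : F)⟫ ^ 2 * cos (t * ⟪e, (ω : F)⟫) ∂(sph F)
      = ∑ i : Fin (Module.finrank ℝ W), - bes1 e t := by
    refine Finset.sum_congr rfl fun i _ => ?_
    rw [bes_key _ e ?_ he]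
    · have : ‖(b i : F)‖ = 1 := b.norm_eq_one i
      rw [this]; ring
    · have := (b i).2
      exact (Submodule.mem_orthogonal_singleton_iff_inner_left.1 this)
  rw [← Finset.mul_sum, ← integral_finsetSum _ (fun i _ => sph_integrable (by fun_prop))] at hsum
  simp only [Finset.sum_const, Finset.card_univ, Fintype.card_fin, nsmul_eq_mul, hfin] at hsum
  rw [show -(((Module.finrank ℝ F : ℝ) - 1) * bes1 e t) = ((Module.finrank ℝ F : ℝ) - 1) * -bes1 e t by ring, ← hsum]
  congr 1
  rw [bes0, bes2, ← integral_add (sph_integrable (by fun_prop)) (sph_integrable (by fun_prop))]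
  congr 1; ext ω
  rw [← Finset.sum_mul, hpt ω (by simp)]
  ring

lemma ode_decay (μ M : ℝ) (hμ : 0 ≤ μ) (hM : 0 ≤ M) : ∃ C : ℝ, 0 ≤ C ∧ ∀ f f1 f2 : ℝ → ℝ,
    (∀ t, HasDerivAt f (f1 t) t) → (∀ t, HasDerivAt f1 (f2 t) t) →
    (∀ t, t * (f t + f2 t) = -(2 * μ * f1 t)) →
    (∀ t, |f t| ≤ M) → (∀ t, |f1 t| ≤ M) → (∀ t, |f2 t| ≤ M) →
    ∀ t, 0 ≤ t → |f t| ≤ C * (1 + t) ^ (-μ) ∧ |f1 t| ≤ C * (1 + t) ^ (-μ) ∧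
      |f t + f2 t| ≤ C * (1 + t) ^ (-μ - 1) := by
  set c := μ ^ 2 - μ with hc
  set K := (M ^ 2 + (M + μ * M) ^ 2) * exp |c| with hK
  have hK0 : 0 ≤ K := by positivity
  set C1 := max (2 * M) ((1 + μ) * √K) with hC1
  have hC10 : 0 ≤ C1 := le_max_of_le_left (by positivity)
  set C := (1 + 2 * μ) * C1 * 2 ^ (μ + 1) with hC
  have h2μ : (1:ℝ) ≤ 2 ^ μ := Real.one_le_rpow (by norm_num) hμ
  have hCC : C1 * 2 ^ μ ≤ C ∧ C1 * 2 ^ (μ + 1) ≤ C ∧ 2 * μ * C1 * 2 ^ (μ + 1) ≤ C := by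
    have : (2:ℝ) ^ (μ + 1) = 2 ^ μ * 2 := by rw [Real.rpow_add_one (by norm_num)]
    rw [hC, this]
    refine ⟨?_, ?_, ?_⟩ <;> nlinarith [mul_nonneg hC10 (by positivity : (0:ℝ) ≤ 2 ^ μ),
      mul_nonneg (mul_nonneg hC10 (by positivity : (0:ℝ) ≤ 2 ^ μ)) hμ]
  refine ⟨C, by positivity, fun f f1 f2 hf hf1 hode b0 b1 b2 t ht => ?_⟩
  rcases le_total t 1 with h1 | h1
  · have hp : (1:ℝ) ≤ 2 ^ μ * (1 + t) ^ (-μ) := by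
      rw [Real.rpow_neg (by linarith), ← div_eq_mul_inv, one_le_div (by positivity)]
      exact Real.rpow_le_rpow (by linarith) (by linarith) hμ
    have hp' : (1:ℝ) ≤ 2 ^ (μ + 1) * (1 + t) ^ (-μ - 1) := by
      rw [show -μ - 1 = -(μ + 1) by ring, Real.rpow_neg (by linarith), ← div_eq_mul_inv, one_le_div (by positivity)]
      exact Real.rpow_le_rpow (by linarith) (by linarith) (by linarith)
    have hM1 : 2 * M ≤ C1 := le_max_left _ _
    have key : C1 ≤ C * (1 + t) ^ (-μ) := by
      calc C1 = C1 * 1 := by ring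
        _ ≤ C1 * (2 ^ μ * (1 + t) ^ (-μ)) := by gcongr
        _ = C1 * 2 ^ μ * (1 + t) ^ (-μ) := by ring
        _ ≤ _ := by gcongr; exact hCC.1
    have key' : C1 ≤ C * (1 + t) ^ (-μ - 1) := by
      calc C1 = C1 * 1 := by ring
        _ ≤ C1 * (2 ^ (μ + 1) * (1 + t) ^ (-μ - 1)) := by gcongr
        _ = C1 * 2 ^ (μ + 1) * (1 + t) ^ (-μ - 1) := by ring
        _ ≤ _ := by gcongr; exact hCC.2.1
    refine ⟨?_, ?_, ?_⟩
    · linarith [b0 t]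
    · linarith [b1 t]
    · linarith [abs_add_le (f t) (f2 t), b0 t, b2 t]
  · have ht0 : 0 < t := by linarith
    let ψ : ℝ → ℝ := fun t => f1 t + μ * f t / t
    let G : ℝ → ℝ := fun t => (f t ^ 2 + ψ t ^ 2) * (t ^ (2 * μ) * exp (|c| / t))
    have hder : ∀ x : ℝ, 0 < x → HasDerivAt G (x ^ (2 * μ) * exp (|c| / x) *
        (2 * c * (f x * ψ x) / x ^ 2 - |c| / x ^ 2 * (f x ^ 2 + ψ x ^ 2))) x := by
      intro x hx
      have hψ : HasDerivAt ψ (f2 x + (μ * f1 x * x - μ * f x * 1) / x ^ 2) x :=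
        (hf1 x).add (((hf x).const_mul μ).div (hasDerivAt_id' x) hx.ne')
      have hp : HasDerivAt (fun y : ℝ => y ^ (2 * μ)) (2 * μ * x ^ (2 * μ - 1)) x :=
        Real.hasDerivAt_rpow_const (Or.inl hx.ne')
      have he : HasDerivAt (fun y : ℝ => exp (|c| / y)) (exp (|c| / x) * ((0 * x - |c| * 1) / x ^ 2)) x :=
        ((hasDerivAt_const x |c|).div (hasDerivAt_id' x) hx.ne').exp
      have := (((hf x).pow 2).add (hψ.pow 2)).mul (hp.mul he)
      refine this.congr_deriv ?_
      rw [Real.rpow_sub_one hx.ne']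
      have h2 : f2 x = - f x - 2 * μ * f1 x / x := by
        have := hode x
        field_simp
        linarith
      simp only [ψ, h2, hc, Pi.mul_apply, Pi.add_apply, Pi.pow_apply]
      generalize x ^ (2 * μ) = X
      generalize |μ ^ 2 - μ| = c'
      generalize exp (c' / x) = Y
      have hx' : x ≠ 0 := hx.ne'
      simp only [Nat.add_one_sub_one, pow_one, Nat.cast_ofNat, show 2 - 1 = 1 from rfl]
      field_simp
      ring
    have hanti : AntitoneOn G (Set.Ici 1) := by
      apply antitoneOn_of_deriv_nonpos (convex_Ici 1)
      · exact fun x hx => (hder x (lt_of_lt_of_le one_pos hx)).continuousAt.continuousWithinAt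
      · intro x hx
        rw [interior_Ici] at hx
        exact (hder x (lt_trans one_pos hx)).differentiableAt.differentiableWithinAt
      · intro x hx
        rw [interior_Ici] at hx
        rw [(hder x (lt_trans one_pos hx)).deriv]
        have hx0 : 0 < x := lt_trans one_pos hx
        apply mul_nonpos_of_nonneg_of_nonpos (by positivity)
        rw [show 2 * c * (f x * ψ x) / x ^ 2 - |c| / x ^ 2 * (f x ^ 2 + ψ x ^ 2) =
          (c * (2 * f x * ψ x) - |c| * (f x ^ 2 + ψ x ^ 2)) / x ^ 2 by field_simp]
        apply div_nonpos_of_nonpos_of_nonneg _ (by positivity)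
        have : |2 * f x * ψ x| ≤ f x ^ 2 + ψ x ^ 2 := by
          rw [abs_le]; constructor <;> nlinarith [sq_nonneg (f x + ψ x), sq_nonneg (f x - ψ x)]
        have h3 : c * (2 * f x * ψ x) ≤ |c| * |2 * f x * ψ x| := by
          rw [← abs_mul]; exact le_abs_self _
        nlinarith [mul_le_mul_of_nonneg_left this (abs_nonneg c)]
    have hG1 : G 1 ≤ K := by
      simp only [G, ψ, hK]
      rw [Real.one_rpow, one_mul, div_one, div_one]
      have e1 : f 1 ^ 2 ≤ M ^ 2 := sq_le_sq' (abs_le.1 (b0 1)).1 (abs_le.1 (b0 1)).2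
      have e2 : |f1 1 + μ * f 1| ≤ M + μ * M := by
        refine (abs_add_le _ _).trans ?_
        rw [abs_mul, abs_of_nonneg hμ]
        have := b0 1; have := b1 1; gcongr
      have e3 : (f1 1 + μ * f 1) ^ 2 ≤ (M + μ * M) ^ 2 := sq_le_sq' (abs_le.1 e2).1 (abs_le.1 e2).2
      gcongr
    have hGt : G t ≤ K := (hanti Set.self_mem_Ici h1 h1).trans hG1
    have hpos : 0 < t ^ μ := by positivity
    have h2 : (f t ^ 2 + ψ t ^ 2) * (t ^ μ) ^ 2 ≤ K := by
      refine le_trans ?_ hGt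
      simp only [G]
      rw [← Real.rpow_natCast (t ^ μ) 2, ← Real.rpow_mul ht0.le, mul_comm μ]
      push_cast
      have : 1 ≤ exp (|c| / t) := Real.one_le_exp (by positivity)
      gcongr
      nlinarith [(by positivity : 0 < t ^ (2 * μ))]
    have e1 : |f t| * t ^ μ ≤ √K := by
      apply Real.le_sqrt_of_sq_le
      rw [mul_pow, sq_abs]; nlinarith [sq_nonneg (ψ t), sq_nonneg (t ^ μ), mul_nonneg (sq_nonneg (ψ t)) (sq_nonneg (t ^ μ))]
    have e2 : |ψ t| * t ^ μ ≤ √K := by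
      apply Real.le_sqrt_of_sq_le
      rw [mul_pow, sq_abs]; nlinarith [mul_nonneg (sq_nonneg (f t)) (sq_nonneg (t ^ μ))]
    have e3 : |f1 t| ≤ |ψ t| + μ * |f t| := by
      have : f1 t = ψ t - μ * f t / t := by simp only [ψ]; ring
      rw [this]
      refine (abs_sub _ _).trans ?_
      gcongr
      rw [abs_div, abs_mul, abs_of_nonneg hμ, abs_of_pos ht0]
      exact div_le_self (by positivity) h1
    have hKC : (1 + μ) * √K ≤ C1 := le_max_right _ _
    have f0 : |f t| * t ^ μ ≤ C1 := by nlinarith [Real.sqrt_nonneg K, mul_nonneg hμ (Real.sqrt_nonneg K)]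
    have f1' : |f1 t| * t ^ μ ≤ C1 := by
      calc |f1 t| * t ^ μ ≤ (|ψ t| + μ * |f t|) * t ^ μ := by gcongr
        _ = |ψ t| * t ^ μ + μ * (|f t| * t ^ μ) := by ring
        _ ≤ √K + μ * √K := by gcongr
        _ ≤ C1 := by linarith
    have hp : ∀ ν : ℝ, 0 ≤ ν → (t ^ ν)⁻¹ ≤ 2 ^ ν * (1 + t) ^ (-ν) := by
      intro ν hν
      rw [Real.rpow_neg (by linarith), ← div_eq_mul_inv, inv_eq_one_div, div_le_div_iff₀ (by positivity) (by positivity), one_mul,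
        ← Real.mul_rpow (by norm_num) ht0.le]
      exact Real.rpow_le_rpow (by linarith) (by linarith) hν
    have g0 : ∀ y, |y| * t ^ μ ≤ C1 → |y| ≤ C * (1 + t) ^ (-μ) := by
      intro y hy
      calc |y| ≤ C1 * (t ^ μ)⁻¹ := by rwa [← div_eq_mul_inv, le_div_iff₀ hpos]
        _ ≤ C1 * (2 ^ μ * (1 + t) ^ (-μ)) := by gcongr; exact hp μ hμ
        _ = C1 * 2 ^ μ * (1 + t) ^ (-μ) := by ring
        _ ≤ _ := by gcongr; exact hCC.1
    refine ⟨g0 _ f0, g0 _ f1', ?_⟩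
    have : f t + f2 t = -(2 * μ * f1 t) / t := by
      rw [← hode t]; field_simp
    rw [this, abs_div, abs_neg, abs_mul, abs_of_pos ht0, abs_of_nonneg (by positivity : 0 ≤ 2 * μ)]
    calc 2 * μ * |f1 t| / t = 2 * μ * (|f1 t| * t ^ μ) * (t ^ (μ + 1))⁻¹ := by
          rw [Real.rpow_add_one ht0.ne']; field_simp
      _ ≤ 2 * μ * C1 * (2 ^ (μ + 1) * (1 + t) ^ (-(μ + 1))) := by gcongr; exact hp _ (by linarith)
      _ = 2 * μ * C1 * 2 ^ (μ + 1) * (1 + t) ^ (-μ - 1) := by rw [neg_add']; ring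
      _ ≤ _ := by gcongr; exact hCC.2.2

end Bessel2




section Bessel3
variable {F : Type*} [NormedAddCommGroup F] [InnerProductSpace ℝ F] [FiniteDimensional ℝ F]
  [MeasurableSpace F] [BorelSpace F]

lemma bes2_continuous (e : F) : Continuous (bes2 e) := by
  rw [continuous_iff_continuousAt]
  intro t
  have : HasDerivAt (bes2 e) (∫ ω : Metric.sphere (0:F) 1, (⟪e, (ω : F)⟫ ^ 3 * sin (t * ⟪e, (ω : F)⟫)) ∂(sph F)) t := by
    refine sph_hasDerivAt (g := fun t (ω : Metric.sphere (0:F) 1) => -(⟪e, (ω : F)⟫ ^ 2 * cos (t * ⟪e, (ω : F)⟫)))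
      (g' := fun t (ω : Metric.sphere (0:F) 1) => (⟪e, (ω : F)⟫ ^ 3 * sin (t * ⟪e, (ω : F)⟫)))
      (fun t => by fun_prop) (by unfold Function.uncurry; fun_prop) (fun t ω => ?_) t
    have := ((((hasDerivAt_id' t).mul_const ⟪e, (ω : F)⟫).cos).const_mul (⟪e, (ω : F)⟫ ^ 2)).neg
    refine this.congr_deriv ?_
    ring
  exact this.continuousAt

lemma bes0_continuous (e : F) : Continuous (bes0 e) :=
  continuous_iff_continuousAt.2 fun t => (bes0_hasDerivAt e t).continuousAt

lemma bes1_continuous (e : F) : Continuous (bes1 e) :=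
  continuous_iff_continuousAt.2 fun t => (bes1_hasDerivAt e t).continuousAt

lemma sph_bound {G : Type*} [NormedAddCommGroup G] [NormedSpace ℝ G]
    {f : Metric.sphere (0 : F) 1 → G} {B : ℝ} (hf : ∀ ω, ‖f ω‖ ≤ B) :
    ‖∫ ω, f ω ∂(sph F)‖ ≤ B * (sph F).real Set.univ :=
  norm_integral_le_of_norm_le_const (Eventually.of_forall hf)

lemma abs_inner_sphere_le (e : F) (he : ‖e‖ = 1) (ω : Metric.sphere (0:F) 1) : |⟪e, (ω : F)⟫| ≤ 1 := by
  have := abs_real_inner_le_norm e (ω : F)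
  simpa [he] using this

lemma bes_decay (F : Type*) [NormedAddCommGroup F] [InnerProductSpace ℝ F] [FiniteDimensional ℝ F]
    [MeasurableSpace F] [BorelSpace F] : ∃ C : ℝ, 0 ≤ C ∧ ∀ e : F, ‖e‖ = 1 → ∀ t, 0 ≤ t →
    |bes0 e t| ≤ C * (1 + t) ^ (-(((Module.finrank ℝ F : ℝ) - 1) / 2)) ∧
    |bes1 e t| ≤ C * (1 + t) ^ (-(((Module.finrank ℝ F : ℝ) - 1) / 2)) ∧
    |bes0 e t + bes2 e t| ≤ C * (1 + t) ^ (-(((Module.finrank ℝ F : ℝ) - 1) / 2) - 1) := by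
  rcases subsingleton_or_nontrivial F with hF | hF
  · refine ⟨0, le_rfl, fun e he => ?_⟩
    rw [Subsingleton.elim e 0, norm_zero] at he
    exact absurd he (by norm_num)
  have hn : 0 ≤ ((Module.finrank ℝ F : ℝ) - 1) / 2 := by
    have : 1 ≤ Module.finrank ℝ F := Module.finrank_pos
    have : (1:ℝ) ≤ Module.finrank ℝ F := by exact_mod_cast this
    linarith
  obtain ⟨C, hC, h⟩ := ode_decay (((Module.finrank ℝ F : ℝ) - 1) / 2) ((sph F).real Set.univ) hn (by positivity)
  refine ⟨C, hC, fun e he t ht => h (bes0 e) (bes1 e) (bes2 e) (bes0_hasDerivAt e) (bes1_hasDerivAt e) ?_ ?_ ?_ ?_ t ht⟩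
  · intro t; rw [bes_ode e he t]; ring
  · intro t
    rw [← one_mul ((sph F).real _)]
    refine sph_bound (f := fun ω : Metric.sphere (0:F) 1 => cos (t * ⟪e, (ω : F)⟫)) fun ω => ?_
    exact abs_cos_le_one _
  · intro t
    rw [← one_mul ((sph F).real _)]
    refine sph_bound (f := fun ω : Metric.sphere (0:F) 1 => -(⟪e, (ω : F)⟫ * sin (t * ⟪e, (ω : F)⟫))) fun ω => ?_
    rw [norm_neg, norm_mul]
    exact mul_le_one₀ (abs_inner_sphere_le e he ω) (norm_nonneg _) (abs_sin_le_one _)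
  · intro t
    rw [← one_mul ((sph F).real _)]
    refine sph_bound (f := fun ω : Metric.sphere (0:F) 1 => -(⟪e, (ω : F)⟫ ^ 2 * cos (t * ⟪e, (ω : F)⟫))) fun ω => ?_
    rw [norm_neg, norm_mul, norm_pow]
    exact mul_le_one₀ (pow_le_one₀ (norm_nonneg _) (abs_inner_sphere_le e he ω)) (norm_nonneg _) (abs_cos_le_one _)

lemma sph_zonal {G : Type*} [NormedAddCommGroup G] [NormedSpace ℝ G] (v w : F) (h : ‖v‖ = ‖w‖)
    (f : ℝ → G) :
    ∫ ω : Metric.sphere (0:F) 1, f ⟪v, (ω : F)⟫ ∂(sph F) = ∫ ω : Metric.sphere (0:F) 1, f ⟪w, (ω : F)⟫ ∂(sph F) := by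
  rw [← sph_integral_iso (Submodule.reflection (ℝ ∙ (v - w))ᗮ) (fun x => f ⟪w, x⟫)]
  congr 1; ext ω
  congr 1
  rw [← LinearIsometryEquiv.inner_map_map (Submodule.reflection (ℝ ∙ (v - w))ᗮ) v, Submodule.reflection_sub h]

lemma sph_neg {G : Type*} [NormedAddCommGroup G] [NormedSpace ℝ G] (f : F → G) :
    ∫ ω : Metric.sphere (0:F) 1, f (-ω) ∂(sph F) = ∫ ω : Metric.sphere (0:F) 1, f ω ∂(sph F) :=
  sph_integral_iso (LinearIsometryEquiv.neg ℝ) f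

lemma sph_exp (e x : F) (he : ‖e‖ = 1) :
    ∫ ω : Metric.sphere (0:F) 1, Complex.exp ((⟪x, (ω : F)⟫ : ℝ) * Complex.I) ∂(sph F) = bes0 e ‖x‖ := by
  rw [sph_zonal x (‖x‖ • e) (by simp [norm_smul, he]) (fun y => Complex.exp ((y : ℝ) * Complex.I))]
  have h1 : ∀ ω : Metric.sphere (0:F) 1, Complex.exp ((⟪‖x‖ • e, (ω : F)⟫ : ℝ) * Complex.I) =
      ((cos (‖x‖ * ⟪e, (ω : F)⟫) : ℝ) : ℂ) + ((sin (‖x‖ * ⟪e, (ω : F)⟫) : ℝ) : ℂ) * Complex.I := by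
    intro ω
    rw [Complex.exp_mul_I, real_inner_smul_left]
    push_cast; rfl
  simp_rw [h1]
  rw [integral_add (sph_integrable (by fun_prop)) (sph_integrable (by fun_prop)), integral_mul_const,
    integral_complex_ofReal, integral_complex_ofReal]
  have h2 : ∫ ω : Metric.sphere (0:F) 1, sin (‖x‖ * ⟪e, (ω : F)⟫) ∂(sph F) = 0 := by
    have := sph_neg (F := F) (fun x' => sin (‖x‖ * ⟪e, x'⟫))
    simp only [inner_neg_right, mul_neg, sin_neg, integral_neg] at this
    linarith
  rw [h2]; simp [bes0]

lemma sph_sq_exp_bound (F : Type*) [NormedAddCommGroup F] [InnerProductSpace ℝ F] [FiniteDimensional ℝ F]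
    [MeasurableSpace F] [BorelSpace F] : ∃ C : ℝ, 0 ≤ C ∧ ∀ e0 x : F, ‖e0‖ = 1 →
    ‖∫ ω : Metric.sphere (0:F) 1, ((⟪e0, (ω : F)⟫ ^ 2 : ℝ) : ℂ) * Complex.exp ((⟪x, (ω : F)⟫ : ℝ) * Complex.I) ∂(sph F)‖
      ≤ C * (1 + ‖x‖) ^ (-(((Module.finrank ℝ F : ℝ) - 1) / 2)) := by
  obtain ⟨C, hC, h⟩ := bes_decay F
  set μ := ((Module.finrank ℝ F : ℝ) - 1) / 2 with hμ
  set M := (sph F).real Set.univ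
  refine ⟨3 * C + M * 2 ^ μ, by positivity, fun e0 x he0 => ?_⟩
  have hn : 0 ≤ μ := by
    have : Nontrivial F := ⟨e0, 0, by intro h; rw [h, norm_zero] at he0; exact one_ne_zero he0.symm⟩
    have : 1 ≤ Module.finrank ℝ F := Module.finrank_pos
    have : (1:ℝ) ≤ Module.finrank ℝ F := by exact_mod_cast this
    rw [hμ]; linarith
  have hpos : 0 < (1 + ‖x‖) ^ (-μ) := by positivity
  rcases le_total ‖x‖ 1 with hx | hx
  · have b1 : ‖∫ ω : Metric.sphere (0:F) 1, ((⟪e0, (ω : F)⟫ ^ 2 : ℝ) : ℂ) * Complex.exp ((⟪x, (ω : F)⟫ : ℝ) * Complex.I) ∂(sph F)‖ ≤ 1 * M := by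
      refine sph_bound fun ω => ?_
      rw [norm_mul, Complex.norm_exp_ofReal_mul_I, mul_one, Complex.norm_real, norm_pow]
      exact pow_le_one₀ (norm_nonneg _) (abs_inner_sphere_le e0 he0 ω)
    have hp : (1:ℝ) ≤ 2 ^ μ * (1 + ‖x‖) ^ (-μ) := by
      rw [Real.rpow_neg (by positivity), ← div_eq_mul_inv, one_le_div (by positivity)]
      exact Real.rpow_le_rpow (by positivity) (by linarith) hn
    have hM : 0 ≤ M := by positivity
    nlinarith [mul_le_mul_of_nonneg_left hp hM, mul_nonneg hC hpos.le]
  · have hx0 : 0 < ‖x‖ := by linarith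
    set R := ‖x‖ with hR
    set e := R⁻¹ • x with he
    have he1 : ‖e‖ = 1 := by rw [he, norm_smul, norm_inv, norm_norm, ← hR, inv_mul_cancel₀ hx0.ne']
    have hxe : x = R • e := by rw [he, smul_smul, mul_inv_cancel₀ hx0.ne', one_smul]
    set c := ⟪e0, e⟫ with hc
    set w := e0 - c • e with hw
    have hwe : ⟪w, e⟫ = 0 := by
      rw [hw, inner_sub_left, real_inner_smul_left, real_inner_self_eq_norm_sq, he1]; simp [hc]
    have he0' : e0 = c • e + w := by rw [hw]; abel
    have hcw : c ^ 2 + ‖w‖ ^ 2 = 1 := by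
      have : ‖e0‖ ^ 2 = 1 := by rw [he0]; norm_num
      rw [he0', ← real_inner_self_eq_norm_sq] at this
      have h' : ⟪e, w⟫ = 0 := by rw [real_inner_comm]; exact hwe
      simp only [inner_add_left, inner_add_right, real_inner_smul_left, real_inner_smul_right, hwe, h',
        real_inner_self_eq_norm_sq, norm_smul, he1, mul_one, norm_eq_abs, sq_abs] at this
      linarith
    have h1 : ∀ ω : Metric.sphere (0:F) 1, ((⟪e0, (ω : F)⟫ ^ 2 : ℝ) : ℂ) * Complex.exp ((⟪x, (ω : F)⟫ : ℝ) * Complex.I) =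
      ((⟪e0, (ω : F)⟫ ^ 2 * cos (R * ⟪e, (ω : F)⟫) : ℝ) : ℂ) + ((⟪e0, (ω : F)⟫ ^ 2 * sin (R * ⟪e, (ω : F)⟫) : ℝ) : ℂ) * Complex.I := by
      intro ω
      rw [Complex.exp_mul_I, hxe, real_inner_smul_left]
      push_cast; ring
    simp_rw [h1]
    rw [integral_add (sph_integrable (by fun_prop)) (sph_integrable (by fun_prop)), integral_mul_const,
      integral_complex_ofReal, integral_complex_ofReal]
    have h2 : ∫ ω : Metric.sphere (0:F) 1, ⟪e0, (ω : F)⟫ ^ 2 * sin (R * ⟪e, (ω : F)⟫) ∂(sph F) = 0 := by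
      have := sph_neg (F := F) (fun x' => ⟪e0, x'⟫ ^ 2 * sin (R * ⟪e, x'⟫))
      simp only [inner_neg_right, mul_neg, sin_neg, integral_neg, neg_sq] at this
      linarith
    rw [h2, Complex.ofReal_zero, zero_mul, add_zero, Complex.norm_real]
    have h3 : ∀ ω : Metric.sphere (0:F) 1, ⟪e0, (ω : F)⟫ ^ 2 * cos (R * ⟪e, (ω : F)⟫) =
        (- c ^ 2) * -(⟪e, (ω : F)⟫ ^ 2 * cos (R * ⟪e, (ω : F)⟫))
        + ⟪w, (ω : F)⟫ * (2 * c * ⟪e, (ω : F)⟫ * cos (R * ⟪e, (ω : F)⟫))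
        + ⟪w, (ω : F)⟫ ^ 2 * cos (R * ⟪e, (ω : F)⟫) := by
      intro ω
      rw [he0', inner_add_left, real_inner_smul_left]; ring
    simp_rw [h3]
    rw [integral_add (sph_integrable (by fun_prop)) (sph_integrable (by fun_prop)),
      integral_add (sph_integrable (by fun_prop)) (sph_integrable (by fun_prop)), integral_const_mul,
      sph_odd w e hwe (fun y => 2 * c * y * cos (R * y)), add_zero]
    have h4 := bes_key w e hwe he1 R
    set J := ∫ ω : Metric.sphere (0:F) 1, ⟪w, (ω : F)⟫ ^ 2 * cos (R * ⟪e, (ω : F)⟫) ∂(sph F)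
    have hb2 : ∫ ω : Metric.sphere (0:F) 1, -(⟪e, (ω : F)⟫ ^ 2 * cos (R * ⟪e, (ω : F)⟫)) ∂(sph F) = bes2 e R := rfl
    rw [hb2]
    obtain ⟨g0, g1, g2⟩ := h e he1 R hx0.le
    have g2' : |bes0 e R + bes2 e R| ≤ C * (1 + R) ^ (-μ) := by
      refine g2.trans ?_
      gcongr
      · linarith
      · linarith
    have gb : |bes2 e R| ≤ 2 * (C * (1 + R) ^ (-μ)) := by
      have : bes2 e R = (bes0 e R + bes2 e R) - bes0 e R := by ring
      rw [this]
      refine (abs_sub _ _).trans ?_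
      linarith
    have hJ : |J| ≤ C * (1 + R) ^ (-μ) := by
      have : |J| ≤ R * |J| := by nlinarith [abs_nonneg J]
      refine this.trans ?_
      rw [← abs_of_pos hx0, ← abs_mul, abs_of_pos hx0, h4, abs_neg, abs_mul, abs_of_nonneg (sq_nonneg _)]
      nlinarith [abs_nonneg (bes1 e R), sq_nonneg c]
    rw [Real.norm_eq_abs]
    have hM : 0 ≤ M * 2 ^ μ * (1 + R) ^ (-μ) := by positivity
    calc |(-c ^ 2) * bes2 e R + J| ≤ |(-c ^ 2) * bes2 e R| + |J| := abs_add_le _ _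
      _ ≤ |bes2 e R| + |J| := by
        refine add_le_add ?_ le_rfl
        rw [abs_mul, abs_neg, abs_of_nonneg (sq_nonneg _)]
        nlinarith [abs_nonneg (bes2 e R), sq_nonneg ‖w‖]
      _ ≤ _ := by nlinarith

/-- the amplitude in `bes0 e t = e^{it} A + conj (e^{it} A)`. -/
def besA (e : F) (t : ℝ) : ℂ := Complex.exp (-(t * Complex.I)) * ((bes0 e t : ℂ) - Complex.I * bes1 e t) / 2
def besA1 (e : F) (t : ℝ) : ℂ := -(Complex.I / 2) * Complex.exp (-(t * Complex.I)) * ((bes0 e t + bes2 e t : ℝ) : ℂ)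

lemma besA_hasDerivAt (e : F) (t : ℝ) : HasDerivAt (besA e) (besA1 e t) t := by
  have h0 : HasDerivAt (fun t => (bes0 e t : ℂ)) (bes1 e t : ℂ) t := (bes0_hasDerivAt e t).ofReal_comp
  have h1 : HasDerivAt (fun t => (bes1 e t : ℂ)) (bes2 e t : ℂ) t := (bes1_hasDerivAt e t).ofReal_comp
  have h2 : HasDerivAt (fun t : ℝ => (t : ℂ)) 1 t := Complex.ofRealCLM.hasDerivAt
  have h3 := (((h2.mul_const Complex.I).neg.cexp).mul (h0.sub (h1.const_mul Complex.I))).div_const 2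
  refine h3.congr_deriv ?_
  simp only [besA1]
  simp only [Pi.neg_apply, Pi.sub_apply]
  push_cast
  linear_combination (Complex.exp (-(t * Complex.I)) * (bes1 e t) / 2) * Complex.I_sq

lemma besA1_continuous (e : F) : Continuous (besA1 e) := by
  have := bes0_continuous e
  have := bes2_continuous e
  unfold besA1; fun_prop

lemma besA_continuous (e : F) : Continuous (besA e) := by
  have := bes0_continuous e
  have := bes1_continuous e
  unfold besA; fun_prop

lemma bes0_eq_besA (e : F) (t : ℝ) :
    (bes0 e t : ℂ) = Complex.exp (t * Complex.I) * besA e t + Complex.exp (-(t * Complex.I)) * (starRingEnd ℂ) (besA e t) := by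
  have h : Complex.exp (t * Complex.I) * Complex.exp (-(t * Complex.I)) = 1 := by
    rw [← Complex.exp_add, add_neg_cancel, Complex.exp_zero]
  simp only [besA, map_div₀, map_mul, map_sub, Complex.conj_ofReal, Complex.conj_I, ← Complex.exp_conj, map_neg, mul_neg, neg_neg]
  have h2 : (starRingEnd ℂ) 2 = 2 := Complex.conj_ofNat 2
  rw [h2]
  linear_combination (-(bes0 e t : ℂ)) * h

lemma besA_decay (F : Type*) [NormedAddCommGroup F] [InnerProductSpace ℝ F] [FiniteDimensional ℝ F]
    [MeasurableSpace F] [BorelSpace F] : ∃ C : ℝ, 0 ≤ C ∧ ∀ e : F, ‖e‖ = 1 → ∀ t, 0 ≤ t →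
    ‖besA e t‖ ≤ C * (1 + t) ^ (-(((Module.finrank ℝ F : ℝ) - 1) / 2)) ∧
    ‖besA1 e t‖ ≤ C * (1 + t) ^ (-(((Module.finrank ℝ F : ℝ) - 1) / 2) - 1) := by
  obtain ⟨C, hC, h⟩ := bes_decay F
  refine ⟨C, hC, fun e he t ht => ?_⟩
  obtain ⟨g0, g1, g2⟩ := h e he t ht
  have hexp : ‖Complex.exp (-(t * Complex.I))‖ = 1 := by
    have := Complex.norm_exp_ofReal_mul_I (-t)
    rwa [Complex.ofReal_neg, neg_mul] at this
  constructor
  · rw [besA, norm_div, norm_mul, hexp]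
    have : ‖(bes0 e t : ℂ) - Complex.I * bes1 e t‖ ≤ |bes0 e t| + |bes1 e t| := by
      refine (norm_sub_le _ _).trans ?_
      simp
    simp only [one_mul, Complex.norm_ofNat]
    linarith
  · rw [besA1, norm_mul, norm_mul, hexp, Complex.norm_real, Real.norm_eq_abs]
    simp only [norm_neg, norm_div, Complex.norm_I, Complex.norm_ofNat, mul_one]
    have := abs_nonneg (bes0 e t + bes2 e t)
    linarith

end Bessel3




section Polar
variable {F : Type*} [NormedAddCommGroup F] [InnerProductSpace ℝ F] [FiniteDimensional ℝ F]
  [MeasurableSpace F] [BorelSpace F]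

lemma polar_point (x : ({0}ᶜ : Set F)) :
    ((homeomorphUnitSphereProd F x).2 : ℝ) • ((homeomorphUnitSphereProd F x).1 : F) = x := by
  have := (homeomorphUnitSphereProd F).symm_apply_apply x
  rw [← homeomorphUnitSphereProd_symm_apply_coe, this]

lemma integral_polar [Nontrivial F] {f : F → ℂ} (hf : Integrable f) :
    ∫ x, f x = ∫ r in Set.Ioi (0:ℝ), ((r ^ (Module.finrank ℝ F - 1) : ℝ) : ℂ) *
      ∫ ω : Metric.sphere (0:F) 1, f (r • (ω : F)) ∂(sph F) := by
  let g : Metric.sphere (0:F) 1 × Set.Ioi (0:ℝ) → ℂ := fun z => f ((z.2 : ℝ) • (z.1 : F))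
  have hmp := (volume : Measure F).measurePreserving_homeomorphUnitSphereProd
  have hg : ∀ x : ({0}ᶜ : Set F), g (homeomorphUnitSphereProd F x) = f x := fun x => by
    simp only [g]; rw [polar_point]
  have hintq : Integrable g ((sph F).prod (.volumeIoiPow (Module.finrank ℝ F - 1))) := by
    rw [← hmp.integrable_comp_emb (Homeomorph.measurableEmbedding _)]
    have h2 : Integrable (fun x : ({0}ᶜ : Set F) => f x) (Measure.comap Subtype.val volume) := by
      have := (integrableOn_iff_comap_subtypeVal (μ := (volume : Measure F)) (f := f) (s := ({0}ᶜ : Set F))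
        (measurableSet_singleton _).compl).1 hf.integrableOn
      exact this
    refine h2.congr (Eventually.of_forall fun x => ?_)
    exact (hg x).symm
  calc ∫ x, f x = ∫ x : ({(0)}ᶜ : Set F), f x ∂((volume : Measure F).comap (↑)) := by
        rw [integral_subtype_comap (measurableSet_singleton _).compl f, restrict_compl_singleton]
    _ = ∫ z, g z ∂((sph F).prod (.volumeIoiPow (Module.finrank ℝ F - 1))) := by
        rw [← hmp.integral_comp (Homeomorph.measurableEmbedding _)]
        simp only [hg]
    _ = ∫ r : Set.Ioi (0:ℝ), (∫ ω : Metric.sphere (0:F) 1, f ((r:ℝ) • (ω : F)) ∂(sph F)) ∂(.volumeIoiPow (Module.finrank ℝ F - 1)) := by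
        rw [integral_prod_symm _ hintq]
    _ = _ := by
      simp only [Measure.volumeIoiPow, ENNReal.ofReal]
      rw [integral_withDensity_eq_integral_smul,
        integral_subtype_comap measurableSet_Ioi fun a => Real.toNNReal (a ^ (Module.finrank ℝ F - 1)) •
          ∫ ω : Metric.sphere (0:F) 1, f ((a:ℝ) • (ω : F)) ∂(sph F),
        setIntegral_congr_fun measurableSet_Ioi fun x hx => ?_]
      · rw [NNReal.smul_def, Real.coe_toNNReal _ (pow_nonneg hx.out.le _), Complex.real_smul]
      · exact (measurable_subtype_coe.pow_const _).real_toNNReal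

lemma lintegral_polar [Nontrivial F] {f : F → ℝ≥0∞} (hf : Measurable f) :
    ∫⁻ x, f x = ∫⁻ r in Set.Ioi (0:ℝ), ENNReal.ofReal (r ^ (Module.finrank ℝ F - 1)) *
      ∫⁻ ω : Metric.sphere (0:F) 1, f (r • (ω : F)) ∂(sph F) := by
  let g : Metric.sphere (0:F) 1 × Set.Ioi (0:ℝ) → ℝ≥0∞ := fun z => f ((z.2 : ℝ) • (z.1 : F))
  have hmp := (volume : Measure F).measurePreserving_homeomorphUnitSphereProd
  have hg : ∀ x : ({0}ᶜ : Set F), g (homeomorphUnitSphereProd F x) = f x := fun x => by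
    simp only [g]; rw [polar_point]
  have hgm : Measurable g := hf.comp (by
    refine Continuous.measurable ?_
    exact (continuous_subtype_val.comp continuous_snd).smul (continuous_subtype_val.comp continuous_fst))
  have hG : Measurable fun r : ℝ => ∫⁻ ω : Metric.sphere (0:F) 1, f (r • (ω : F)) ∂(sph F) := by
    refine Measurable.lintegral_prod_right' (f := fun z : ℝ × Metric.sphere (0:F) 1 => f (z.1 • (z.2 : F))) (hf.comp ?_)
    refine Continuous.measurable ?_
    exact continuous_fst.smul (continuous_subtype_val.comp continuous_snd)
  have hG' : Measurable (fun r : Set.Ioi (0:ℝ) => ∫⁻ ω : Metric.sphere (0:F) 1, f ((r:ℝ) • (ω : F)) ∂(sph F)) :=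
    hG.comp measurable_subtype_coe
  calc ∫⁻ x, f x = ∫⁻ x : ({(0)}ᶜ : Set F), f x ∂((volume : Measure F).comap (↑)) := by
        rw [lintegral_subtype_comap (measurableSet_singleton _).compl f, restrict_compl_singleton]
    _ = ∫⁻ z, g z ∂((sph F).prod (.volumeIoiPow (Module.finrank ℝ F - 1))) := by
        rw [← hmp.lintegral_comp_emb (Homeomorph.measurableEmbedding _)]
        simp only [hg]
    _ = ∫⁻ r : Set.Ioi (0:ℝ), (∫⁻ ω : Metric.sphere (0:F) 1, f ((r:ℝ) • (ω : F)) ∂(sph F)) ∂(.volumeIoiPow (Module.finrank ℝ F - 1)) := by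
        rw [lintegral_prod_symm _ hgm.aemeasurable]
    _ = _ := by
      simp only [Measure.volumeIoiPow]
      rw [lintegral_withDensity_eq_lintegral_mul _ (by fun_prop) hG',
        ← lintegral_subtype_comap measurableSet_Ioi]
      rfl

lemma lintegral_radial [Nontrivial F] {f : ℝ → ℝ≥0∞} (hf : Measurable f) :
    ∫⁻ x : F, f ‖x‖ = (sph F) Set.univ * ∫⁻ r in Set.Ioi (0:ℝ), ENNReal.ofReal (r ^ (Module.finrank ℝ F - 1)) * f r := by
  rw [lintegral_polar (f := fun x : F => f ‖x‖) (hf.comp measurable_norm), ← lintegral_const_mul _ (by fun_prop)]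
  refine setLIntegral_congr_fun measurableSet_Ioi fun r hr => ?_
  have : ∀ ω : Metric.sphere (0:F) 1, ‖r • (ω:F)‖ = r := fun ω => by
    rw [norm_smul, Real.norm_of_nonneg (le_of_lt hr)]; simp
  simp only [this, lintegral_const]
  ring

end Polar

section Kernel

/-- the κ-integral is bounded -/
lemma lintegral_kappa (h : ℝ → ℝ≥0∞) (hsupp : ∀ r, 3/2 < r → h r = 0) (ρ : ℝ) :
    ∫⁻ κ in Set.Ioi (0:ℝ), ENNReal.ofReal (κ ^ 2) * h (√(ρ ^ 2 + κ ^ 2)) ≤ ENNReal.ofReal (9/4) * ∫⁻ r, h r := by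
  have hpos : ∀ κ : ℝ, κ ∈ Set.Ioi (0:ℝ) → 0 < ρ ^ 2 + κ ^ 2 := fun κ hκ => by
    have : 0 < κ := hκ
    positivity
  have key := lintegral_image_eq_lintegral_abs_deriv_mul (s := Set.Ioi (0:ℝ)) (f := fun κ => √(ρ ^ 2 + κ ^ 2))
    (f' := fun κ => κ / √(ρ ^ 2 + κ ^ 2)) measurableSet_Ioi (fun κ hκ => by
      have h1 : HasDerivAt (fun κ : ℝ => ρ ^ 2 + κ ^ 2) (2 * κ) κ := by
        simpa using (hasDerivAt_pow 2 κ).const_add (ρ ^ 2)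
      have := h1.sqrt (hpos κ hκ).ne'
      refine (this.congr_deriv ?_).hasDerivWithinAt
      field_simp) (fun κ hκ κ' hκ' he => by
      have h1 : ρ ^ 2 + κ ^ 2 = ρ ^ 2 + κ' ^ 2 := by
        rwa [Real.sqrt_inj (hpos κ hκ).le (hpos κ' hκ').le] at he
      have hκ0 : 0 < κ := hκ
      have hκ0' : 0 < κ' := hκ'
      nlinarith [sq_nonneg (κ - κ')])
    (fun r => ENNReal.ofReal (r * √(r ^ 2 - ρ ^ 2)) * h r)
  have e1 : ∫⁻ κ in Set.Ioi (0:ℝ), ENNReal.ofReal (κ ^ 2) * h (√(ρ ^ 2 + κ ^ 2)) =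
      ∫⁻ κ in Set.Ioi (0:ℝ), ENNReal.ofReal |κ / √(ρ ^ 2 + κ ^ 2)| *
        (ENNReal.ofReal (√(ρ ^ 2 + κ ^ 2) * √((√(ρ ^ 2 + κ ^ 2)) ^ 2 - ρ ^ 2)) * h (√(ρ ^ 2 + κ ^ 2))) := by
    refine setLIntegral_congr_fun measurableSet_Ioi fun κ hκ => ?_
    have hκ0 : 0 < κ := hκ
    have hp := hpos κ hκ
    rw [← mul_assoc, ← ENNReal.ofReal_mul (abs_nonneg _), Real.sq_sqrt hp.le, add_sub_cancel_left, Real.sqrt_sq hκ0.le,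
      abs_of_pos (div_pos hκ0 (Real.sqrt_pos.2 hp))]
    congr 2
    have := (Real.sqrt_pos.2 hp).ne'
    field_simp
  rw [e1, ← key]
  refine (setLIntegral_le_lintegral _ _).trans ?_
  rw [← lintegral_const_mul' _ _ (by simp)]
  refine lintegral_mono fun r => ?_
  rcases le_or_gt r (3/2) with hr | hr
  · refine mul_le_mul_left (ENNReal.ofReal_le_ofReal ?_) _
    rcases le_or_gt r 0 with h0 | h0
    · have := Real.sqrt_nonneg (r ^ 2 - ρ ^ 2)
      nlinarith
    · have : √(r ^ 2 - ρ ^ 2) ≤ r := by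
        rw [Real.sqrt_le_left h0.le]; nlinarith [sq_nonneg ρ]
      nlinarith
  · simp [hsupp r hr]

variable {E : Type*} [NormedAddCommGroup E] [InnerProductSpace ℝ E] [FiniteDimensional ℝ E]
  [MeasurableSpace E] [BorelSpace E]

end Kernel




section Kernel2

/-- admissible weights -/
structure IsW (h : ℝ → ℝ) : Prop where
  meas : Measurable h
  nn : ∀ r, 0 ≤ h r
  supp : ∀ r, ¬ (1/2 ≤ r ∧ r ≤ 3/2) → h r = 0
  int : Integrable h

lemma kerF_bound (F : Type*) [NormedAddCommGroup F] [InnerProductSpace ℝ F] [FiniteDimensional ℝ F]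
    [MeasurableSpace F] [BorelSpace F] : ∃ C : ℝ, 0 ≤ C ∧ ∀ h : ℝ → ℝ, IsW h → ∀ e0 x : F, ‖e0‖ = 1 →
    Integrable (fun ξ : F => ⟪e0, ξ⟫ ^ 2 * h ‖ξ‖) ∧
    ‖∫ ξ : F, ((⟪e0, ξ⟫ ^ 2 * h ‖ξ‖ : ℝ) : ℂ) * Complex.exp ((2 * π * ⟪x, ξ⟫ : ℝ) * Complex.I)‖
      ≤ C * (∫ r, h r) * (1 + ‖x‖) ^ (-(((Module.finrank ℝ F : ℝ) - 1) / 2)) := by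
  obtain ⟨C0, hC0, hb⟩ := sph_sq_exp_bound F
  set n := Module.finrank ℝ F with hn
  set μ := ((n : ℝ) - 1) / 2 with hμ
  refine ⟨(3/2) ^ (n + 1) * C0, by positivity, fun h hw e0 x he0 => ?_⟩
  have hnt : Nontrivial F := ⟨e0, 0, by intro h; rw [h, norm_zero] at he0; exact one_ne_zero he0.symm⟩
  have hn1 : 1 ≤ n := Module.finrank_pos
  have hμ0 : 0 ≤ μ := by
    have : (1:ℝ) ≤ n := by exact_mod_cast hn1
    rw [hμ]; linarith
  have hpw : ∀ r : ℝ, 0 < r → r ^ (n - 1) * (r ^ 2 * h r) ≤ (3/2) ^ (n + 1) * h r := by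
    intro r hr
    by_cases hr2 : 1/2 ≤ r ∧ r ≤ 3/2
    · rw [← mul_assoc, ← pow_add, show n - 1 + 2 = n + 1 by omega]
      exact mul_le_mul_of_nonneg_right (pow_le_pow_left₀ hr.le hr2.2 _) (hw.nn r)
    · simp [hw.supp r hr2]
  have hintq : Integrable (fun ξ : F => ⟪e0, ξ⟫ ^ 2 * h ‖ξ‖) := by
    have h1 : Integrable (fun ξ : F => ‖ξ‖ ^ 2 * h ‖ξ‖) := by
      rw [integrable_fun_norm_addHaar volume (f := fun r => r ^ 2 * h r)]
      refine Integrable.mono' (g := fun r => (3/2) ^ (n + 1) * h r) (hw.int.integrableOn.const_mul _) ?_ ?_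
      · have := hw.meas
        exact Measurable.aestronglyMeasurable (by fun_prop)
      · refine (ae_restrict_iff' measurableSet_Ioi).2 (Eventually.of_forall fun r hr => ?_)
        have hr0 : 0 < r := hr
        have := hw.nn r
        rw [Real.norm_of_nonneg (by positivity)]
        exact hpw r hr0
    refine h1.mono' ?_ (Eventually.of_forall fun ξ => ?_)
    · have := hw.meas
      exact Measurable.aestronglyMeasurable (by fun_prop)
    · have := hw.nn ‖ξ‖
      rw [norm_mul, norm_pow, Real.norm_of_nonneg this]
      have h2 := abs_real_inner_le_norm e0 ξ
      rw [he0, one_mul] at h2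
      gcongr
      exact h2
  refine ⟨hintq, ?_⟩
  have hint2 : Integrable (fun ξ : F => ((⟪e0, ξ⟫ ^ 2 * h ‖ξ‖ : ℝ) : ℂ) * Complex.exp ((2 * π * ⟪x, ξ⟫ : ℝ) * Complex.I)) := by
    refine hintq.ofReal.mul_bdd (c := 1) ?_ (Eventually.of_forall fun ξ => ?_)
    · exact Continuous.aestronglyMeasurable (by fun_prop)
    · rw [Complex.norm_exp_ofReal_mul_I]
  rw [integral_polar hint2]
  have hbd : ∀ r : ℝ, 0 < r → ‖((r ^ (n - 1) : ℝ) : ℂ) *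
      ∫ ω : Metric.sphere (0:F) 1, ((⟪e0, r • (ω : F)⟫ ^ 2 * h ‖r • (ω : F)‖ : ℝ) : ℂ) *
        Complex.exp ((2 * π * ⟪x, r • (ω : F)⟫ : ℝ) * Complex.I) ∂(sph F)‖
      ≤ (3/2) ^ (n + 1) * C0 * (1 + ‖x‖) ^ (-μ) * h r := by
    intro r hr
    have e1 : ∀ ω : Metric.sphere (0:F) 1, ((⟪e0, r • (ω : F)⟫ ^ 2 * h ‖r • (ω : F)‖ : ℝ) : ℂ) *
        Complex.exp ((2 * π * ⟪x, r • (ω : F)⟫ : ℝ) * Complex.I) =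
        ((r ^ 2 * h r : ℝ) : ℂ) * (((⟪e0, (ω : F)⟫ ^ 2 : ℝ) : ℂ) * Complex.exp ((⟪(2 * π * r) • x, (ω : F)⟫ : ℝ) * Complex.I)) := by
      intro ω
      have e2 : ‖r • (ω : F)‖ = r := by rw [norm_smul, Real.norm_of_nonneg hr.le]; simp
      rw [e2, real_inner_smul_right, real_inner_smul_right, real_inner_smul_left]
      push_cast
      rw [mul_assoc (2 * (π : ℂ)) r]
      ring
    simp_rw [e1]
    rw [integral_const_mul, ← mul_assoc, ← Complex.ofReal_mul, norm_mul, Complex.norm_real]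
    have h0 := hw.nn r
    rw [Real.norm_of_nonneg (by positivity)]
    by_cases hr2 : 1/2 ≤ r ∧ r ≤ 3/2
    · have e3 : (1 + ‖(2 * π * r) • x‖) ^ (-μ) ≤ (1 + ‖x‖) ^ (-μ) := by
        apply Real.rpow_le_rpow_of_nonpos (by positivity) _ (by linarith)
        rw [norm_smul, Real.norm_of_nonneg (by positivity)]
        have : 1 ≤ 2 * π * r := by nlinarith [Real.pi_gt_three]
        nlinarith [norm_nonneg x]
      calc _ ≤ (3/2) ^ (n + 1) * h r * (C0 * (1 + ‖x‖) ^ (-μ)) := by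
            refine mul_le_mul (hpw r hr) ((hb e0 _ he0).trans ?_) (norm_nonneg _) (by positivity)
            gcongr
        _ = _ := by ring
    · simp [hw.supp r hr2]
  calc _ ≤ ∫ r in Set.Ioi (0:ℝ), (3/2) ^ (n + 1) * C0 * (1 + ‖x‖) ^ (-μ) * h r := by
        refine norm_integral_le_of_norm_le (hw.int.integrableOn.const_mul _) ?_
        exact (ae_restrict_iff' measurableSet_Ioi).2 (Eventually.of_forall hbd)
    _ = (3/2) ^ (n + 1) * C0 * (1 + ‖x‖) ^ (-μ) * ∫ r in Set.Ioi (0:ℝ), h r := by rw [integral_const_mul]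
    _ ≤ (3/2) ^ (n + 1) * C0 * (1 + ‖x‖) ^ (-μ) * ∫ r, h r := by
        exact mul_le_mul_of_nonneg_left (setIntegral_le_integral hw.int (Eventually.of_forall hw.nn)) (by positivity)
    _ = _ := by ring

variable {E : Type*} [NormedAddCommGroup E] [InnerProductSpace ℝ E] [FiniteDimensional ℝ E]
  [MeasurableSpace E] [BorelSpace E]

/-- the density on `E × ℝ` -/
def wt (h : ℝ → ℝ) (p : E × ℝ) : ℝ := p.2 ^ 2 * h (√(‖p.1‖ ^ 2 + p.2 ^ 2))

lemma wt_nonneg {h : ℝ → ℝ} (hw : IsW h) (p : E × ℝ) : 0 ≤ wt h p :=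
  mul_nonneg (sq_nonneg _) (hw.nn _)

lemma wt_measurable {h : ℝ → ℝ} (hw : IsW h) : Measurable (wt h : E × ℝ → ℝ) := by
  have := hw.meas
  unfold wt; fun_prop

/-- plane wave -/
def pw (y : E) (s : ℝ) (p : E × ℝ) : ℂ := Complex.exp ((2 * π * (⟪y, p.1⟫ + s * p.2) : ℝ) * Complex.I)

lemma norm_pw (y : E) (s : ℝ) (p : E × ℝ) : ‖pw y s p‖ = 1 := Complex.norm_exp_ofReal_mul_I _

def kerW (h : ℝ → ℝ) (y : E) (s : ℝ) : ℂ := ∫ p : E × ℝ, (wt h p : ℂ) * pw y s p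

lemma ker_bound (E : Type*) [NormedAddCommGroup E] [InnerProductSpace ℝ E] [FiniteDimensional ℝ E]
    [MeasurableSpace E] [BorelSpace E] : ∃ C : ℝ, 0 ≤ C ∧ ∀ h : ℝ → ℝ, IsW h →
    Integrable (wt h : E × ℝ → ℝ) ∧ ∀ (y : E) (s : ℝ),
    ‖kerW h y s‖ ≤ C * (∫ r, h r) * (1 + |s|) ^ (-((Module.finrank ℝ E : ℝ) / 2)) := by
  obtain ⟨C, hC, hb⟩ := kerF_bound (WithLp 2 (E × ℝ))
  have hfin : (((Module.finrank ℝ (WithLp 2 (E × ℝ)) : ℕ) : ℝ) - 1) / 2 = (Module.finrank ℝ E : ℝ) / 2 := by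
    rw [(WithLp.linearEquiv 2 ℝ (E×ℝ)).finrank_eq]; simp
  rw [hfin] at hb
  refine ⟨C, hC, fun h hw => ?_⟩
  let e0 : WithLp 2 (E × ℝ) := WithLp.toLp 2 (0, 1)
  have he0 : ‖e0‖ = 1 := by simp [e0, WithLp.prod_norm_eq_of_L2]
  have hmp := WithLp.volume_preserving_ofLp E ℝ
  have hemb : MeasurableEmbedding (@WithLp.ofLp 2 (E × ℝ)) :=
    (WithLp.homeomorphProd 2 E ℝ).measurableEmbedding
  have hinner : ∀ (y : E) (s : ℝ) (ξ : WithLp 2 (E × ℝ)), ⟪WithLp.toLp 2 (y, s), ξ⟫ = ⟪y, ξ.fst⟫ + s * ξ.snd := by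
    intro y s ξ
    rw [WithLp.prod_inner_apply]
    simp [mul_comm]
  have hwt : ∀ ξ : WithLp 2 (E × ℝ), wt h ξ.ofLp = ⟪e0, ξ⟫ ^ 2 * h ‖ξ‖ := by
    intro ξ
    rw [hinner, WithLp.prod_norm_eq_of_L2]
    simp [wt]
  constructor
  · rw [← hmp.integrable_comp_emb hemb]
    refine (hb h hw e0 0 he0).1.congr (Eventually.of_forall fun ξ => ?_)
    exact (hwt ξ).symm
  · intro y s
    have h1 := (hb h hw e0 (WithLp.toLp 2 (y, s)) he0).2
    have e : kerW h y s = ∫ ξ : WithLp 2 (E × ℝ), ((⟪e0, ξ⟫ ^ 2 * h ‖ξ‖ : ℝ) : ℂ) *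
        Complex.exp ((2 * π * ⟪WithLp.toLp 2 (y, s), ξ⟫ : ℝ) * Complex.I) := by
      rw [kerW, ← hmp.integral_comp hemb]
      congr 1; ext ξ
      rw [hwt, pw, hinner y s]
      rfl
    rw [e]
    refine h1.trans ?_
    have hH : 0 ≤ ∫ r, h r := integral_nonneg hw.nn
    have hs : |s| ≤ ‖WithLp.toLp 2 (y, s)‖ := by
      rw [WithLp.prod_norm_eq_of_L2]
      apply Real.le_sqrt_of_sq_le
      change |s| ^ 2 ≤ ‖y‖ ^ 2 + |s| ^ 2
      nlinarith [sq_nonneg ‖y‖]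
    gcongr ?_ * ?_
    apply Real.rpow_le_rpow_of_nonpos (by positivity) (by linarith)
    have : (0:ℝ) ≤ (Module.finrank ℝ E : ℝ) := by positivity
    linarith

end Kernel2





section Planch

variable {F : Type*} [NormedAddCommGroup F] [InnerProductSpace ℝ F] [FiniteDimensional ℝ F]
    [MeasurableSpace F] [BorelSpace F]

lemma ae_eq_of_schwartz {U W : F → ℂ} (hU : LocallyIntegrable U) (hW : LocallyIntegrable W)
    (h : ∀ φ : SchwartzMap F ℂ, ∫ x, φ x * U x = ∫ x, φ x * W x) : U =ᵐ[volume] W := by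
  have : ∀ᵐ x, U x - W x = 0 := by
    apply ae_eq_zero_of_integral_contDiff_smul_eq_zero (hU.sub hW)
    intro g hg hgc
    have hc : HasCompactSupport (fun x => (g x : ℂ)) := hgc.comp_left (g := fun r : ℝ => (r : ℂ)) (by simp)
    have hd : ContDiff ℝ (⊤ : ℕ∞) (fun x => (g x : ℂ)) := Complex.ofRealCLM.contDiff.comp hg
    have h1 := h (hc.toSchwartzMap hd)
    have e : ∀ x, (hc.toSchwartzMap hd) x = (g x : ℂ) := fun x => rfl
    simp only [e] at h1
    have i1 : Integrable (fun x => (g x : ℂ) * U x) := by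
      have := hU.integrable_smul_left_of_hasCompactSupport hg.continuous hgc
      simpa using! this
    have i2 : Integrable (fun x => (g x : ℂ) * W x) := by
      have := hW.integrable_smul_left_of_hasCompactSupport hg.continuous hgc
      simpa using! this
    simp only [Complex.real_smul, Pi.sub_apply, mul_sub]
    rw [integral_sub i1 i2, h1, sub_self]
  filter_upwards [this] with x hx
  exact sub_eq_zero.mp hx

lemma fourier_flip {f g : F → ℂ} (hf : Integrable f) (hg : Integrable g) :
    ∫ x, 𝓕 f x * g x = ∫ x, f x * 𝓕 g x := by
  simpa using! (VectorFourier.integral_fourierIntegral_smul_eq_flip (L := innerₗ F)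
      Real.continuous_fourierChar continuous_inner hf hg)

lemma fourierInv_flip {f g : F → ℂ} (hf : Integrable f) (hg : Integrable g) :
    ∫ x, 𝓕⁻ f x * g x = ∫ x, f x * 𝓕⁻ g x := by
  have h1 := fourier_flip hf (g := fun x => g (-x)) hg.comp_neg
  have h2 : ∀ x, 𝓕 (fun x => g (-x)) x = 𝓕⁻ g x := by
    intro x
    rw [Real.fourierInv_eq_fourier_comp_neg]
  simp only [h2] at h1
  rw [← h1, ← integral_neg_eq_self]
  simp [Real.fourierInv_eq_fourier_neg]

lemma fourier_cont {f : F → ℂ} (hf : Integrable f) : Continuous (𝓕 f) :=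
  VectorFourier.fourierIntegral_continuous Real.continuous_fourierChar continuous_inner hf

lemma fourierInv_cont {f : F → ℂ} (hf : Integrable f) : Continuous (𝓕⁻ f) := by
  have : 𝓕⁻ f = fun x => 𝓕 f (-x) := by ext x; rw [Real.fourierInv_eq_fourier_neg]
  rw [this]
  exact (fourier_cont hf).comp continuous_neg

lemma fourier_L2 {f : F → ℂ} (hf : Integrable f) (h2 : MemLp f 2 volume) :
    eLpNorm (𝓕 f) 2 volume = eLpNorm f 2 volume := by
  set g : Lp (α := F) ℂ 2 := h2.toLp f with hg
  have h3 := Lp.fourier_toTemperedDistribution_eq g (E := F)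
  have h4 : ((𝓕 g : Lp (α := F) ℂ 2 volume) : F → ℂ) =ᵐ[volume] 𝓕 f := by
    apply ae_eq_of_schwartz
    · exact (Lp.memLp _).locallyIntegrable (by norm_num)
    · exact (fourier_cont hf).locallyIntegrable
    intro φ
    have h5 := congrArg (fun T => T φ) h3
    simp only [Lp.toTemperedDistribution_apply, TemperedDistribution.fourier_apply, smul_eq_mul] at h5
    rw [← h5]
    have : ∫ x, (𝓕 φ) x * g x = ∫ x, (𝓕 (φ : F → ℂ)) x * f x := by
      apply integral_congr_ae
      filter_upwards [h2.coeFn_toLp] with x hx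
      rw [hg, hx]; rfl
    rw [this, fourier_flip (φ.integrable (μ := volume)) hf]
  have h6 := Lp.norm_fourier_eq g
  rw [Lp.norm_def, Lp.norm_def, ENNReal.toReal_eq_toReal_iff' (Lp.eLpNorm_ne_top _) (Lp.eLpNorm_ne_top _)] at h6
  rw [eLpNorm_congr_ae h4, eLpNorm_congr_ae h2.coeFn_toLp] at h6
  exact h6

lemma fourierInv_L2 {f : F → ℂ} (hf : Integrable f) (h2 : MemLp f 2 volume) :
    eLpNorm (𝓕⁻ f) 2 volume = eLpNorm f 2 volume := by
  have : 𝓕⁻ f = (𝓕 f) ∘ (fun x => -x) := by ext x; rw [Real.fourierInv_eq_fourier_neg]; rfl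
  rw [this, eLpNorm_comp_measurePreserving (fourier_cont hf).aestronglyMeasurable
    (Measure.measurePreserving_neg volume)]
  exact fourier_L2 hf h2

lemma fourierInv_inj {f : F → ℂ} (hf : Integrable f) (h2 : MemLp f 2 volume) (h : ∀ x, 𝓕⁻ f x = 0) :
    f =ᵐ[volume] 0 := by
  have h3 := fourierInv_L2 hf h2
  have : 𝓕⁻ f = 0 := by ext x; exact h x
  rw [this, eLpNorm_zero] at h3
  exact (eLpNorm_eq_zero_iff h2.1 (by norm_num)).1 h3.symm

end Planch

lemma isFT_inv {d : ℕ} {V v : Rd d → ℂ} (hv : MemLp v 2 volume) (hV : Integrable V) (h : IsFT V v) :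
    v =ᵐ[volume] 𝓕⁻ V := by
  apply ae_eq_of_schwartz
  · exact hv.locallyIntegrable (by norm_num)
  · exact (fourierInv_cont hV).locallyIntegrable
  intro ψ
  have h1 := h (𝓕⁻ ψ)
  have h2 : 𝓕 (⇑(𝓕⁻ ψ : SchwartzMap (Rd d) ℂ)) = ψ := by
    have : 𝓕 (𝓕⁻ ψ : SchwartzMap (Rd d) ℂ) = ψ := FourierTransform.fourier_fourierInv_eq ψ
    rw [← SchwartzMap.fourier_coe, this]
  rw [h2] at h1
  have h3 := fourierInv_flip hV (ψ.integrable (μ := volume))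
  rw [← SchwartzMap.fourierInv_coe, h1] at h3
  simp only [mul_comm (ψ _)]
  exact h3.symm





section Marc

lemma lint_rpow {r : ℝ} (hr : -1 < r) {R : ℝ} (hR : 0 ≤ R) :
    ∫⁻ s in Set.Ioc 0 R, ENNReal.ofReal (s ^ r) = ENNReal.ofReal (R ^ (r + 1) / (r + 1)) := by
  have hi : IntegrableOn (fun s : ℝ => s ^ r) (Set.Ioc 0 R) := by
    have := intervalIntegral.intervalIntegrable_rpow' (a := 0) (b := R) hr
    rwa [intervalIntegrable_iff_integrableOn_Ioc_of_le hR] at this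
  rw [← ofReal_integral_eq_lintegral_ofReal hi]
  · rw [← intervalIntegral.integral_of_le hR, integral_rpow (Or.inl hr), Real.zero_rpow (by linarith), sub_zero]
  · filter_upwards [ae_restrict_mem measurableSet_Ioc] with s hs
    exact Real.rpow_nonneg hs.1.le _

variable {X Y : Type*} [MeasurableSpace X] [MeasurableSpace Y] {μ : Measure X} {ν : Measure Y} [SFinite μ]

lemma marc {p q : ℝ} (hp : 2 < p) (hq : q = p / (p - 1)) (f : X → ℝ) (hf : Measurable f) (hf0 : ∀ x, 0 ≤ f x)
    (T : Set X → Y → ℝ) (hTm : ∀ A, MeasurableSet A → AEMeasurable (T A) ν) (hT0 : ∀ A y, 0 ≤ T A y)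
    (hT : ∀ A, MeasurableSet A → ∀ y, T Set.univ y ≤ T A y + T Aᶜ y) {M1 M2 N : ℝ} (hM1 : 0 < M1) (hM2 : 0 ≤ M2)
    (hN : 0 < N)
    (h1 : ∀ A, MeasurableSet A → ∀ y, ENNReal.ofReal (T A y) ≤ ENNReal.ofReal M1 * ∫⁻ x in A, ENNReal.ofReal (f x) ∂μ)
    (h2 : ∀ A, MeasurableSet A → ∫⁻ y, ENNReal.ofReal (T A y ^ 2) ∂ν ≤
      ENNReal.ofReal (M2 ^ 2) * ∫⁻ x in A, ENNReal.ofReal (f x ^ 2) ∂μ)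
    (hfN : ∫⁻ x, ENNReal.ofReal (f x ^ q) ∂μ ≤ ENNReal.ofReal N) :
    ∫⁻ y, ENNReal.ofReal (T Set.univ y ^ p) ∂ν ≤
      ENNReal.ofReal (4 * p * 2 ^ (p - 2) / (p - 2) * M2 ^ 2 * M1 ^ (p - 2) * N ^ (p - 1)) := by
  have hp1 : 0 < p - 1 := by linarith
  have hp2 : 0 < p - 2 := by linarith
  have hq1 : q - 1 = 1 / (p - 1) := by rw [hq]; field_simp; ring
  have hq0 : 0 < q - 1 := by rw [hq1]; positivity
  set A : ℝ → Set X := fun s => {x | f x ^ (q - 1) * s ≤ 2 * M1 * N} with hA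
  have hAm2 : MeasurableSet {z : ℝ × X | f z.2 ^ (q - 1) * z.1 ≤ 2 * M1 * N} := by
    apply measurableSet_le _ measurable_const
    exact ((hf.comp measurable_snd).pow_const _).mul measurable_fst
  have hAm : ∀ s, MeasurableSet (A s) := fun s =>
    measurableSet_le ((hf.pow_const _).mul measurable_const) measurable_const
  -- complement bound
  have hcomp : ∀ s, 0 < s → ∀ y, T (A s)ᶜ y ≤ s / 2 := by
    intro s hs y
    have e1 : ENNReal.ofReal M1 * ∫⁻ x in (A s)ᶜ, ENNReal.ofReal (f x) ∂μ ≤ ENNReal.ofReal (s / 2) := by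
      rw [← lintegral_const_mul _ (by fun_prop)]
      calc ∫⁻ x in (A s)ᶜ, ENNReal.ofReal M1 * ENNReal.ofReal (f x) ∂μ
          ≤ ∫⁻ x in (A s)ᶜ, ENNReal.ofReal (s / (2 * N)) * ENNReal.ofReal (f x ^ q) ∂μ := by
            apply setLIntegral_mono' (hAm s).compl
            intro x hx
            rw [← ENNReal.ofReal_mul hM1.le, ← ENNReal.ofReal_mul (by positivity)]
            apply ENNReal.ofReal_le_ofReal
            have hx' : 2 * M1 * N < f x ^ (q - 1) * s := by simpa [hA] using hx
            have : f x ^ q = f x ^ (q - 1) * f x := by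
              rcases (hf0 x).eq_or_lt with h | h
              · rw [← h, Real.zero_rpow (by linarith), mul_zero]
              · rw [← Real.rpow_add_one h.ne']; congr 1; ring
            rw [this]
            have h3 : M1 ≤ s / (2 * N) * f x ^ (q - 1) := by
              rw [div_mul_eq_mul_div, le_div_iff₀ (by positivity)]; nlinarith
            calc M1 * f x ≤ (s / (2 * N) * f x ^ (q - 1)) * f x := by gcongr; exact hf0 x
              _ = _ := by ring
        _ ≤ ENNReal.ofReal (s / (2 * N)) * ENNReal.ofReal N := by
            rw [lintegral_const_mul _ (by fun_prop)]
            gcongr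
            exact (setLIntegral_le_lintegral _ _).trans hfN
        _ = ENNReal.ofReal (s / 2) := by
            rw [← ENNReal.ofReal_mul (by positivity)]; congr 1; field_simp
    exact (ENNReal.ofReal_le_ofReal_iff (by positivity)).1 ((h1 _ (hAm s).compl y).trans e1)
  have hdist : ∀ s, 0 < s → ν {y | s < T Set.univ y} ≤
      ENNReal.ofReal (4 / s ^ 2 * M2 ^ 2) * ∫⁻ x in A s, ENNReal.ofReal (f x ^ 2) ∂μ := by
    intro s hs
    have hsub : {y | s < T Set.univ y} ⊆ {y | ENNReal.ofReal (s ^ 2 / 4) ≤ ENNReal.ofReal (T (A s) y ^ 2)} := by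
      intro y hy
      simp only [Set.mem_ofPred_eq] at hy ⊢
      apply ENNReal.ofReal_le_ofReal
      have := hT _ (hAm s) y
      have := hcomp s hs y
      nlinarith
    have hch := mul_meas_ge_le_lintegral₀ (μ := ν) (f := fun y => ENNReal.ofReal (T (A s) y ^ 2))
      ((hTm _ (hAm s)).pow_const 2).ennreal_ofReal (ENNReal.ofReal (s ^ 2 / 4))
    calc ν {y | s < T Set.univ y} ≤ ν {y | ENNReal.ofReal (s ^ 2 / 4) ≤ ENNReal.ofReal (T (A s) y ^ 2)} := measure_mono hsub
      _ = ENNReal.ofReal (4 / s ^ 2) * (ENNReal.ofReal (s ^ 2 / 4) * ν {y | ENNReal.ofReal (s ^ 2 / 4) ≤ ENNReal.ofReal (T (A s) y ^ 2)}) := by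
          rw [← mul_assoc, ← ENNReal.ofReal_mul (by positivity), show 4 / s ^ 2 * (s ^ 2 / 4) = 1 by field_simp]
          simp
      _ ≤ ENNReal.ofReal (4 / s ^ 2) * (ENNReal.ofReal (M2 ^ 2) * ∫⁻ x in A s, ENNReal.ofReal (f x ^ 2) ∂μ) := by
          exact mul_le_mul_right (hch.trans (h2 _ (hAm s))) _
      _ = _ := by rw [← mul_assoc, ← ENNReal.ofReal_mul (by positivity)]
  rw [lintegral_rpow_eq_lintegral_meas_lt_mul ν (ae_of_all _ (hT0 _)) (hTm _ MeasurableSet.univ) (by linarith)]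
  have step1 : ∫⁻ s in Set.Ioi (0:ℝ), ν {y | s < T Set.univ y} * ENNReal.ofReal (s ^ (p - 1)) ≤
      ∫⁻ s in Set.Ioi (0:ℝ), ENNReal.ofReal (4 * M2 ^ 2) * ∫⁻ x, ENNReal.ofReal (s ^ (p - 3)) *
        ({z : ℝ × X | f z.2 ^ (q - 1) * z.1 ≤ 2 * M1 * N}.indicator (fun z => ENNReal.ofReal (f z.2 ^ 2)) (s, x)) ∂μ := by
    apply setLIntegral_mono' measurableSet_Ioi
    intro s hs
    have hs : 0 < s := hs
    have e : ∫⁻ x, ENNReal.ofReal (s ^ (p - 3)) *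
        ({z : ℝ × X | f z.2 ^ (q - 1) * z.1 ≤ 2 * M1 * N}.indicator (fun z => ENNReal.ofReal (f z.2 ^ 2)) (s, x)) ∂μ
        = ENNReal.ofReal (s ^ (p - 3)) * ∫⁻ x in A s, ENNReal.ofReal (f x ^ 2) ∂μ := by
      rw [← lintegral_indicator (hAm s), ← lintegral_const_mul]
      · rfl
      · exact Measurable.indicator (by fun_prop) (hAm s)
    rw [e]
    calc _ ≤ (ENNReal.ofReal (4 / s ^ 2 * M2 ^ 2) * ∫⁻ x in A s, ENNReal.ofReal (f x ^ 2) ∂μ) * ENNReal.ofReal (s ^ (p - 1)) := by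
          gcongr; exact hdist s hs
      _ = ENNReal.ofReal (4 / s ^ 2 * M2 ^ 2 * s ^ (p - 1)) * ∫⁻ x in A s, ENNReal.ofReal (f x ^ 2) ∂μ := by
          rw [mul_right_comm, ← ENNReal.ofReal_mul (by positivity)]
      _ = ENNReal.ofReal (4 * M2 ^ 2 * s ^ (p - 3)) * ∫⁻ x in A s, ENNReal.ofReal (f x ^ 2) ∂μ := by
          congr 2
          have : s ^ (p - 1) = s ^ (p - 3) * s ^ 2 := by
            rw [← Real.rpow_natCast s 2, ← Real.rpow_add hs]; norm_num; ring_nf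
          rw [this]; field_simp
      _ = _ := by rw [ENNReal.ofReal_mul (by positivity), mul_assoc]
      _ ≤ _ := le_rfl
  have hmeas : Measurable (fun z : ℝ × X => ENNReal.ofReal (z.1 ^ (p - 3)) *
        ({z : ℝ × X | f z.2 ^ (q - 1) * z.1 ≤ 2 * M1 * N}.indicator (fun z => ENNReal.ofReal (f z.2 ^ 2)) z)) := by
    apply Measurable.mul (by fun_prop)
    exact Measurable.indicator (by fun_prop) hAm2
  have step2 : ∀ x, ∫⁻ s in Set.Ioi (0:ℝ), ENNReal.ofReal (s ^ (p - 3)) *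
        ({z : ℝ × X | f z.2 ^ (q - 1) * z.1 ≤ 2 * M1 * N}.indicator (fun z => ENNReal.ofReal (f z.2 ^ 2)) (s, x)) ≤
        ENNReal.ofReal ((2 * M1 * N) ^ (p - 2) / (p - 2)) * ENNReal.ofReal (f x ^ q) := by
    intro x
    rcases (hf0 x).eq_or_lt with h | h
    · have : ∀ s : ℝ, ({z : ℝ × X | f z.2 ^ (q - 1) * z.1 ≤ 2 * M1 * N}.indicator (fun z => ENNReal.ofReal (f z.2 ^ 2)) (s, x)) = 0 := by
        intro s; simp [Set.indicator, ← h]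
      simp [this]
    set R := 2 * M1 * N / f x ^ (q - 1) with hR
    have hfx : 0 < f x ^ (q - 1) := Real.rpow_pos_of_pos h _
    have hR0 : 0 < R := by positivity
    calc _ ≤ ∫⁻ s in Set.Ioi (0:ℝ), (Set.Ioc 0 R).indicator (fun s => ENNReal.ofReal (f x ^ 2) * ENNReal.ofReal (s ^ (p - 3))) s := by
          apply setLIntegral_mono' measurableSet_Ioi
          intro s hs
          by_cases hh : f x ^ (q - 1) * s ≤ 2 * M1 * N
          · have : s ∈ Set.Ioc 0 R := ⟨hs, by rw [hR, le_div_iff₀ hfx]; linarith⟩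
            rw [Set.indicator_of_mem (by simpa using hh), Set.indicator_of_mem this, mul_comm]
          · rw [Set.indicator_of_notMem (by simpa using hh)]; simp
      _ ≤ ∫⁻ s in Set.Ioc 0 R, ENNReal.ofReal (f x ^ 2) * ENNReal.ofReal (s ^ (p - 3)) := by
          rw [← lintegral_indicator measurableSet_Ioc]
          exact setLIntegral_le_lintegral _ _
      _ = ENNReal.ofReal (f x ^ 2 * (R ^ (p - 2) / (p - 2))) := by
          rw [lintegral_const_mul _ (by fun_prop), lint_rpow (by linarith) hR0.le, ENNReal.ofReal_mul (by positivity)]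
          ring_nf
      _ = _ := by
          rw [← ENNReal.ofReal_mul (by positivity)]
          congr 1
          rw [hR, Real.div_rpow (by positivity) hfx.le, ← Real.rpow_mul h.le]
          have : f x ^ q = f x ^ 2 / f x ^ ((q - 1) * (p - 2)) := by
            rw [← Real.rpow_natCast (f x) 2, ← Real.rpow_sub h, hq1, hq]
            congr 1
            push_cast
            field_simp
            ring
          rw [this]; field_simp
  calc _ ≤ ENNReal.ofReal p * (ENNReal.ofReal (4 * M2 ^ 2) * (ENNReal.ofReal ((2 * M1 * N) ^ (p - 2) / (p - 2)) * ENNReal.ofReal N)) := by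
        gcongr
        refine step1.trans ?_
        rw [lintegral_const_mul]
        · gcongr
          rw [lintegral_lintegral_swap hmeas.aemeasurable]
          calc _ ≤ ∫⁻ x, ENNReal.ofReal ((2 * M1 * N) ^ (p - 2) / (p - 2)) * ENNReal.ofReal (f x ^ q) ∂μ := lintegral_mono step2
            _ ≤ _ := by
              rw [lintegral_const_mul _ (by fun_prop)]
              gcongr
        · exact hmeas.lintegral_prod_right'
    _ = _ := by
        rw [← ENNReal.ofReal_mul (by positivity), ← ENNReal.ofReal_mul (by positivity), ← ENNReal.ofReal_mul (by positivity)]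
        congr 1
        have : N ^ (p - 1) = N ^ (p - 2) * N := by
          rw [← Real.rpow_add_one hN.ne']; congr 1; ring
        rw [this, Real.mul_rpow (by positivity) hN.le, Real.mul_rpow (by positivity) hM1.le]
        field_simp

end Marc





section Nice

/-- bounded measurable functions with bounded support -/
structure Nice {E : Type*} [NormedAddCommGroup E] [MeasurableSpace E] (f : E → ℂ) : Prop where
  meas : Measurable f
  bdd : ∃ B : ℝ, ∀ x, ‖f x‖ ≤ B
  supp : ∃ R : ℝ, ∀ x, R < ‖x‖ → f x = 0

variable {E : Type*} [NormedAddCommGroup E] [MeasurableSpace E] [BorelSpace E] [ProperSpace E]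
  {μ : Measure E} [IsFiniteMeasureOnCompacts μ]

lemma Nice.real_integrable {φ : E → ℝ} (hm : Measurable φ) {B R : ℝ} (hb : ∀ x, |φ x| ≤ B)
    (hs : ∀ x, R < ‖x‖ → φ x = 0) : Integrable φ μ := by
  have h1 : IntegrableOn φ (Metric.closedBall 0 R) μ := by
    apply Measure.integrableOn_of_bounded (M := B)
    · exact (isCompact_closedBall _ _).measure_lt_top.ne
    · exact hm.aestronglyMeasurable
    · exact ae_of_all _ hb
  rw [← integrableOn_univ]
  apply (integrableOn_iff_integrable_of_support_subset (s := Metric.closedBall 0 R) _).1 h1 |>.integrableOn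
  intro x hx
  by_contra hc
  exact hx (hs x (by simpa using hc))

lemma Nice.rpow_integrable {f : E → ℂ} (hf : Nice f) {q : ℝ} (hq : 0 < q) : Integrable (fun x => ‖f x‖ ^ q) μ := by
  obtain ⟨B, hB⟩ := hf.bdd
  obtain ⟨R, hR⟩ := hf.supp
  apply Nice.real_integrable (B := B ^ q) (R := R)
  · exact hf.meas.norm.pow_const _
  · intro x
    rw [abs_of_nonneg (by positivity)]
    gcongr
    exact hB x
  · intro x hx; rw [hR x hx]; simp [hq.ne']

lemma Nice.integrable {f : E → ℂ} (hf : Nice f) : Integrable f μ := by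
  rw [← integrable_norm_iff hf.meas.aestronglyMeasurable]
  simpa using hf.rpow_integrable (μ := μ) one_pos

lemma Nice.memLp2 {f : E → ℂ} (hf : Nice f) : MemLp f 2 μ := by
  rw [memLp_two_iff_integrable_sq_norm hf.meas.aestronglyMeasurable]
  simpa using hf.rpow_integrable (μ := μ) two_pos

lemma Nice.indicator {f : E → ℂ} (hf : Nice f) {A : Set E} (hA : MeasurableSet A) : Nice (A.indicator f) := by
  obtain ⟨B, hB⟩ := hf.bdd
  obtain ⟨R, hR⟩ := hf.supp
  refine ⟨hf.meas.indicator hA, ⟨B, fun x => (norm_indicator_le_norm_self f x).trans (hB x)⟩, R, fun x hx => ?_⟩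
  simp [Set.indicator, hR x hx]

lemma Nice.mul {E : Type*} [NormedAddCommGroup E] [MeasurableSpace E] {f : E → ℂ} (hf : Nice f) {g : E → ℂ} (hg : Measurable g) {B : ℝ} (hB : ∀ x, ‖g x‖ ≤ B) :
    Nice (fun x => g x * f x) := by
  obtain ⟨B', hB'⟩ := hf.bdd
  obtain ⟨R, hR⟩ := hf.supp
  refine ⟨hg.mul hf.meas, ⟨B * B', fun x => ?_⟩, R, fun x hx => by simp [hR x hx]⟩
  rw [norm_mul]
  exact mul_le_mul (hB x) (hB' x) (norm_nonneg _) ((norm_nonneg _).trans (hB x))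

lemma Nice.conj {E : Type*} [NormedAddCommGroup E] [MeasurableSpace E] {f : E → ℂ} (hf : Nice f) : Nice (fun x => (starRingEnd ℂ) (f x)) := by
  obtain ⟨B', hB'⟩ := hf.bdd
  obtain ⟨R, hR⟩ := hf.supp
  exact ⟨Complex.continuous_conj.measurable.comp hf.meas, ⟨B', by simpa using hB'⟩, R, fun x hx => by simp [hR x hx]⟩

lemma Nice.slice {E F : Type*} [NormedAddCommGroup E] [MeasurableSpace E] [NormedAddCommGroup F] [MeasurableSpace F] {f : E × F → ℂ} (hf : Nice f) (z : F) :
    Nice (fun y => f (y, z)) := by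
  obtain ⟨B', hB'⟩ := hf.bdd
  obtain ⟨R, hR⟩ := hf.supp
  exact ⟨hf.meas.comp (by fun_prop), ⟨B', fun x => hB' _⟩, R, fun x hx => hR _ (hx.trans_le (norm_fst_le (x, z)))⟩

lemma lint_sq_eq {X : Type*} [MeasurableSpace X] {μ : Measure X} (f : X → ℂ) :
    ∫⁻ x, ENNReal.ofReal (‖f x‖ ^ 2) ∂μ = eLpNorm f 2 μ ^ 2 := by
  have := eLpNorm_nnreal_pow_eq_lintegral (f := f) (μ := μ) (p := 2) (by norm_num)
  simp only [NNReal.coe_ofNat, ENNReal.coe_ofNat] at this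
  rw [← ENNReal.rpow_two, this]
  congr with x
  rw [ENNReal.ofReal_pow (norm_nonneg _), ofReal_norm, ENNReal.rpow_two]

end Nice

section OpK

variable {E : Type*} [NormedAddCommGroup E] [InnerProductSpace ℝ E] [FiniteDimensional ℝ E]
    [MeasurableSpace E] [BorelSpace E]

def mS (h : ℝ → ℝ) (s : ℝ) (η : E) : ℂ := ∫ κ : ℝ, (wt h (η, κ) : ℂ) * Complex.exp ((2 * π * (s * κ) : ℝ) * Complex.I)

lemma lint_wt {h : ℝ → ℝ} (hw : IsW h) (η : E) :
    ∫⁻ κ : ℝ, ENNReal.ofReal (wt h (η, κ)) ≤ ENNReal.ofReal (9/2 * ∫ r, h r) := by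
  have hk := lintegral_kappa (fun r => ENNReal.ofReal (h r)) (fun r hr => by
    rw [hw.supp r (by intro hh; linarith [hh.2])]; simp) ‖η‖
  rw [← ofReal_integral_eq_lintegral_ofReal hw.int (ae_of_all _ hw.nn), ← ENNReal.ofReal_mul (by norm_num)] at hk
  have e : ∀ κ, ENNReal.ofReal (wt h (η, κ)) = ENNReal.ofReal (κ ^ 2) * ENNReal.ofReal (h (√(‖η‖ ^ 2 + κ ^ 2))) := by
    intro κ; rw [← ENNReal.ofReal_mul (by positivity)]; rfl
  simp only [e]
  set Φ : ℝ → ℝ≥0∞ := fun κ => ENNReal.ofReal (κ ^ 2) * ENNReal.ofReal (h (√(‖η‖ ^ 2 + κ ^ 2))) with hΦ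
  have e2 : ∫⁻ κ in Set.Iic 0, Φ κ = ∫⁻ κ in Set.Ioi 0, Φ κ := by
    have : ∫⁻ κ in Set.Iio 0, Φ κ = ∫⁻ κ in Set.Ioi 0, Φ κ := by
      have := (Measure.measurePreserving_neg (volume : Measure ℝ)).setLIntegral_comp_preimage_emb
        (MeasurableEquiv.neg ℝ).measurableEmbedding Φ (Set.Ioi 0)
      rw [← this]
      have : (Neg.neg ⁻¹' Set.Ioi (0:ℝ)) = Set.Iio 0 := by ext; simp
      rw [this]
      simp [hΦ]
    rw [← this]
    exact setLIntegral_congr Iio_ae_eq_Iic.symm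
  calc ∫⁻ κ, Φ κ = (∫⁻ κ in Set.Ioi 0, Φ κ) + ∫⁻ κ in (Set.Ioi 0)ᶜ, Φ κ := (lintegral_add_compl _ measurableSet_Ioi).symm
    _ ≤ ENNReal.ofReal (9/4 * ∫ r, h r) + ENNReal.ofReal (9/4 * ∫ r, h r) := by
        rw [Set.compl_Ioi, e2]; gcongr
    _ = _ := by
        have : 0 ≤ ∫ r, h r := integral_nonneg hw.nn
        rw [← ENNReal.ofReal_add (by positivity) (by positivity)]; congr 1; ring

lemma mS_bound {h : ℝ → ℝ} (hw : IsW h) (s : ℝ) (η : E) : ‖mS h s η‖ ≤ 9/2 * ∫ r, h r := by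
  have h0 : 0 ≤ ∫ r, h r := integral_nonneg hw.nn
  have h1 := enorm_integral_le_lintegral_enorm (μ := volume) (fun κ : ℝ => (wt h (η, κ) : ℂ) * Complex.exp ((2 * π * (s * κ) : ℝ) * Complex.I))
  have h2 : ∀ κ : ℝ, ‖(wt h (η, κ) : ℂ) * Complex.exp ((2 * π * (s * κ) : ℝ) * Complex.I)‖ₑ = ENNReal.ofReal (wt h (η, κ)) := by
    intro κ
    rw [← ofReal_norm, norm_mul, Complex.norm_exp_ofReal_mul_I, mul_one, Complex.norm_real, Real.norm_of_nonneg (wt_nonneg hw _)]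
  simp only [h2] at h1
  have h3 := h1.trans (lint_wt hw η)
  rw [← ofReal_norm] at h3
  exact (ENNReal.ofReal_le_ofReal_iff (by positivity)).1 h3

def opK (h : ℝ → ℝ) (s : ℝ) (g : E → ℂ) (y : E) : ℂ := ∫ y', g y' * kerW h (y - y') s

lemma wtpw_int {h : ℝ → ℝ} (hw : IsW h) (y : E) (s : ℝ) : Integrable (fun p : E × ℝ => (wt h p : ℂ) * pw y s p) := by
  obtain ⟨C, hC, hb⟩ := ker_bound E
  have := (hb h hw).1
  apply (this.ofReal (𝕜 := ℂ)).mul_bdd (c := 1)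
  · apply Continuous.aestronglyMeasurable; unfold pw; fun_prop
  · exact ae_of_all _ fun p => (norm_pw _ _ _).le

lemma pw_sub (y y' : E) (s : ℝ) (p : E × ℝ) : pw (y - y') s p = pw y s p * Complex.exp ((-2 * π * ⟪y', p.1⟫ : ℝ) * Complex.I) := by
  unfold pw
  rw [← Complex.exp_add]
  congr 1
  rw [inner_sub_left]
  push_cast
  ring

lemma mS_int {h : ℝ → ℝ} (hw : IsW h) (s : ℝ) : Integrable (mS h s : E → ℂ) := by
  have h1 := (wtpw_int hw (0:E) s).integral_prod_left
  unfold mS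
  simpa [pw] using h1

lemma opK_eq {h : ℝ → ℝ} (hw : IsW h) (s : ℝ) {g : E → ℂ} (hg : Integrable g) (y : E) :
    opK h s g y = 𝓕⁻ (fun η => mS h s η * 𝓕 g η) y := by
  have h1 : opK h s g y = ∫ y', ∫ p : E × ℝ, g y' * ((wt h p : ℂ) * pw (y - y') s p) := by
    unfold opK kerW
    simp only [integral_const_mul]
  have hfub : Integrable (Function.uncurry (fun (y' : E) (p : E × ℝ) => g y' * ((wt h p : ℂ) * pw (y - y') s p))) (volume.prod volume) := by
    have := (hg.mul_prod (wtpw_int hw y s))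
    have h2 := this.mul_bdd (c := 1) (g := fun z : E × (E × ℝ) => Complex.exp ((-2 * π * ⟪z.1, z.2.1⟫ : ℝ) * Complex.I))
      (by apply Continuous.aestronglyMeasurable; fun_prop) (ae_of_all _ fun p => (Complex.norm_exp_ofReal_mul_I _).le)
    refine h2.congr (ae_of_all _ fun z => ?_)
    simp only [Function.uncurry, pw_sub]
    ring
  rw [h1, integral_integral_swap hfub]
  have h3 : ∀ p : E × ℝ, ∫ y', g y' * ((wt h p : ℂ) * pw (y - y') s p) = ((wt h p : ℂ) * pw y s p) * 𝓕 g p.1 := by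
    intro p
    rw [Real.fourier_eq', ← integral_const_mul]
    congr with y'
    rw [pw_sub]
    simp only [smul_eq_mul]
    ring
  simp only [h3]
  have hintq : Integrable (fun p : E × ℝ => ((wt h p : ℂ) * pw y s p) * 𝓕 g p.1) := by
    apply (wtpw_int hw y s).mul_bdd (c := ∫ x, ‖g x‖)
    · exact ((fourier_cont hg).comp continuous_fst).aestronglyMeasurable
    · exact ae_of_all _ fun p => VectorFourier.norm_fourierIntegral_le_integral_norm _ _ _ _ _
  rw [Measure.volume_eq_prod, integral_prod _ hintq, Real.fourierInv_eq']
  congr with η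
  unfold mS
  simp only [smul_eq_mul]
  rw [← integral_mul_const, ← integral_const_mul]
  congr with κ
  unfold pw
  rw [show ((2 * π * (⟪y, η⟫ + s * κ) : ℝ) : ℂ) * Complex.I = ((2 * π * ⟪η, y⟫ : ℝ):ℂ) * Complex.I + ((2 * π * (s * κ) : ℝ):ℂ) * Complex.I by
    rw [real_inner_comm]; push_cast; ring, Complex.exp_add]
  ring

lemma opK_cont {h : ℝ → ℝ} (hw : IsW h) (s : ℝ) {g : E → ℂ} (hg : Integrable g) : Continuous (opK h s g) := by
  have : opK h s g = 𝓕⁻ (fun η => mS h s η * 𝓕 g η) := by ext y; exact opK_eq hw s hg y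
  rw [this]
  apply fourierInv_cont
  apply (mS_int hw s).mul_bdd (c := ∫ x, ‖g x‖)
  · exact (fourier_cont hg).aestronglyMeasurable
  · exact ae_of_all _ fun p => VectorFourier.norm_fourierIntegral_le_integral_norm _ _ _ _ _

lemma opK_L2 {h : ℝ → ℝ} (hw : IsW h) (s : ℝ) {g : E → ℂ} (hg : Integrable g) (hg2 : MemLp g 2 volume) :
    eLpNorm (opK h s g) 2 volume ≤ ENNReal.ofReal (9/2 * ∫ r, h r) * eLpNorm g 2 volume := by
  have h0 : 0 ≤ ∫ r, h r := integral_nonneg hw.nn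
  have e : opK h s g = 𝓕⁻ (fun η => mS h s η * 𝓕 g η) := by ext y; exact opK_eq hw s hg y
  have hF2 : MemLp (𝓕 g) 2 volume := ⟨(fourier_cont hg).aestronglyMeasurable, by rw [fourier_L2 hg hg2]; exact hg2.2⟩
  have hb : ∀ᵐ η : E, ‖mS h s η * 𝓕 g η‖ ≤ (9/2 * ∫ r, h r) * ‖𝓕 g η‖ := by
    refine ae_of_all _ fun η => ?_
    rw [norm_mul]
    gcongr
    exact mS_bound hw s η
  have hm : AEStronglyMeasurable (fun η : E => mS h s η * 𝓕 g η) volume :=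
    (mS_int hw s).1.mul (fourier_cont hg).aestronglyMeasurable
  have hi : Integrable (fun η : E => mS h s η * 𝓕 g η) := by
    apply (mS_int hw s).mul_bdd (c := ∫ x, ‖g x‖)
    · exact (fourier_cont hg).aestronglyMeasurable
    · exact ae_of_all _ fun p => VectorFourier.norm_fourierIntegral_le_integral_norm _ _ _ _ _
  have h2 : MemLp (fun η : E => mS h s η * 𝓕 g η) 2 volume := hF2.of_le_mul hm hb
  rw [e, fourierInv_L2 hi h2, ← fourier_L2 hg hg2]
  exact eLpNorm_le_mul_eLpNorm_of_ae_le_mul hb _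

end OpK





section KForm

def nq {X : Type*} [MeasureSpace X] (q : ℝ) (f : X → ℂ) : ℝ := (∫ x, ‖f x‖ ^ q) ^ (1 / q)

lemma nq_nonneg {X : Type*} [MeasureSpace X] (q : ℝ) (f : X → ℂ) : 0 ≤ nq q f :=
  Real.rpow_nonneg (integral_nonneg fun _ => by positivity) _

variable (E : Type*) [NormedAddCommGroup E] [InnerProductSpace ℝ E] [FiniteDimensional ℝ E]
    [MeasurableSpace E] [BorelSpace E]

lemma kern_form {p q : ℝ} (hp : 2 < p) (hq : q = p / (p - 1)) :
    ∃ C : ℝ, 0 ≤ C ∧ ∀ h : ℝ → ℝ, IsW h → 0 < ∫ r, h r → ∀ (s : ℝ) (f g : E → ℂ), Nice f → Nice g →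
    ‖∫ y, g y * opK h s f y‖ ≤ C * (∫ r, h r) * (1 + |s|) ^ (-((Module.finrank ℝ E : ℝ) * (1/2 - 1/p))) * nq q f * nq q g := by
  obtain ⟨C0, hC0, hker⟩ := ker_bound E
  have hp1 : 0 < p - 1 := by linarith
  have hp2 : 0 < p - 2 := by linarith
  have hp0 : 0 < p := by linarith
  have hq1 : 1 < q := by rw [hq, lt_div_iff₀ hp1]; linarith
  have hq0 : 0 < q := by linarith
  have hpq : q.HolderConjugate p := by
    rw [Real.holderConjugate_iff]; refine ⟨hq1, ?_⟩; rw [hq]; field_simp; ring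
  set K := 4 * p * 2 ^ (p - 2) / (p - 2) with hK
  have hK0 : 0 ≤ K := by positivity
  refine ⟨(K * (9/2) ^ 2 * (C0 + 1) ^ (p - 2)) ^ (1 / p), by positivity, ?_⟩
  intro h hw hH s f g hf hg
  set H := ∫ r, h r with hHdef
  set a : ℝ := (Module.finrank ℝ E : ℝ)
  set J : ℝ := 1 + |s| with hJ
  have hJ0 : 0 < J := by positivity
  set N := ∫ x, ‖f x‖ ^ q with hN
  have hN0 : 0 ≤ N := integral_nonneg fun _ => by positivity
  rcases hN0.eq_or_lt with hz | hNpos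
  · have hz' : (fun x => ‖f x‖ ^ q) =ᵐ[volume] 0 := by
      rw [← integral_eq_zero_iff_of_nonneg (fun _ => by positivity) (hf.rpow_integrable hq0)]
      exact hz.symm
    have h0 : ∀ y, opK h s f y = 0 := by
      intro y
      unfold opK
      rw [integral_eq_zero_of_ae]
      filter_upwards [hz'] with x hx
      have : ‖f x‖ = 0 := by
        simpa [Real.rpow_eq_zero (norm_nonneg _) hq0.ne'] using hx
      simp [norm_eq_zero.1 this]
    simp only [h0, mul_zero, integral_zero, norm_zero]
    have := nq_nonneg q f
    have := nq_nonneg q g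
    positivity
  have hnf : ∀ A, MeasurableSet A → Integrable (A.indicator f) := fun A hA => (hf.indicator hA).integrable
  have hm := marc (μ := (volume : Measure E)) (ν := (volume : Measure E)) hp hq (fun x => ‖f x‖) hf.meas.norm
    (fun x => norm_nonneg _)
    (fun A y => ‖opK h s (A.indicator f) y‖) (fun A hA => ((opK_cont hw s (hnf A hA)).norm).aemeasurable)
    (fun A y => norm_nonneg _) (M1 := (C0 + 1) * H * J ^ (-(a / 2))) (M2 := 9/2 * H) (N := N) ?_ (by positivity)
    (by positivity) hNpos ?_ ?_ ?_
  rotate_left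
  · intro A hA y
    refine le_trans (le_of_eq ?_) (norm_add_le _ _)
    congr 1
    unfold opK
    have hkc : ∀ B, MeasurableSet B → Integrable (fun y' => B.indicator f y' * kerW h (y - y') s) := by
      intro B hB
      apply (hnf B hB).mul_bdd (c := C0 * H * J ^ (-(a / 2)))
      · have : Continuous (fun y : E => kerW h y s) := by
          unfold kerW
          refine continuous_of_dominated (bound := fun p => wt h p) (fun y => (wtpw_int hw y s).1) ?_ (hker h hw).1 ?_
          · intro y
            refine ae_of_all _ fun p => ?_
            rw [norm_mul, norm_pw, mul_one, Complex.norm_real, Real.norm_of_nonneg (wt_nonneg hw _)]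
          · refine ae_of_all _ fun p => ?_
            unfold pw; fun_prop
        exact (this.comp (by fun_prop : Continuous fun y' => y - y')).aestronglyMeasurable
      · exact ae_of_all _ fun y' => (hker h hw).2 _ _
    rw [← integral_add (hkc _ hA) (hkc _ hA.compl)]
    congr with y'
    rw [← add_mul]
    congr 1
    simp only [Set.indicator_univ]
    exact (Set.indicator_self_add_compl_apply A f y').symm
  · intro A hA y
    rw [ofReal_norm]
    unfold opK
    refine (enorm_integral_le_lintegral_enorm _).trans ?_
    rw [← lintegral_const_mul _ (by have := hf.meas; fun_prop), ← lintegral_indicator hA]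
    apply lintegral_mono
    intro y'
    by_cases hy : y' ∈ A
    · simp only [Set.indicator_of_mem hy]
      rw [enorm_mul, mul_comm, ofReal_norm]
      gcongr
      rw [← ofReal_norm]
      apply ENNReal.ofReal_le_ofReal
      refine ((hker h hw).2 _ _).trans ?_
      gcongr
      linarith
    · simp [hy]
  · intro A hA
    have h1 := opK_L2 hw s (hnf A hA) (hf.indicator hA).memLp2
    rw [lint_sq_eq, lint_sq_eq, ENNReal.ofReal_pow (by positivity), ← mul_pow]
    gcongr
    rwa [eLpNorm_indicator_eq_eLpNorm_restrict hA] at h1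
  · rw [← ofReal_integral_eq_lintegral_ofReal (hf.rpow_integrable hq0) (ae_of_all _ fun _ => by positivity)]
  simp only [Set.indicator_univ] at hm
  have hmf := hf.integrable (μ := volume)
  have hHo := ENNReal.lintegral_mul_le_Lp_mul_Lq volume hpq (f := fun y => ENNReal.ofReal ‖g y‖)
    (g := fun y => ENNReal.ofReal ‖opK h s f y‖) (by have := hg.meas; fun_prop)
    ((opK_cont hw s hmf).norm.measurable.ennreal_ofReal.aemeasurable)
  have e1 : ∫⁻ y, ENNReal.ofReal ‖g y‖ ^ q = ENNReal.ofReal (∫ y, ‖g y‖ ^ q) := by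
    rw [ofReal_integral_eq_lintegral_ofReal (hg.rpow_integrable hq0) (ae_of_all _ fun _ => by positivity)]
    congr with y
    rw [ENNReal.ofReal_rpow_of_nonneg (norm_nonneg _) hq0.le]
  have e2 : ∫⁻ y, ENNReal.ofReal ‖opK h s f y‖ ^ p = ∫⁻ y, ENNReal.ofReal (‖opK h s f y‖ ^ p) := by
    congr with y
    rw [ENNReal.ofReal_rpow_of_nonneg (norm_nonneg _) hp0.le]
  rw [e1, e2] at hHo
  have e3 : ENNReal.ofReal ‖∫ y, g y * opK h s f y‖ ≤ ENNReal.ofReal (∫ y, ‖g y‖ ^ q) ^ (1/q) *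
      ENNReal.ofReal (K * (9/2 * H) ^ 2 * ((C0 + 1) * H * J ^ (-(a / 2))) ^ (p - 2) * N ^ (p - 1)) ^ (1/p) := by
    calc _ ≤ ∫⁻ y, ENNReal.ofReal ‖g y‖ * ENNReal.ofReal ‖opK h s f y‖ := by
          rw [ofReal_norm]
          refine (enorm_integral_le_lintegral_enorm _).trans (le_of_eq ?_)
          congr with y
          rw [enorm_mul, ofReal_norm, ofReal_norm]
      _ ≤ _ := by
          refine hHo.trans ?_
          gcongr
  rw [ENNReal.ofReal_rpow_of_nonneg (integral_nonneg fun _ => by positivity) (by positivity),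
    ENNReal.ofReal_rpow_of_nonneg (by positivity) (by positivity),
    show (∫ y, ‖g y‖ ^ q) ^ (1/q) = nq q g from rfl, ← ENNReal.ofReal_mul (nq_nonneg q g),
    ENNReal.ofReal_le_ofReal_iff (mul_nonneg (nq_nonneg q g) (by positivity))] at e3
  refine e3.trans (le_of_eq ?_)
  change nq q g * _ = _
  have e4 : (K * (9/2 * H) ^ 2 * ((C0 + 1) * H * J ^ (-(a / 2))) ^ (p - 2) * N ^ (p - 1)) ^ (1/p)
     = (K * (9/2) ^ 2 * (C0 + 1) ^ (p - 2)) ^ (1 / p) * H * J ^ (-(a * (1/2 - 1/p))) * nq q f := by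
    have r1 : (K * (9/2 * H) ^ 2 * ((C0 + 1) * H * J ^ (-(a / 2))) ^ (p - 2) * N ^ (p - 1))
       = (K * (9/2) ^ 2 * (C0 + 1) ^ (p - 2)) * H ^ p * (J ^ (-(a / 2))) ^ (p - 2) * N ^ (p - 1) := by
      have : H ^ p = H ^ 2 * H ^ (p - 2) := by
        rw [← Real.rpow_natCast H 2, ← Real.rpow_add hH]; norm_num
      rw [this, Real.mul_rpow (by positivity) (by positivity), Real.mul_rpow (by positivity) (by positivity)]
      ring
    rw [r1, Real.mul_rpow (by positivity) (by positivity), Real.mul_rpow (by positivity) (by positivity),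
      Real.mul_rpow (by positivity) (by positivity), ← Real.rpow_mul hH.le, ← Real.rpow_mul hJ0.le,
      ← Real.rpow_mul hJ0.le, ← Real.rpow_mul hNpos.le, nq, ← hN]
    rw [show p * (1 / p) = 1 by field_simp, Real.rpow_one, show -(a / 2) * (p - 2) * (1 / p) = -(a * (1/2 - 1/p)) by field_simp,
      show (p - 1) * (1 / p) = 1 / q by rw [hq]; field_simp]
  rw [e4]; ring

end KForm





section HLS

def nearK (p A δ : ℝ) : ℝ :=
  if A = 0 then 0 else if δ ≤ A ^ (-(p / (p - 1))) then A ^ 2 * δ ^ (-(2 / p)) else δ ^ (-2 : ℝ)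

lemma nearK_nonneg (p A : ℝ) {δ : ℝ} (hδ : 0 ≤ δ) : 0 ≤ nearK p A δ := by
  unfold nearK; split_ifs <;> positivity

lemma nearK_meas (p : ℝ) : Measurable (fun z : ℝ × ℝ => nearK p z.1 z.2) := by
  unfold nearK
  apply Measurable.ite (measurableSet_eq_fun (by fun_prop) (by fun_prop)) measurable_const
  apply Measurable.ite (measurableSet_le (by fun_prop) (by fun_prop)) <;> fun_prop

lemma near_point {p q : ℝ} (hp : 2 < p) (hq : q = p / (p - 1)) {A B δ : ℝ} (hA : 0 ≤ A) (hB : 0 ≤ B) (hδ : 0 < δ)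
    (hBA : B ≤ A) : A * B * δ ^ (-(2/p)) ≤ nearK p A δ + A ^ q * B ^ q := by
  have hp1 : 0 < p - 1 := by linarith
  have hp0 : 0 < p := by linarith
  have hq1 : 1 < q := by rw [hq, lt_div_iff₀ hp1]; linarith
  have hq0 : 0 < q := by linarith
  have hqp : q / p = q - 1 := by rw [hq]; field_simp; ring
  have hpq : q.HolderConjugate p := by
    rw [Real.holderConjugate_iff]; refine ⟨hq1, ?_⟩; rw [hq]; field_simp; ring
  rcases hA.eq_or_lt with h | h
  · have : B = 0 := by linarith
    rw [← h]; simp [nearK, this, hq0.ne']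
  unfold nearK
  rw [if_neg h.ne', ← hq]
  split_ifs with hd
  · have : A * B * δ ^ (-(2/p)) ≤ A ^ 2 * δ ^ (-(2/p)) := by
      gcongr; nlinarith
    have : 0 ≤ A ^ q * B ^ q := by positivity
    linarith
  · have hy := Real.young_inequality_of_nonneg (a := A ^ (1/p) * B) (b := A ^ (-(1/p)) * δ ^ (-(2/p))) (by positivity)
      (by positivity) hpq
    have e1 : (A ^ (1/p) * B) ^ q = A ^ (q - 1) * B ^ q := by
      rw [Real.mul_rpow (by positivity) hB, ← Real.rpow_mul hA, ← hqp]; congr 2; ring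
    have e2 : (A ^ (-(1/p)) * δ ^ (-(2/p))) ^ p = A⁻¹ * δ ^ (-2 : ℝ) := by
      rw [Real.mul_rpow (by positivity) (by positivity), ← Real.rpow_mul hA, ← Real.rpow_mul hδ.le,
        show -(1/p) * p = -1 by field_simp, show -(2/p) * p = -2 by field_simp, Real.rpow_neg_one]
    have e3 : A ^ (1/p) * B * (A ^ (-(1/p)) * δ ^ (-(2/p))) = B * δ ^ (-(2/p)) := by
      rw [Real.rpow_neg hA]; field_simp
    rw [e1, e2, e3] at hy
    have e4 : A ^ (q - 1) * B ^ q / q ≤ A ^ (q - 1) * B ^ q := div_le_self (by positivity) hq1.le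
    have e5 : A⁻¹ * δ ^ (-2 : ℝ) / p ≤ A⁻¹ * δ ^ (-2 : ℝ) := div_le_self (by positivity) (by linarith)
    have e6 : A ^ q = A * A ^ (q - 1) := by
      rw [← Real.rpow_one_add' hA (by linarith)]; congr 1; ring
    calc A * B * δ ^ (-(2/p)) = A * (B * δ ^ (-(2/p))) := by ring
      _ ≤ A * (A ^ (q - 1) * B ^ q + A⁻¹ * δ ^ (-2 : ℝ)) := by gcongr; linarith
      _ = δ ^ (-2 : ℝ) + A ^ q * B ^ q := by rw [e6]; field_simp; ring

lemma lint_abs_sub (φ : ℝ → ℝ≥0∞) (t : ℝ) :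
    ∫⁻ t', φ |t - t'| = 2 * ∫⁻ r in Set.Ioi 0, φ r := by
  have h1 : ∫⁻ t', φ |t - t'| = ∫⁻ r, φ |r| :=
    lintegral_sub_left_eq_self (fun r => φ |r|) t
  rw [h1]
  have e1 : ∫⁻ r in Set.Ioi 0, φ |r| = ∫⁻ r in Set.Ioi 0, φ r := by
    apply setLIntegral_congr_fun measurableSet_Ioi
    intro r hr
    simp only [abs_of_pos (show 0 < r from hr)]
  have e2 : ∫⁻ κ in Set.Iic 0, φ |κ| = ∫⁻ κ in Set.Ioi 0, φ |κ| := by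
    have : ∫⁻ κ in Set.Iio 0, φ |κ| = ∫⁻ κ in Set.Ioi 0, φ |κ| := by
      have := (Measure.measurePreserving_neg (volume : Measure ℝ)).setLIntegral_comp_preimage_emb
        (MeasurableEquiv.neg ℝ).measurableEmbedding (fun r => φ |r|) (Set.Ioi 0)
      rw [← this]
      have : (Neg.neg ⁻¹' Set.Ioi (0:ℝ)) = Set.Iio 0 := by ext; simp
      rw [this]
      simp
    rw [← this]
    exact setLIntegral_congr Iio_ae_eq_Iic.symm
  rw [← lintegral_add_compl _ (measurableSet_Ioi (a := (0:ℝ))), Set.compl_Ioi, e2, e1, two_mul]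

lemma lint_rpow_Ioi {r : ℝ} (hr : r < -1) {R : ℝ} (hR : 0 < R) :
    ∫⁻ s in Set.Ioi R, ENNReal.ofReal (s ^ r) = ENNReal.ofReal (-R ^ (r + 1) / (r + 1)) := by
  rw [← ofReal_integral_eq_lintegral_ofReal (integrableOn_Ioi_rpow_of_lt hr hR), integral_Ioi_rpow_of_lt hr hR]
  filter_upwards [ae_restrict_mem measurableSet_Ioi] with s hs
  have : R < s := hs
  exact Real.rpow_nonneg (by linarith) _

lemma near_int {p q : ℝ} (hp : 2 < p) (hq : q = p / (p - 1)) {A : ℝ} (hA : 0 ≤ A) (t : ℝ) :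
    ∫⁻ t', ENNReal.ofReal (nearK p A |t - t'|) ≤ ENNReal.ofReal ((2 / (1 - 2/p) + 2) * A ^ q) := by
  have hp1 : 0 < p - 1 := by linarith
  have hp0 : 0 < p := by linarith
  have hq1 : 1 < q := by rw [hq, lt_div_iff₀ hp1]; linarith
  have hq0 : 0 < q := by linarith
  have h2p : 2 / p < 1 := by rw [div_lt_one hp0]; exact hp
  rw [lint_abs_sub (fun r => ENNReal.ofReal (nearK p A r))]
  rcases hA.eq_or_lt with h | h
  · rw [← h]; simp [nearK]
  set R := A ^ (-q) with hR
  have hR0 : 0 < R := Real.rpow_pos_of_pos h _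
  have hsplit : Set.Ioi (0:ℝ) = Set.Ioc 0 R ∪ Set.Ioi R := (Set.Ioc_union_Ioi_eq_Ioi hR0.le).symm
  have i1 : ∫⁻ r in Set.Ioc 0 R, ENNReal.ofReal (nearK p A r) = ENNReal.ofReal (A ^ q / (1 - 2/p)) := by
    rw [setLIntegral_congr_fun (g := fun r => ENNReal.ofReal (A ^ 2) * ENNReal.ofReal (r ^ (-(2/p)))) measurableSet_Ioc,
      lintegral_const_mul _ (by fun_prop), lint_rpow (by linarith) hR0.le, ← ENNReal.ofReal_mul (by positivity)]
    · congr 1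
      rw [hR, ← Real.rpow_mul hA, mul_div_assoc', ← Real.rpow_natCast A 2, ← Real.rpow_add h]
      rw [show -(2/p) + 1 = 1 - 2/p by ring]
      congr 2
      rw [hq]; push_cast; field_simp; ring
    · intro r hr
      simp only [nearK]
      rw [if_neg h.ne', ← hq, if_pos hr.2, ENNReal.ofReal_mul (by positivity)]
  have i2 : ∫⁻ r in Set.Ioi R, ENNReal.ofReal (nearK p A r) = ENNReal.ofReal (A ^ q) := by
    rw [setLIntegral_congr_fun (g := fun r => ENNReal.ofReal (r ^ (-2 : ℝ))) measurableSet_Ioi,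
      lint_rpow_Ioi (by norm_num) hR0]
    · congr 1
      rw [hR, ← Real.rpow_mul hA]; norm_num
    · intro r hr
      simp only [nearK]
      rw [if_neg h.ne', ← hq, if_neg (not_le.2 hr)]
  calc _ ≤ 2 * (ENNReal.ofReal (A ^ q / (1 - 2/p)) + ENNReal.ofReal (A ^ q)) := by
        rw [hsplit]
        gcongr
        refine (lintegral_union_le _ _ _).trans ?_
        rw [i1, i2]
    _ = _ := by
        have : 0 < 1 - 2/p := by linarith
        rw [← ENNReal.ofReal_add (by positivity) (by positivity), show (2:ℝ≥0∞) = ENNReal.ofReal 2 by simp, ← ENNReal.ofReal_mul (by norm_num)]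
        congr 1; field_simp

/-- off-diagonal row weight -/
def offW (σ τ t t' : ℝ) : ℝ :=
  (if t' < t then t' ^ (-σ) * t ^ (σ - 1) else 0) + (if t < t' then t' ^ (-τ) * t ^ (τ - 1) else 0)

lemma offW_meas (σ τ : ℝ) : Measurable (fun z : ℝ × ℝ => offW σ τ z.1 z.2) := by
  unfold offW
  apply Measurable.add
  · exact Measurable.ite (measurableSet_lt (by fun_prop) (by fun_prop)) (by fun_prop) (by fun_prop)
  · exact Measurable.ite (measurableSet_lt (by fun_prop) (by fun_prop)) (by fun_prop) (by fun_prop)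

lemma offW_nonneg (σ τ : ℝ) {t t' : ℝ} (ht : 0 < t) (ht' : 0 < t') : 0 ≤ offW σ τ t t' := by
  unfold offW; split_ifs <;> positivity

lemma offW_int {σ τ : ℝ} (hσ : σ < 1) (hτ : 1 < τ) {t : ℝ} (ht : 0 < t) :
    ∫⁻ t' in Set.Ioi 0, ENNReal.ofReal (offW σ τ t t') ≤ ENNReal.ofReal (1 / (1 - σ) + 1 / (τ - 1)) := by
  have hsplit : Set.Ioi (0:ℝ) = Set.Ioc 0 t ∪ Set.Ioi t := (Set.Ioc_union_Ioi_eq_Ioi ht.le).symm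
  have s1 : 0 < 1 - σ := by linarith
  have s2 : 0 < τ - 1 := by linarith
  have i1 : ∫⁻ r in Set.Ioc 0 t, ENNReal.ofReal (offW σ τ t r) ≤ ENNReal.ofReal (1 / (1 - σ)) := by
    calc _ ≤ ∫⁻ r in Set.Ioc 0 t, ENNReal.ofReal (t ^ (σ - 1)) * ENNReal.ofReal (r ^ (-σ)) := by
          apply setLIntegral_mono' measurableSet_Ioc
          intro r hr
          rw [← ENNReal.ofReal_mul (by positivity)]
          apply ENNReal.ofReal_le_ofReal
          unfold offW
          rw [if_neg (not_lt.2 hr.2), add_zero]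
          have : 0 ≤ r := hr.1.le
          split_ifs
          · rw [mul_comm]
          · positivity
      _ = _ := by
          rw [lintegral_const_mul _ (by fun_prop), lint_rpow (by linarith) ht.le, ← ENNReal.ofReal_mul (by positivity)]
          congr 1
          rw [mul_div_assoc', ← Real.rpow_add ht, show σ - 1 + (-σ + 1) = 0 by ring, Real.rpow_zero]
          congr 1; ring
  have i2 : ∫⁻ r in Set.Ioi t, ENNReal.ofReal (offW σ τ t r) ≤ ENNReal.ofReal (1 / (τ - 1)) := by
    calc _ ≤ ∫⁻ r in Set.Ioi t, ENNReal.ofReal (t ^ (τ - 1)) * ENNReal.ofReal (r ^ (-τ)) := by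
          apply setLIntegral_mono' measurableSet_Ioi
          intro r hr
          have hr : t < r := hr
          rw [← ENNReal.ofReal_mul (by positivity)]
          apply ENNReal.ofReal_le_ofReal
          unfold offW
          rw [if_neg (not_lt.2 hr.le), if_pos hr, zero_add, mul_comm]
      _ = _ := by
          rw [lintegral_const_mul _ (by fun_prop), lint_rpow_Ioi (by linarith) ht, ← ENNReal.ofReal_mul (by positivity)]
          congr 1
          rw [mul_div_assoc', mul_neg, ← Real.rpow_add ht, show τ - 1 + (-τ + 1) = 0 by ring, Real.rpow_zero,
            show -τ + 1 = -(τ - 1) by ring, neg_div_neg_eq]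
  rw [hsplit]
  refine (lintegral_union_le _ _ _).trans ?_
  rw [ENNReal.ofReal_add (by positivity) (by positivity)]
  gcongr

lemma off_point {p q α lam : ℝ} (hp : 2 < p) (hq : q = p / (p - 1)) (hα : 0 ≤ α) (hl : 0 < lam)
    (hs : 2 * α + lam = 2 / p) {A B t t' : ℝ} (hA : 0 ≤ A) (hB : 0 ≤ B) (ht' : 0 < t') (htt : t' ≤ t / 2) :
    A * B * ((1 + t) ^ (-α) * (1 + t') ^ (-α) * (1 + |t - t'|) ^ (-lam)) ≤
     2 ^ lam * (A ^ q * offW ((1 + α * p)/2) (1 + (1 - α * p)/2) t t' + B ^ q * offW ((1 + α * p)/2) (1 + (1 - α * p)/2) t' t + A ^ q * B ^ q) := by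
  have hp1 : 0 < p - 1 := by linarith
  have hp0 : 0 < p := by linarith
  have ht : 0 < t := by linarith
  have hlt : t' < t := by linarith
  have hq1 : 1 < q := by rw [hq, lt_div_iff₀ hp1]; linarith
  have hq0 : 0 < q := by linarith
  set σ := (1 + α * p)/2 with hσ
  set τ := 1 + (1 - α * p)/2 with hτ
  have hlam : lam = 2 / p - 2 * α := by linarith
  have k1 : (1 + t) ^ (-α) * (1 + t') ^ (-α) * (1 + |t - t'|) ^ (-lam) ≤ 2 ^ lam * (t' ^ (-α) * t ^ (-(α + lam))) := by
    have e : 2 ^ lam * (t' ^ (-α) * t ^ (-(α + lam))) = t ^ (-α) * t' ^ (-α) * (t / 2) ^ (-lam) := by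
      rw [neg_add, Real.rpow_add ht, Real.div_rpow ht.le (by norm_num), Real.rpow_neg (by norm_num : (0:ℝ) ≤ 2)]
      field_simp
    rw [e]
    have m1 : (1 + t) ^ (-α) ≤ t ^ (-α) := Real.rpow_le_rpow_of_nonpos ht (by linarith) (by linarith)
    have m2 : (1 + t') ^ (-α) ≤ t' ^ (-α) := Real.rpow_le_rpow_of_nonpos ht' (by linarith) (by linarith)
    have m3 : (1 + |t - t'|) ^ (-lam) ≤ (t/2) ^ (-lam) :=
      Real.rpow_le_rpow_of_nonpos (by linarith) (by rw [abs_of_pos (by linarith)]; linarith) (by linarith)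
    gcongr
  have hy := Real.geom_mean_le_arith_mean3_weighted (w₁ := 1/p) (w₂ := 1/p) (w₃ := 1 - 2/p)
    (p₁ := A ^ q * (t' ^ (-σ) * t ^ (σ - 1))) (p₂ := B ^ q * (t ^ (-τ) * t' ^ (τ - 1))) (p₃ := A ^ q * B ^ q)
    (by positivity) (by positivity) (by rw [sub_nonneg, div_le_one hp0]; exact hp.le) (by positivity) (by positivity) (by positivity)
    (by ring)
  have e : (A ^ q * (t' ^ (-σ) * t ^ (σ - 1))) ^ (1/p) * (B ^ q * (t ^ (-τ) * t' ^ (τ - 1))) ^ (1/p) * (A ^ q * B ^ q) ^ (1 - 2/p)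
     = A * B * (t' ^ (-α) * t ^ (-(α + lam))) := by
    rw [Real.mul_rpow (by positivity) (by positivity), Real.mul_rpow (by positivity) (by positivity),
      Real.mul_rpow (by positivity) (by positivity), Real.mul_rpow (by positivity) (by positivity), Real.mul_rpow (by positivity) (by positivity)]
    simp only [← Real.rpow_mul hA, ← Real.rpow_mul hB, ← Real.rpow_mul ht.le, ← Real.rpow_mul ht'.le]
    have f1 : ∀ x : ℝ, 0 ≤ x → x ^ (q * (1/p)) * x ^ (q * (1 - 2/p)) = x := by
      intro x hx
      rw [← Real.rpow_add_of_nonneg hx (by positivity) (mul_nonneg hq0.le (by rw [sub_nonneg, div_le_one hp0]; exact hp.le))]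
      have : q * (1/p) + q * (1 - 2/p) = 1 := by rw [hq]; field_simp; ring
      rw [this, Real.rpow_one]
    have f2 : t' ^ (-σ * (1/p)) * t' ^ ((τ - 1) * (1/p)) = t' ^ (-α) := by
      rw [← Real.rpow_add ht']; congr 1; rw [hσ, hτ]; field_simp; ring
    have f3 : t ^ ((σ - 1) * (1/p)) * t ^ (-τ * (1/p)) = t ^ (-(α + lam)) := by
      rw [← Real.rpow_add ht]; congr 1; rw [hσ, hτ, hlam]; field_simp; ring
    calc _ = (A ^ (q * (1/p)) * A ^ (q * (1 - 2/p))) * (B ^ (q * (1/p)) * B ^ (q * (1 - 2/p))) *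
          ((t' ^ (-σ * (1/p)) * t' ^ ((τ - 1) * (1/p))) * (t ^ ((σ - 1) * (1/p)) * t ^ (-τ * (1/p)))) := by ring
      _ = _ := by rw [f1 A hA, f1 B hB, f2, f3]
  rw [e] at hy
  have w1 : offW σ τ t t' = t' ^ (-σ) * t ^ (σ - 1) := by
    unfold offW; rw [if_pos hlt, if_neg (not_lt.2 hlt.le), add_zero]
  have w2 : offW σ τ t' t = t ^ (-τ) * t' ^ (τ - 1) := by
    unfold offW; rw [if_pos hlt, if_neg (not_lt.2 hlt.le), zero_add]
  rw [w1, w2]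
  have g1 : 1 / p ≤ 1 := by rw [div_le_one hp0]; linarith
  have g2 : 1 - 2/p ≤ 1 := by have : 0 < 2 / p := by positivity
                              linarith
  calc _ ≤ A * B * (2 ^ lam * (t' ^ (-α) * t ^ (-(α + lam)))) := by gcongr
    _ = 2 ^ lam * (A * B * (t' ^ (-α) * t ^ (-(α + lam)))) := by ring
    _ ≤ _ := by
      apply mul_le_mul_of_nonneg_left _ (by positivity)
      refine hy.trans ?_
      have n1 : 0 ≤ A ^ q * (t' ^ (-σ) * t ^ (σ - 1)) := by positivity
      have n2 : 0 ≤ B ^ q * (t ^ (-τ) * t' ^ (τ - 1)) := by positivity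
      have n3 : 0 ≤ A ^ q * B ^ q := by positivity
      nlinarith

lemma hls_point {p q α lam : ℝ} (hp : 2 < p) (hq : q = p / (p - 1)) (hα : 0 ≤ α) (hl : 0 < lam)
    (hs : 2 * α + lam = 2 / p) {A B t t' : ℝ} (hA : 0 ≤ A) (hB : 0 ≤ B) (ht : 0 < t) (ht' : 0 < t') (hne : t ≠ t') :
    A * B * ((1 + t) ^ (-α) * (1 + t') ^ (-α) * (1 + |t - t'|) ^ (-lam)) ≤
     (nearK p A |t - t'| + 2 ^ lam * (A ^ q * offW ((1 + α * p)/2) (1 + (1 - α * p)/2) t t')) +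
     (nearK p B |t' - t| + 2 ^ lam * (B ^ q * offW ((1 + α * p)/2) (1 + (1 - α * p)/2) t' t)) +
     (1 + 2 ^ lam) * (A ^ q * B ^ q) := by
  have n1 := nearK_nonneg p A (abs_nonneg (t - t'))
  have n2 := nearK_nonneg p B (abs_nonneg (t' - t))
  have n3 : 0 ≤ A ^ q * offW ((1 + α * p)/2) (1 + (1 - α * p)/2) t t' := mul_nonneg (by positivity) (offW_nonneg _ _ ht ht')
  have n4 : 0 ≤ B ^ q * offW ((1 + α * p)/2) (1 + (1 - α * p)/2) t' t := mul_nonneg (by positivity) (offW_nonneg _ _ ht' ht)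
  have n5 : 0 ≤ A ^ q * B ^ q := by positivity
  have n6 : (0:ℝ) < 2 ^ lam := by positivity
  rcases le_or_gt t' (t/2) with h1 | h1
  · have := off_point hp hq hα hl hs hA hB ht' h1
    nlinarith
  rcases le_or_gt t (t'/2) with h2 | h2
  · have := off_point hp hq hα hl hs hB hA ht h2
    rw [abs_sub_comm, mul_comm B A, mul_comm ((1 + t') ^ (-α)), mul_comm (B ^ q) (A ^ q)] at this
    nlinarith
  have hδ : 0 < |t - t'| := abs_pos.2 (sub_ne_zero.2 hne)
  have hδt : |t - t'| ≤ t := by rw [abs_le]; constructor <;> linarith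
  have hδt' : |t - t'| ≤ t' := by rw [abs_le]; constructor <;> linarith
  have hk : (1 + t) ^ (-α) * (1 + t') ^ (-α) * (1 + |t - t'|) ^ (-lam) ≤ |t - t'| ^ (-(2/p)) := by
    rw [← hs, show -(2 * α + lam) = -α + -α + -lam by ring, Real.rpow_add hδ, Real.rpow_add hδ]
    have m1 : (1 + t) ^ (-α) ≤ |t - t'| ^ (-α) := Real.rpow_le_rpow_of_nonpos hδ (by linarith) (by linarith)
    have m2 : (1 + t') ^ (-α) ≤ |t - t'| ^ (-α) := Real.rpow_le_rpow_of_nonpos hδ (by linarith) (by linarith)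
    have m3 : (1 + |t - t'|) ^ (-lam) ≤ |t - t'| ^ (-lam) := Real.rpow_le_rpow_of_nonpos hδ (by linarith) (by linarith)
    gcongr
  have hk2 : A * B * ((1 + t) ^ (-α) * (1 + t') ^ (-α) * (1 + |t - t'|) ^ (-lam)) ≤ A * B * |t - t'| ^ (-(2/p)) := by
    gcongr
  rcases le_total B A with h | h
  · have := near_point hp hq hA hB hδ h
    nlinarith
  · have := near_point hp hq hB hA hδ h
    rw [abs_sub_comm t' t]
    rw [abs_sub_comm t' t] at n2
    rw [mul_comm B A, mul_comm (B ^ q) (A ^ q)] at this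
    nlinarith

lemma hls_row {p q : ℝ} (hp : 2 < p) (hq : q = p / (p - 1)) {σ τ : ℝ} (hσ : σ < 1) (hτ : 1 < τ) (L : ℝ) (hL : 0 ≤ L)
    {A t : ℝ} (hA : 0 ≤ A) (ht : 0 < t) :
    ∫⁻ t' in Set.Ioi 0, ENNReal.ofReal (nearK p A |t - t'| + L * (A ^ q * offW σ τ t t')) ≤
      ENNReal.ofReal (2 / (1 - 2/p) + 2 + L * (1 / (1 - σ) + 1 / (τ - 1))) * ENNReal.ofReal (A ^ q) := by
  have h2p : 2 / p < 1 := by rw [div_lt_one (by linarith)]; exact hp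
  have h2p' : 0 < 1 - 2/p := by linarith
  have s1 : 0 < 1 - σ := by linarith
  have s2 : 0 < τ - 1 := by linarith
  have hm1 : Measurable fun t' => nearK p A |t - t'| := (nearK_meas p).comp (by fun_prop : Measurable fun t' : ℝ => (A, |t - t'|))
  have hm2 : Measurable fun t' => offW σ τ t t' := (offW_meas σ τ).comp (by fun_prop : Measurable fun t' : ℝ => (t, t'))
  calc _ ≤ ∫⁻ t' in Set.Ioi 0, (ENNReal.ofReal (nearK p A |t - t'|) + ENNReal.ofReal (L * A ^ q) * ENNReal.ofReal (offW σ τ t t')) := by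
        apply lintegral_mono
        intro t'
        simp only
        rw [← ENNReal.ofReal_mul (by positivity), mul_assoc]
        exact ENNReal.ofReal_add_le
    _ ≤ ENNReal.ofReal ((2 / (1 - 2/p) + 2) * A ^ q) + ENNReal.ofReal (L * A ^ q) * ENNReal.ofReal (1 / (1 - σ) + 1 / (τ - 1)) := by
        rw [lintegral_add_left hm1.ennreal_ofReal, lintegral_const_mul _ hm2.ennreal_ofReal]
        gcongr
        · exact (setLIntegral_le_lintegral _ _).trans (near_int hp hq hA t)
        · exact offW_int hσ hτ ht
    _ = _ := by
        rw [← ENNReal.ofReal_mul (by positivity), ← ENNReal.ofReal_mul (by positivity), ← ENNReal.ofReal_add (by positivity) (by positivity)]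
        congr 1; ring

lemma hls {p q α lam : ℝ} (hp : 2 < p) (hq : q = p / (p - 1)) (hα : 0 ≤ α) (hl : 0 < lam)
    (hs : 2 * α + lam = 2 / p) : ∃ C : ℝ, 0 ≤ C ∧ ∀ F G : ℝ → ℝ, Measurable F → Measurable G → (∀ t, 0 ≤ F t) → (∀ t, 0 ≤ G t) →
      ∫⁻ t in Set.Ioi 0, ENNReal.ofReal (F t ^ q) ≤ 1 → ∫⁻ t in Set.Ioi 0, ENNReal.ofReal (G t ^ q) ≤ 1 →
      ∫⁻ t in Set.Ioi 0, ∫⁻ t' in Set.Ioi 0, ENNReal.ofReal (F t * G t' * ((1 + t) ^ (-α) * (1 + t') ^ (-α) * (1 + |t - t'|) ^ (-lam)))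
       ≤ ENNReal.ofReal C := by
  have hp0 : 0 < p := by linarith
  have hαp : α * p < 1 := by
    have : 2 * α < 2 / p := by linarith
    rw [lt_div_iff₀ hp0] at this; linarith
  have h2p : 2 / p < 1 := by rw [div_lt_one (by linarith)]; exact hp
  have h2p' : 0 < 1 - 2/p := by linarith
  set σ := (1 + α * p)/2 with hσ
  set τ := 1 + (1 - α * p)/2 with hτ
  have hσ1 : σ < 1 := by rw [hσ]; linarith
  have hτ1 : 1 < τ := by rw [hτ]; linarith
  set L : ℝ := 2 ^ lam with hL
  have hL0 : 0 ≤ L := by positivity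
  set D := 2 / (1 - 2/p) + 2 + L * (1 / (1 - σ) + 1 / (τ - 1)) with hD
  have hD0 : 0 ≤ D := by
    have s1 : 0 < 1 - σ := by linarith
    have s2 : 0 < τ - 1 := by linarith
    positivity
  refine ⟨D + D + (1 + L), by positivity, ?_⟩
  intro F G hFm hGm hF hG hF1 hG1
  set R : (ℝ → ℝ) → ℝ → ℝ → ℝ≥0∞ := fun F t t' => ENNReal.ofReal (nearK p (F t) |t - t'| + L * (F t ^ q * offW σ τ t t')) with hR
  have hRm : ∀ F : ℝ → ℝ, Measurable F → Measurable (fun z : ℝ × ℝ => R F z.1 z.2) := by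
    intro F hF
    apply Measurable.ennreal_ofReal
    apply Measurable.add
    · exact (nearK_meas p).comp (by fun_prop : Measurable fun z : ℝ × ℝ => (F z.1, |z.1 - z.2|))
    · have := offW_meas σ τ
      fun_prop
  have hRi : ∀ F : ℝ → ℝ, Measurable F → (∀ t, 0 ≤ F t) → ∫⁻ t in Set.Ioi 0, ENNReal.ofReal (F t ^ q) ≤ 1 →
      ∫⁻ t in Set.Ioi 0, ∫⁻ t' in Set.Ioi 0, R F t t' ≤ ENNReal.ofReal D := by
    intro F hFm hF hF1
    calc _ ≤ ∫⁻ t in Set.Ioi 0, ENNReal.ofReal D * ENNReal.ofReal (F t ^ q) := by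
          apply setLIntegral_mono' measurableSet_Ioi
          intro t ht
          exact hls_row hp hq hσ1 hτ1 L hL0 (hF t) ht
      _ ≤ ENNReal.ofReal D * 1 := by
          rw [lintegral_const_mul _ (by fun_prop)]; gcongr
      _ = _ := mul_one _
  calc _ ≤ ∫⁻ t in Set.Ioi 0, ∫⁻ t' in Set.Ioi 0, (R F t t' + R G t' t + ENNReal.ofReal ((1 + L)) * (ENNReal.ofReal (F t ^ q) * ENNReal.ofReal (G t' ^ q))) := by
        apply setLIntegral_mono' measurableSet_Ioi
        intro t ht
        apply lintegral_mono_ae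
        have hne : ∀ᵐ t' : ℝ, t' ≠ t := by
          rw [ae_iff]; simp
        filter_upwards [ae_restrict_mem measurableSet_Ioi, ae_restrict_of_ae hne] with t' ht' hne
        have hpt := hls_point hp hq hα hl hs (hF t) (hG t') ht ht' (Ne.symm hne)
        have q1 := hF t
        have q2 := hG t'
        rw [← ENNReal.ofReal_mul (by positivity), ← ENNReal.ofReal_mul (by positivity)]
        refine (ENNReal.ofReal_le_ofReal hpt).trans ?_
        refine ENNReal.ofReal_add_le.trans ?_
        gcongr
        exact ENNReal.ofReal_add_le
    _ = (∫⁻ t in Set.Ioi 0, ∫⁻ t' in Set.Ioi 0, R F t t') + (∫⁻ t in Set.Ioi 0, ∫⁻ t' in Set.Ioi 0, R G t' t) +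
        ENNReal.ofReal (1 + L) * ((∫⁻ t in Set.Ioi 0, ENNReal.ofReal (F t ^ q)) * (∫⁻ t in Set.Ioi 0, ENNReal.ofReal (G t ^ q))) := by
        have m1 := hRm F hFm
        have m2 : Measurable (fun z : ℝ × ℝ => R G z.2 z.1) := (hRm G hGm).comp measurable_swap
        have m1' : ∀ t, Measurable (fun t' => R F t t') := fun t => m1.comp (by fun_prop : Measurable fun t' : ℝ => (t, t'))
        have m2' : ∀ t, Measurable (fun t' => R G t' t) := fun t => m2.comp (by fun_prop : Measurable fun t' : ℝ => (t, t'))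
        have c1 : ∀ t, ∫⁻ t' in Set.Ioi 0, (R F t t' + R G t' t + ENNReal.ofReal ((1 + L)) * (ENNReal.ofReal (F t ^ q) * ENNReal.ofReal (G t' ^ q)))
           = (∫⁻ t' in Set.Ioi 0, R F t t') + (∫⁻ t' in Set.Ioi 0, R G t' t) +
            ENNReal.ofReal (1 + L) * (ENNReal.ofReal (F t ^ q) * ∫⁻ t' in Set.Ioi 0, ENNReal.ofReal (G t' ^ q)) := by
          intro t
          have m3 : Measurable (fun t' => R F t t' + R G t' t) := (m1' t).add (m2' t)
          rw [lintegral_add_left m3, lintegral_add_left (m1' t), lintegral_const_mul _ (by fun_prop),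
            lintegral_const_mul _ (by fun_prop)]
        simp only [c1]
        rw [lintegral_add_left, lintegral_add_left, lintegral_const_mul _ (by fun_prop), lintegral_mul_const _ (by fun_prop)]
        · exact m1.lintegral_prod_right'
        · exact m1.lintegral_prod_right'.add m2.lintegral_prod_right'
    _ ≤ ENNReal.ofReal D + ENNReal.ofReal D + ENNReal.ofReal (1 + L) * (1 * 1) := by
        gcongr
        · exact hRi F hFm hF hF1
        · have m2 : Measurable (fun z : ℝ × ℝ => R G z.2 z.1) := (hRm G hGm).comp measurable_swap
          rw [lintegral_lintegral_swap m2.aemeasurable]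
          exact hRi G hGm hG hG1
    _ = _ := by
        rw [mul_one, mul_one, ← ENNReal.ofReal_add hD0 hD0, ← ENNReal.ofReal_add (by positivity) (by positivity)]

end HLS





section HLSE

lemma hlsE (E : Type*) [NormedAddCommGroup E] [InnerProductSpace ℝ E] [FiniteDimensional ℝ E]
    [MeasurableSpace E] [BorelSpace E] [Nontrivial E] {p q a : ℝ} (hp : 2 < p) (hq : q = p / (p - 1)) (ha : 0 < a)
    (hpk : 1 ≤ (2 * (Module.finrank ℝ E : ℝ) + a) * (1/2 - 1/p)) :
    ∃ C : ℝ, 0 ≤ C ∧ ∀ ψ : ℝ → ℝ, Measurable ψ → (∀ t, 0 ≤ ψ t) →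
      ∫⁻ z : E, ENNReal.ofReal (ψ ‖z‖ ^ q) ≤ 1 →
      ∫⁻ z : E, ∫⁻ z' : E, ENNReal.ofReal (((1 + ‖z‖) ^ (-(((Module.finrank ℝ E : ℝ) - 1)/2)) * ψ ‖z‖) *
        ((1 + ‖z'‖) ^ (-(((Module.finrank ℝ E : ℝ) - 1)/2)) * ψ ‖z'‖) * (1 + |‖z‖ - ‖z'‖|) ^ (-(a * (1/2 - 1/p)))) ≤ ENNReal.ofReal C := by
  set n := Module.finrank ℝ E with hn
  have hn1 : 1 ≤ n := Module.finrank_pos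
  have hnr : (1:ℝ) ≤ n := by exact_mod_cast hn1
  have hp1 : 0 < p - 1 := by linarith
  have hp0 : 0 < p := by linarith
  have hq1 : 1 < q := by rw [hq, lt_div_iff₀ hp1]; linarith
  have hq0 : 0 < q := by linarith
  set x := 1/2 - 1/p with hx
  have hx0 : 0 < x := by
    rw [hx, sub_pos]; exact one_div_lt_one_div_of_lt (by norm_num) hp
  set D := (2 * ((n:ℝ) - 1) + a) * x with hD
  have hD0 : 0 < D := by
    have : 0 < 2 * ((n:ℝ) - 1) + a := by linarith
    positivity
  have hDp : 2 / p ≤ D := by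
    have : 2 / p = 1 - 2 * x := by rw [hx]; ring
    rw [this, hD]; nlinarith
  set θ := (2 / p) / D with hθ
  have hθ0 : 0 < θ := by positivity
  have hθ1 : θ ≤ 1 := by rw [hθ, div_le_one hD0]; exact hDp
  set α := θ * (((n:ℝ) - 1) * x) with hα
  have hn0 : 0 ≤ (n:ℝ) - 1 := by linarith
  have hα0 : 0 ≤ α := by positivity
  obtain ⟨C, hC, hb⟩ := hls (α := α) (lam := θ * (a * x)) hp hq hα0 (by positivity) (by
    rw [hα, ← mul_assoc, ← mul_assoc]
    have : θ * D = 2 / p := by rw [hθ]; field_simp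
    rw [← this, hD]; ring)
  set S : ℝ := (sph E Set.univ).toReal with hS
  have hSpos : 0 < S := ENNReal.toReal_pos (by
    intro h0
    have := lintegral_radial (F := E) (f := fun r => if r < 1 then 1 else 0) (Measurable.ite measurableSet_Iio measurable_const measurable_const)
    rw [h0, zero_mul] at this
    have h2 : ∫⁻ z : E, (if ‖z‖ < 1 then 1 else 0 : ℝ≥0∞) = volume (Metric.ball (0:E) 1) := by
      rw [← setLIntegral_one, ← lintegral_indicator measurableSet_ball]
      congr with z
      simp [Set.indicator]
    rw [h2] at this
    exact (Metric.measure_ball_pos volume (0:E) one_pos).ne' this) (measure_ne_top _ _)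
  have hSe : sph E Set.univ = ENNReal.ofReal S := (ENNReal.ofReal_toReal (measure_ne_top _ _)).symm
  refine ⟨S * S * (S ^ (-(1/q)) * S ^ (-(1/q))) * C, by positivity, ?_⟩
  intro ψ hψ hψ0 hψ1
  set F : ℝ → ℝ := fun t => S ^ (1/q) * |t| ^ (((n:ℝ) - 1) / q) * ψ t with hF
  have hFm : Measurable F := by fun_prop
  have hF0 : ∀ t, 0 ≤ F t := fun t => by have := hψ0 t; positivity
  have hF1 : ∫⁻ t in Set.Ioi 0, ENNReal.ofReal (F t ^ q) ≤ 1 := by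
    refine le_trans (le_of_eq ?_) hψ1
    rw [lintegral_radial (F := E) (f := fun r => ENNReal.ofReal (ψ r ^ q)) (by fun_prop), hSe, ← lintegral_const_mul _ (by fun_prop)]
    apply setLIntegral_congr_fun measurableSet_Ioi
    intro t ht
    have ht : 0 < t := ht
    simp only [hF]
    rw [← ENNReal.ofReal_mul (by positivity), ← ENNReal.ofReal_mul hSpos.le, abs_of_pos ht]
    congr 1
    rw [Real.mul_rpow (by positivity) (hψ0 t), Real.mul_rpow (by positivity) (by positivity), ← Real.rpow_mul hSpos.le, ← Real.rpow_mul ht.le,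
      one_div_mul_cancel hq0.ne', Real.rpow_one, div_mul_cancel₀ _ hq0.ne', ← Real.rpow_natCast, Nat.cast_sub hn1, Nat.cast_one, mul_assoc]
  have hmain := hb F F hFm hFm hF0 hF0 hF1 hF1
  -- polar
  set ω : ℝ → ℝ := fun t => (1 + t) ^ (-(((n:ℝ) - 1)/2)) * ψ t with hω
  have hωm : Measurable ω := by fun_prop
  have hpt : ∀ t, 0 < t → t ^ (n - 1) * ω t ≤ S ^ (-(1/q)) * (F t * (1 + t) ^ (-α)) := by
    intro t ht
    have e0 : t ^ (n - 1) = t ^ (((n:ℝ) - 1)/q) * t ^ (((n:ℝ) - 1)/p) := by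
      rw [← Real.rpow_add ht, ← Real.rpow_natCast, Nat.cast_sub hn1]; congr 1; rw [hq]; push_cast; field_simp; ring
    have e1 : t ^ (((n:ℝ) - 1)/p) * (1 + t) ^ (-(((n:ℝ) - 1)/2)) ≤ (1 + t) ^ (-α) := by
      calc _ ≤ (1 + t) ^ (((n:ℝ) - 1)/p) * (1 + t) ^ (-(((n:ℝ) - 1)/2)) := by gcongr; linarith
        _ = (1 + t) ^ (-(((n:ℝ) - 1) * x)) := by
            rw [← Real.rpow_add (by linarith)]; congr 1; rw [hx]; field_simp; ring
        _ ≤ (1 + t) ^ (-α) := by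
            apply Real.rpow_le_rpow_of_exponent_le (by linarith)
            rw [hα, neg_le_neg_iff]
            exact mul_le_of_le_one_left (by positivity) hθ1
    have e2 : S ^ (-(1/q)) * S ^ (1/q) = 1 := by rw [← Real.rpow_add hSpos]; simp
    have := hψ0 t
    calc t ^ (n - 1) * ω t = (t ^ (((n:ℝ) - 1)/q) * ψ t) * (t ^ (((n:ℝ) - 1)/p) * (1 + t) ^ (-(((n:ℝ) - 1)/2))) := by rw [e0, hω]; ring
      _ ≤ (t ^ (((n:ℝ) - 1)/q) * ψ t) * (1 + t) ^ (-α) := by gcongr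
      _ = (S ^ (-(1/q)) * S ^ (1/q)) * ((t ^ (((n:ℝ) - 1)/q) * ψ t) * (1 + t) ^ (-α)) := by rw [e2, one_mul]
      _ = _ := by simp only [hF, abs_of_pos ht]; ring
  have hin : ∀ r : ℝ, ∫⁻ z' : E, ENNReal.ofReal (ω r * ω ‖z'‖ * (1 + |r - ‖z'‖|) ^ (-(a * x)))
      = ENNReal.ofReal S * ∫⁻ t' in Set.Ioi 0, ENNReal.ofReal (t' ^ (n - 1)) * ENNReal.ofReal (ω r * ω t' * (1 + |r - t'|) ^ (-(a * x))) := by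
    intro r
    rw [lintegral_radial (F := E) (f := fun t' => ENNReal.ofReal (ω r * ω t' * (1 + |r - t'|) ^ (-(a * x)))) (by fun_prop), hSe]
  have hjm : Measurable (fun z : ℝ × ℝ => ENNReal.ofReal (z.2 ^ (n - 1)) * ENNReal.ofReal (ω z.1 * ω z.2 * (1 + |z.1 - z.2|) ^ (-(a * x)))) := by
    fun_prop
  change ∫⁻ z : E, ∫⁻ z' : E, ENNReal.ofReal (ω ‖z‖ * ω ‖z'‖ * (1 + |‖z‖ - ‖z'‖|) ^ (-(a * x))) ≤ _
  simp only [hin]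
  rw [lintegral_radial (F := E) (f := fun r => ENNReal.ofReal S * ∫⁻ t' in Set.Ioi 0, ENNReal.ofReal (t' ^ (n - 1)) * ENNReal.ofReal (ω r * ω t' * (1 + |r - t'|) ^ (-(a * x))))
    (hjm.lintegral_prod_right'.const_mul _), hSe]
  rw [ENNReal.ofReal_mul (by positivity), mul_assoc S S, ENNReal.ofReal_mul (by positivity), mul_assoc]
  gcongr
  calc _ ≤ ∫⁻ t in Set.Ioi 0, ENNReal.ofReal (S * (S ^ (-(1/q)) * S ^ (-(1/q)))) * ∫⁻ t' in Set.Ioi 0, ENNReal.ofReal (F t * F t' * ((1 + t) ^ (-α) * (1 + t') ^ (-α) * (1 + |t - t'|) ^ (-(θ * (a * x))))) := by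
        apply setLIntegral_mono' measurableSet_Ioi
        intro t ht
        have ht : 0 < t := ht
        rw [mul_left_comm, ENNReal.ofReal_mul hSpos.le, mul_assoc]
        refine mul_le_mul_right ?_ _
        rw [← lintegral_const_mul _ (by fun_prop), ← lintegral_const_mul _ (by fun_prop)]
        apply setLIntegral_mono' measurableSet_Ioi
        intro t' ht'
        have ht' : 0 < t' := ht'
        rw [← ENNReal.ofReal_mul (by positivity), ← ENNReal.ofReal_mul (by positivity), ← ENNReal.ofReal_mul (by positivity)]
        apply ENNReal.ofReal_le_ofReal
        have p1 := hpt t ht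
        have p2 := hpt t' ht'
        have w0 : 0 ≤ ω t' := by have := hψ0 t'; positivity
        have w1 := hF0 t
        have w2 := hF0 t'
        have p3 : (1 + |t - t'|) ^ (-(a * x)) ≤ (1 + |t - t'|) ^ (-(θ * (a * x))) := by
          apply Real.rpow_le_rpow_of_exponent_le (by linarith [abs_nonneg (t - t')])
          rw [neg_le_neg_iff]
          exact mul_le_of_le_one_left (by positivity) hθ1
        calc _ = (t ^ (n - 1) * ω t) * (t' ^ (n - 1) * ω t') * (1 + |t - t'|) ^ (-(a * x)) := by ring
          _ ≤ (S ^ (-(1/q)) * (F t * (1 + t) ^ (-α))) * (S ^ (-(1/q)) * (F t' * (1 + t') ^ (-α))) * (1 + |t - t'|) ^ (-(θ * (a * x))) := by gcongr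
          _ = _ := by ring
    _ ≤ ENNReal.ofReal (S * (S ^ (-(1/q)) * S ^ (-(1/q)))) * ENNReal.ofReal C := by
        rw [lintegral_const_mul]
        · gcongr
        · apply Measurable.lintegral_prod_right' (f := fun z : ℝ × ℝ => ENNReal.ofReal (F z.1 * F z.2 * ((1 + z.1) ^ (-α) * (1 + z.2) ^ (-α) * (1 + |z.1 - z.2|) ^ (-(θ * (a * x))))))
          fun_prop
    _ = _ := by rw [← ENNReal.ofReal_mul (by positivity)]

end HLSE




section Core

variable {E : Type*} [NormedAddCommGroup E] [InnerProductSpace ℝ E] [FiniteDimensional ℝ E]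
    [MeasurableSpace E] [BorelSpace E]

def sl (g : E → ℂ) (s : ℝ) (p : E × ℝ) : ℂ := ∫ y, g y * pw y s p

lemma pw_conj (y y' : E) (s s' : ℝ) (p : E × ℝ) :
    pw y s p * (starRingEnd ℂ) (pw y' s' p) = pw (y - y') (s - s') p := by
  unfold pw
  rw [← Complex.exp_conj, ← Complex.exp_add]
  congr 1
  simp only [map_mul, Complex.conj_ofReal, Complex.conj_I, inner_sub_left]
  push_cast
  ring

lemma slice_form {h : ℝ → ℝ} (hw : IsW h) (s s' : ℝ) {f g : E → ℂ} (hf : Integrable f) (hg : Integrable g) :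
    ∫ p : E × ℝ, (wt h p : ℂ) * (sl g s p * (starRingEnd ℂ) (sl f s' p))
      = ∫ y, g y * opK h (s - s') (fun y' => (starRingEnd ℂ) (f y')) y := by
  have hfc : Integrable (fun y' => (starRingEnd ℂ) (f y')) := by
    exact (Complex.conjCLE.toContinuousLinearMap.integrable_comp hf)
  have hΦ : Integrable (fun x : (E × E) × (E × ℝ) => (g x.1.1 * (starRingEnd ℂ) (f x.1.2)) * ((wt h x.2 : ℂ) * pw (x.1.1 - x.1.2) (s - s') x.2))
      ((volume.prod volume).prod volume) := by
    have h1 := ((hg.mul_prod hfc).mul_prod (wtpw_int hw (0:E) 0)).mul_bdd (c := 1)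
      (g := fun x : (E × E) × (E × ℝ) => pw (x.1.1 - x.1.2) (s - s') x.2)
      (by apply Continuous.aestronglyMeasurable; unfold pw; fun_prop) (ae_of_all _ fun p => (norm_pw _ _ _).le)
    refine h1.congr (ae_of_all _ fun x => ?_)
    simp [pw]
    ring
  have e1 : ∀ p : E × ℝ, (wt h p : ℂ) * (sl g s p * (starRingEnd ℂ) (sl f s' p))
      = ∫ z : E × E, (g z.1 * (starRingEnd ℂ) (f z.2)) * ((wt h p : ℂ) * pw (z.1 - z.2) (s - s') p) := by
    intro p
    unfold sl
    rw [← integral_conj, Measure.volume_eq_prod, ← integral_prod_mul, ← integral_const_mul]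
    congr with z
    rw [← pw_conj, map_mul]
    ring
  simp only [e1]
  rw [integral_integral_swap (f := fun (p : E × ℝ) (z : E × E) => (g z.1 * (starRingEnd ℂ) (f z.2)) * ((wt h p : ℂ) * pw (z.1 - z.2) (s - s') p))]
  · simp only [integral_const_mul]
    have h2 := hΦ.integral_prod_left
    simp only [integral_const_mul] at h2
    rw [Measure.volume_eq_prod, integral_prod _ h2]
    congr with y
    unfold opK kerW
    rw [← integral_const_mul]
    congr with y'
    ring
  · exact hΦ.swap

variable {E₂ : Type*} [NormedAddCommGroup E₂] [InnerProductSpace ℝ E₂] [FiniteDimensional ℝ E₂]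
    [MeasurableSpace E₂] [BorelSpace E₂]

lemma sl_bound (g : E → ℂ) (s : ℝ) (p : E × ℝ) : ‖sl g s p‖ ≤ ∫ y, ‖g y‖ := by
  unfold sl
  refine (norm_integral_le_integral_norm _).trans (le_of_eq ?_)
  simp only [norm_mul, norm_pw, mul_one]

lemma sl_meas {G : E × E₂ → ℂ} (hG : Measurable G) {τ : E₂ → ℝ} (hτ : Measurable τ) :
    StronglyMeasurable (fun x : E₂ × (E × ℝ) => sl (fun y => G (y, x.1)) (τ x.1) x.2) := by
  unfold sl
  apply StronglyMeasurable.integral_prod_right' (f := fun w : (E₂ × (E × ℝ)) × E => G (w.2, w.1.1) * pw w.2 (τ w.1.1) w.1.2)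
  apply Measurable.stronglyMeasurable
  unfold pw
  fun_prop

lemma core_fubini {h : ℝ → ℝ} (hw : IsW h) {G : E × E₂ → ℂ} (hG : Nice G) {τ : E₂ → ℝ} (hτ : Measurable τ) :
    ∫⁻ p : E × ℝ, ENNReal.ofReal (wt h p * ‖∫ x : E × E₂, G x * pw x.1 (τ x.2) p‖ ^ 2)
      ≤ ∫⁻ z : E₂ × E₂, ‖∫ y, G (y, z.1) * opK h (τ z.1 - τ z.2) (fun y' => (starRingEnd ℂ) (G (y', z.2))) y‖ₑ := by
  have hGi : Integrable G (volume.prod volume) := hG.integrable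
  obtain ⟨C, hC, hb⟩ := ker_bound E
  have hwi : Integrable (wt h : E × ℝ → ℝ) := (hb h hw).1
  have hGp : ∀ p : E × ℝ, Integrable (fun x : E × E₂ => G x * pw x.1 (τ x.2) p) (volume.prod volume) := by
    intro p
    apply hGi.mul_bdd (c := 1)
    · apply Measurable.aestronglyMeasurable; unfold pw; fun_prop
    · exact ae_of_all _ fun p => (norm_pw _ _ _).le
  have hT : ∀ p : E × ℝ, ∫ x : E × E₂, G x * pw x.1 (τ x.2) p = ∫ z, sl (fun y => G (y, z)) (τ z) p := by
    intro p
    rw [Measure.volume_eq_prod, integral_prod_symm _ (hGp p)]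
    rfl
  have hmi : Integrable (fun z : E₂ => ∫ y, ‖G (y, z)‖) := hGi.norm.integral_prod_right
  have hSi : ∀ p, Integrable (fun z => sl (fun y => G (y, z)) (τ z) p) := fun p => (hGp p).integral_prod_right
  have hΨ : Integrable (fun x : (E₂ × E₂) × (E × ℝ) => (wt h x.2 : ℂ) * (sl (fun y => G (y, x.1.1)) (τ x.1.1) x.2 *
      (starRingEnd ℂ) (sl (fun y => G (y, x.1.2)) (τ x.1.2) x.2))) ((volume.prod volume).prod volume) := by
    refine ((hmi.mul_prod hmi).mul_prod hwi).mono' ?_ (ae_of_all _ fun x => ?_)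
    · have m1 := ((sl_meas hG.meas hτ).comp_measurable (g := fun x : (E₂ × E₂) × (E × ℝ) => (x.1.1, x.2)) (by fun_prop))
      have m2 := ((sl_meas hG.meas hτ).comp_measurable (g := fun x : (E₂ × E₂) × (E × ℝ) => (x.1.2, x.2)) (by fun_prop))
      have m3 : Measurable (fun x : (E₂ × E₂) × (E × ℝ) => (wt h x.2 : ℂ)) := by
        have := wt_measurable (E := E) hw
        fun_prop
      exact (m3.stronglyMeasurable.mul (m1.mul (Complex.continuous_conj.comp_stronglyMeasurable m2))).aestronglyMeasurable
    · rw [norm_mul, norm_mul, RCLike.norm_conj, Complex.norm_real, Real.norm_of_nonneg (wt_nonneg hw _), mul_comm]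
      have a1 := sl_bound (fun y => G (y, x.1.1)) (τ x.1.1) x.2
      have a2 := sl_bound (fun y => G (y, x.1.2)) (τ x.1.2) x.2
      have a3 := wt_nonneg hw x.2
      gcongr
  have e1 : ∀ p : E × ℝ, ((wt h p * ‖∫ x : E × E₂, G x * pw x.1 (τ x.2) p‖ ^ 2 : ℝ) : ℂ) = ∫ z : E₂ × E₂, (wt h p : ℂ) * (sl (fun y => G (y, z.1)) (τ z.1) p *
      (starRingEnd ℂ) (sl (fun y => G (y, z.2)) (τ z.2) p)) := by
    intro p
    rw [hT, integral_const_mul, Measure.volume_eq_prod, integral_prod_mul (fun z => sl (fun y => G (y, z)) (τ z) p) (fun z => (starRingEnd ℂ) (sl (fun y => G (y, z)) (τ z) p)),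
      integral_conj, Complex.mul_conj, Complex.normSq_eq_norm_sq]
    push_cast
    rfl
  have hintq : Integrable (fun p : E × ℝ => wt h p * ‖∫ x : E × E₂, G x * pw x.1 (τ x.2) p‖ ^ 2) := by
    have := hΨ.integral_prod_right
    rw [← Measure.volume_eq_prod] at this
    simp only [← e1] at this
    exact this.re
  rw [← ofReal_integral_eq_lintegral_ofReal hintq (ae_of_all _ fun p => mul_nonneg (wt_nonneg hw p) (by positivity))]
  have e2 : ((∫ p : E × ℝ, wt h p * ‖∫ x : E × E₂, G x * pw x.1 (τ x.2) p‖ ^ 2 : ℝ) : ℂ)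
      = ∫ z : E₂ × E₂, ∫ y, G (y, z.1) * opK h (τ z.1 - τ z.2) (fun y' => (starRingEnd ℂ) (G (y', z.2))) y := by
    rw [← integral_complex_ofReal]
    simp only [e1]
    rw [integral_integral_swap (f := fun (p : E × ℝ) (z : E₂ × E₂) => (wt h p : ℂ) * (sl (fun y => G (y, z.1)) (τ z.1) p *
      (starRingEnd ℂ) (sl (fun y => G (y, z.2)) (τ z.2) p)))]
    · congr with z
      exact slice_form hw _ _ (hG.slice z.2).integrable (hG.slice z.1).integrable
    · exact hΨ.swap
  refine le_trans (le_of_eq ?_) (enorm_integral_le_lintegral_enorm _)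
  rw [← e2, ← ofReal_norm, Complex.norm_real, Real.norm_of_nonneg]
  exact integral_nonneg fun p => mul_nonneg (wt_nonneg hw p) (by positivity)

end Core




section Core2

lemma nq_mono_mul {X : Type*} [MeasureSpace X] {q : ℝ} (hq : 0 < q) {f g : X → ℂ} (hf : Integrable (fun x => ‖f x‖ ^ q)) (hg : Measurable g)
    {w : ℝ} (hw : 0 ≤ w) (h : ∀ x, ‖g x‖ ≤ w * ‖f x‖) : nq q g ≤ w * nq q f := by
  unfold nq
  have h1 : ∫ x, ‖g x‖ ^ q ≤ w ^ q * ∫ x, ‖f x‖ ^ q := by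
    rw [← integral_const_mul]
    apply integral_mono_of_nonneg (ae_of_all _ fun x => by positivity) (hf.const_mul _) (ae_of_all _ fun x => ?_)
    simp only
    rw [← Real.mul_rpow hw (norm_nonneg _)]
    exact Real.rpow_le_rpow (norm_nonneg _) (h x) hq.le
  have h0 : 0 ≤ ∫ x, ‖f x‖ ^ q := integral_nonneg fun x => by positivity
  have h0' : 0 ≤ ∫ x, ‖g x‖ ^ q := integral_nonneg fun x => by positivity
  calc _ ≤ (w ^ q * ∫ x, ‖f x‖ ^ q) ^ (1/q) := Real.rpow_le_rpow h0' h1 (by positivity)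
    _ = _ := by rw [Real.mul_rpow (by positivity) h0, ← Real.rpow_mul hw, mul_one_div_cancel hq.ne', Real.rpow_one]

lemma nq_conj {X : Type*} [MeasureSpace X] (q : ℝ) (f : X → ℂ) : nq q (fun x => (starRingEnd ℂ) (f x)) = nq q f := by
  simp [nq]

variable (E₁ E₂ : Type*) [NormedAddCommGroup E₁] [InnerProductSpace ℝ E₁] [FiniteDimensional ℝ E₁]
    [MeasurableSpace E₁] [BorelSpace E₁] [Nontrivial E₁] [NormedAddCommGroup E₂] [InnerProductSpace ℝ E₂] [FiniteDimensional ℝ E₂]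
    [MeasurableSpace E₂] [BorelSpace E₂] [Nontrivial E₂]

lemma core {p q : ℝ} (hp : 2 < p) (hq : q = p / (p - 1))
    (hpk : 1 ≤ (2 * (Module.finrank ℝ E₂ : ℝ) + (Module.finrank ℝ E₁ : ℝ)) * (1/2 - 1/p)) :
    ∃ C : ℝ, 0 ≤ C ∧ ∀ h : ℝ → ℝ, IsW h → 0 < ∫ r, h r → ∀ τ : E₂ → ℝ, Measurable τ →
      (∀ z z', |τ z - τ z'| = |‖z‖ - ‖z'‖|) → ∀ f G : E₁ × E₂ → ℂ, Nice f → Nice G →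
      (∀ y z z', ‖z‖ = ‖z'‖ → ‖f (y, z)‖ = ‖f (y, z')‖) →
      (∀ y z, ‖G (y, z)‖ ≤ (1 + ‖z‖) ^ (-(((Module.finrank ℝ E₂ : ℝ) - 1)/2)) * ‖f (y, z)‖) →
      ∫⁻ p : E₁ × ℝ, ENNReal.ofReal (wt h p * ‖∫ x : E₁ × E₂, G x * pw x.1 (τ x.2) p‖ ^ 2)
        ≤ ENNReal.ofReal (C * (∫ r, h r) * nq q f ^ 2) := by
  have hp1 : 0 < p - 1 := by linarith
  have hq1 : 1 < q := by rw [hq, lt_div_iff₀ hp1]; linarith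
  have hq0 : 0 < q := by linarith
  have ha : (0:ℝ) < Module.finrank ℝ E₁ := by exact_mod_cast Module.finrank_pos
  obtain ⟨C1, hC1, hkern⟩ := kern_form E₁ hp hq
  obtain ⟨C2, hC2, hhls⟩ := hlsE E₂ hp hq ha hpk
  refine ⟨C1 * C2, by positivity, ?_⟩
  intro h hw hI τ hτ hτd f G hf hG hrad hGf
  set M := ∫ r, h r with hM
  set N := nq q f with hN
  have hN0 : 0 ≤ N := nq_nonneg _ _
  have hfq : Integrable (fun x : E₁ × E₂ => ‖f x‖ ^ q) (volume.prod volume) := hf.rpow_integrable hq0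
  rcases eq_or_lt_of_le hN0 with hNz | hNp
  · -- trivial case
    have h1 : ∫ x, ‖f x‖ ^ q = 0 := by
      rw [hN, nq, eq_comm, Real.rpow_eq_zero (integral_nonneg fun x => by positivity) (by positivity)] at hNz
      exact hNz
    rw [Measure.volume_eq_prod, integral_eq_zero_iff_of_nonneg (fun x => by positivity) hfq, ← Measure.volume_eq_prod] at h1
    have hG0 : G =ᵐ[volume] 0 := by
      filter_upwards [h1] with x hx
      have : ‖f x‖ = 0 := by
        simp only [Pi.zero_apply] at hx
        rwa [Real.rpow_eq_zero (norm_nonneg _) hq0.ne'] at hx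
      have h2 := hGf x.1 x.2
      rw [Prod.mk.eta, this, mul_zero] at h2
      simpa using h2
    have h3 : ∀ p : E₁ × ℝ, ∫ x : E₁ × E₂, G x * pw x.1 (τ x.2) p = 0 := by
      intro p
      apply integral_eq_zero_of_ae
      filter_upwards [hG0] with x hx
      rw [hx]; simp
    simp [h3]
  obtain ⟨e, he⟩ := exists_norm_eq E₂ (zero_le_one (α := ℝ))
  set ψ0 : ℝ → ℝ := fun t => nq q (fun y => f (y, t • e)) with hψ0
  have hψ00 : ∀ t, 0 ≤ ψ0 t := fun t => nq_nonneg _ _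
  have hψ0m : Measurable ψ0 := by
    have : StronglyMeasurable (fun t : ℝ => ∫ y, ‖f (y, t • e)‖ ^ q) := by
      apply StronglyMeasurable.integral_prod_right' (f := fun w : ℝ × E₁ => ‖f (w.2, w.1 • e)‖ ^ q)
      have := hf.meas
      apply Measurable.stronglyMeasurable
      fun_prop
    exact this.measurable.pow_const _
  have hψz : ∀ z : E₂, ψ0 ‖z‖ = nq q (fun y => f (y, z)) := by
    intro z
    simp only [hψ0, nq]
    congr 2 with y
    rw [hrad y (‖z‖ • e) z (by rw [norm_smul, he]; simp)]
  have hψint : ∫⁻ z : E₂, ENNReal.ofReal ((ψ0 ‖z‖ / N) ^ q) ≤ 1 := by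
    have e1 : ∀ z : E₂, ENNReal.ofReal ((ψ0 ‖z‖ / N) ^ q) = ENNReal.ofReal ((N ^ q)⁻¹) * ENNReal.ofReal (∫ y, ‖f (y, z)‖ ^ q) := by
      intro z
      rw [← ENNReal.ofReal_mul (by positivity), hψz, Real.div_rpow (nq_nonneg _ _) hN0, nq, ← Real.rpow_mul (integral_nonneg fun x => by positivity),
        one_div_mul_cancel hq0.ne', Real.rpow_one, div_eq_inv_mul]
    simp only [e1]
    have hi := hfq.integral_prod_right
    rw [lintegral_const_mul' _ _ ENNReal.ofReal_ne_top, ← ofReal_integral_eq_lintegral_ofReal hi (ae_of_all _ fun z => integral_nonneg fun x => by positivity),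
      ← integral_prod_symm _ hfq, ← ENNReal.ofReal_mul (by positivity), ← Measure.volume_eq_prod]
    have : N ^ q = ∫ x, ‖f x‖ ^ q := by
      rw [hN, nq, ← Real.rpow_mul (integral_nonneg fun x => by positivity), one_div_mul_cancel hq0.ne', Real.rpow_one]
    rw [← this, inv_mul_cancel₀ (by positivity)]
    simp
  have hres := hhls (fun t => ψ0 t / N) (by fun_prop) (fun t => div_nonneg (hψ00 t) hN0) hψint
  refine (core_fubini hw hG hτ).trans ?_
  set β := -(((Module.finrank ℝ E₂ : ℝ) - 1)/2) with hβ
  set lam := -((Module.finrank ℝ E₁ : ℝ) * (1/2 - 1/p)) with hlam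
  have hpt : ∀ z : E₂ × E₂, ‖∫ y, G (y, z.1) * opK h (τ z.1 - τ z.2) (fun y' => (starRingEnd ℂ) (G (y', z.2))) y‖ₑ
      ≤ ENNReal.ofReal (C1 * M * N ^ 2) * ENNReal.ofReal (((1 + ‖z.1‖) ^ β * (ψ0 ‖z.1‖ / N)) * ((1 + ‖z.2‖) ^ β * (ψ0 ‖z.2‖ / N)) * (1 + |‖z.1‖ - ‖z.2‖|) ^ lam) := by
    intro z
    rw [← ENNReal.ofReal_mul (by positivity), ← ofReal_norm]
    apply ENNReal.ofReal_le_ofReal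
    have k1 := hkern h hw hI (τ z.1 - τ z.2) _ _ (hG.slice z.2).conj (hG.slice z.1)
    rw [hτd, nq_conj] at k1
    have k2 : ∀ z : E₂, nq q (fun y => G (y, z)) ≤ (1 + ‖z‖) ^ β * ψ0 ‖z‖ := by
      intro z
      rw [hψz]
      exact nq_mono_mul hq0 ((hf.slice z).rpow_integrable hq0) (hG.slice z).meas (by positivity) (fun y => hGf y z)
    have b1 := k2 z.1
    have b2 := k2 z.2
    have c1 := nq_nonneg q (fun y => G (y, z.1))
    have c2 := nq_nonneg q (fun y => G (y, z.2))
    have c3 := hψ00 ‖z.2‖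
    have c4 := hψ00 ‖z.1‖
    calc _ ≤ _ := k1
      _ ≤ C1 * M * (1 + |‖z.1‖ - ‖z.2‖|) ^ lam * ((1 + ‖z.2‖) ^ β * ψ0 ‖z.2‖) * ((1 + ‖z.1‖) ^ β * ψ0 ‖z.1‖) := by
          gcongr
      _ = _ := by field_simp
  refine (lintegral_mono hpt).trans ?_
  have hm : Measurable (fun z : E₂ × E₂ => ENNReal.ofReal (((1 + ‖z.1‖) ^ β * (ψ0 ‖z.1‖ / N)) * ((1 + ‖z.2‖) ^ β * (ψ0 ‖z.2‖ / N)) * (1 + |‖z.1‖ - ‖z.2‖|) ^ lam)) := by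
    fun_prop
  rw [lintegral_const_mul' _ _ ENNReal.ofReal_ne_top, Measure.volume_eq_prod, lintegral_prod _ hm.aemeasurable]
  refine (mul_le_mul_right hres _).trans (le_of_eq ?_)
  rw [← ENNReal.ofReal_mul (by positivity)]
  congr 1
  ring

end Core2




section Amp

lemma lint_sq_le {X : Type*} [MeasurableSpace X] (μ : Measure X) (f : X → ℝ≥0∞) (hf : AEMeasurable f μ) :
    (∫⁻ x, f x ∂μ) ^ 2 ≤ μ Set.univ * ∫⁻ x, f x ^ 2 ∂μ := by
  have h := ENNReal.lintegral_mul_le_Lp_mul_Lq μ (p := 2) (q := 2) Real.HolderConjugate.two_two hf (g := fun _ => 1) aemeasurable_const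
  simp only [Pi.mul_apply, mul_one, ENNReal.one_rpow, lintegral_one, ENNReal.rpow_two, one_pow] at h
  calc _ ≤ ((∫⁻ x, f x ^ 2 ∂μ) ^ (1/2:ℝ) * μ Set.univ ^ (1/2:ℝ)) ^ 2 := by gcongr
    _ = _ := by
      rw [mul_pow, ← ENNReal.rpow_two, ← ENNReal.rpow_two, ← ENNReal.rpow_mul, ← ENNReal.rpow_mul]
      norm_num
      rw [mul_comm]

lemma add_sq_le' (a b : ℝ≥0∞) : (a + b) ^ 2 ≤ 2 * a ^ 2 + 2 * b ^ 2 := by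
  have := ENNReal.rpow_add_le_mul_rpow_add_rpow a b (p := 2) (by norm_num)
  norm_num at this
  rw [mul_add] at this
  exact this

lemma nq_const_mul {X : Type*} [MeasureSpace X] {q : ℝ} (hq : 0 < q) (f : X → ℂ) {D : ℝ} (hD : 0 ≤ D) :
    nq q (fun x => (D : ℂ) * f x) = D * nq q f := by
  unfold nq
  have : ∀ x, ‖(D : ℂ) * f x‖ ^ q = D ^ q * ‖f x‖ ^ q := fun x => by
    rw [norm_mul, Complex.norm_real, Real.norm_of_nonneg hD, Real.mul_rpow hD (norm_nonneg _)]
  simp only [this, integral_const_mul]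
  rw [Real.mul_rpow (by positivity) (integral_nonneg fun x => by positivity), ← Real.rpow_mul hD, mul_one_div_cancel hq.ne', Real.rpow_one]

variable (E₁ E₂ : Type*) [NormedAddCommGroup E₁] [InnerProductSpace ℝ E₁] [FiniteDimensional ℝ E₁]
    [MeasurableSpace E₁] [BorelSpace E₁] [Nontrivial E₁] [NormedAddCommGroup E₂] [InnerProductSpace ℝ E₂] [FiniteDimensional ℝ E₂]
    [MeasurableSpace E₂] [BorelSpace E₂] [Nontrivial E₂]

lemma amp {p q D : ℝ} (hp : 2 < p) (hq : q = p / (p - 1)) (hD : 0 ≤ D)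
    (hpk : 1 ≤ (2 * (Module.finrank ℝ E₂ : ℝ) + (Module.finrank ℝ E₁ : ℝ)) * (1/2 - 1/p)) :
    ∃ C : ℝ, 0 ≤ C ∧ ∀ h : ℝ → ℝ, IsW h → 0 < ∫ r, h r → ∀ τ : E₂ → ℝ, Measurable τ →
      (∀ z z', |τ z - τ z'| = |‖z‖ - ‖z'‖|) → ∀ a a1 : ℝ → ℝ → ℂ, Continuous (Function.uncurry a) → Continuous (Function.uncurry a1) →
      (∀ s κ, HasDerivAt (a s) (a1 s κ) κ) →
      (∀ s κ, 0 ≤ s → 1/4 ≤ κ → ‖a s κ‖ ≤ D * (1 + s) ^ (-(((Module.finrank ℝ E₂ : ℝ) - 1)/2))) →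
      (∀ s κ, 0 ≤ s → 1/4 ≤ κ → ‖a1 s κ‖ ≤ D * (1 + s) ^ (-(((Module.finrank ℝ E₂ : ℝ) - 1)/2))) →
      ∀ f : E₁ × E₂ → ℂ, Nice f →
      (∀ y z z', ‖z‖ = ‖z'‖ → ‖f (y, z)‖ = ‖f (y, z')‖) →
      ∫⁻ p : E₁ × ℝ in {p | 1/4 ≤ p.2 ∧ p.2 ≤ 3/2}, ENNReal.ofReal (wt h p) * ‖∫ x : E₁ × E₂, (a ‖x.2‖ p.2 * f x) * pw x.1 (τ x.2) p‖ₑ ^ 2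
        ≤ ENNReal.ofReal (C * (∫ r, h r) * nq q f ^ 2) := by
  have hp1 : 0 < p - 1 := by linarith
  have hq1 : 1 < q := by rw [hq, lt_div_iff₀ hp1]; linarith
  have hq0 : 0 < q := by linarith
  obtain ⟨C0, hC0, hcore⟩ := core E₁ E₂ hp hq hpk
  refine ⟨10 * (C0 * D ^ 2), by positivity, ?_⟩
  intro h hw hI τ hτ hτd a a1 hca hca1 hder hab ha1b f hf hrad
  set β := -(((Module.finrank ℝ E₂ : ℝ) - 1)/2) with hβ
  have hβ0 : β ≤ 0 := by
    have : (1:ℝ) ≤ Module.finrank ℝ E₂ := by exact_mod_cast Module.finrank_pos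
    rw [hβ]; linarith
  have hβ1 : ∀ z : E₂, (1 + ‖z‖) ^ β ≤ 1 := fun z => Real.rpow_le_one_of_one_le_of_nonpos (by linarith [norm_nonneg z]) hβ0
  set B := C0 * (∫ r, h r) * (D * nq q f) ^ 2 with hB
  have hB0 : 0 ≤ B := by positivity
  have hDf : Nice (fun x : E₁ × E₂ => (D:ℂ) * f x) := hf.mul measurable_const (B := D) (fun x => by simp [abs_of_nonneg hD])
  -- application of core to an amplitude
  have happ : ∀ b : ℝ → ℂ, Continuous b → (∀ s, 0 ≤ s → ‖b s‖ ≤ D * (1 + s) ^ β) →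
      ∫⁻ p : E₁ × ℝ, ENNReal.ofReal (wt h p) * ‖∫ x : E₁ × E₂, (b ‖x.2‖ * f x) * pw x.1 (τ x.2) p‖ₑ ^ 2 ≤ ENNReal.ofReal B := by
    intro b hbc hbb
    have hN : Nice (fun x : E₁ × E₂ => b ‖x.2‖ * f x) := by
      apply hf.mul (g := fun x : E₁ × E₂ => b ‖x.2‖) (by fun_prop) (B := D)
      intro x
      refine (hbb _ (norm_nonneg _)).trans ?_
      exact mul_le_of_le_one_right hD (hβ1 _)
    have := hcore h hw hI τ hτ hτd (fun x => (D:ℂ) * f x) _ hDf hN (fun y z z' hz => by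
        simp only [norm_mul]; rw [hrad y z z' hz]) (fun y z => by
        simp only [norm_mul, Complex.norm_real, Real.norm_of_nonneg hD]
        calc _ ≤ (D * (1 + ‖z‖) ^ β) * ‖f (y, z)‖ := by gcongr; exact hbb _ (norm_nonneg _)
          _ = _ := by ring)
    rw [nq_const_mul hq0 _ hD] at this
    refine le_trans (le_of_eq ?_) this
    congr with p
    rw [ENNReal.ofReal_mul (wt_nonneg hw p), ENNReal.ofReal_pow (norm_nonneg _), ofReal_norm]
  set T0 : E₁ × ℝ → ℂ := fun p => ∫ x : E₁ × E₂, (a ‖x.2‖ (1/4) * f x) * pw x.1 (τ x.2) p with hT0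
  set T1 : ℝ → E₁ × ℝ → ℂ := fun κ' p => ∫ x : E₁ × E₂, (a1 ‖x.2‖ κ' * f x) * pw x.1 (τ x.2) p with hT1
  have hb0 : ∫⁻ p : E₁ × ℝ, ENNReal.ofReal (wt h p) * ‖T0 p‖ₑ ^ 2 ≤ ENNReal.ofReal B :=
    happ (fun s => a s (1/4)) (by fun_prop) (fun s hs => hab s _ hs le_rfl)
  have hb1 : ∀ κ', 1/4 ≤ κ' → ∫⁻ p : E₁ × ℝ, ENNReal.ofReal (wt h p) * ‖T1 κ' p‖ₑ ^ 2 ≤ ENNReal.ofReal B := fun κ' hκ' =>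
    happ (fun s => a1 s κ') (by fun_prop) (fun s hs => ha1b s _ hs hκ')
  have hfm := hf.meas
  have hpwm : Measurable (fun w : (ℝ × (E₁ × ℝ)) × (E₁ × E₂) => pw w.2.1 (τ w.2.2) w.1.2) := by unfold pw; fun_prop
  have hT1m : StronglyMeasurable (Function.uncurry T1) := by
    rw [hT1]
    apply StronglyMeasurable.integral_prod_right' (f := fun w : (ℝ × (E₁ × ℝ)) × (E₁ × E₂) => (a1 ‖w.2.2‖ w.1.1 * f w.2) * pw w.2.1 (τ w.2.2) w.1.2)
    apply Measurable.stronglyMeasurable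
    have : Measurable (fun w : (ℝ × (E₁ × ℝ)) × (E₁ × E₂) => a1 ‖w.2.2‖ w.1.1) := by
      apply Continuous.measurable
      exact hca1.comp (g := Function.uncurry a1) (f := fun w : (ℝ × (E₁ × ℝ)) × (E₁ × E₂) => (‖w.2.2‖, w.1.1)) (by fun_prop)
    fun_prop
  set I : Set ℝ := Set.Icc (1/4) (3/2) with hIdef
  have hfi : Integrable f (volume : Measure (E₁ × E₂)) := hf.integrable
  have hpt : ∀ p : E₁ × ℝ, 1/4 ≤ p.2 ∧ p.2 ≤ 3/2 →
      ‖∫ x : E₁ × E₂, (a ‖x.2‖ p.2 * f x) * pw x.1 (τ x.2) p‖ₑ ^ 2 ≤ 2 * ‖T0 p‖ₑ ^ 2 + 2 * (2 * ∫⁻ κ' in I, ‖T1 κ' p‖ₑ ^ 2) := by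
    rintro p ⟨hp1, hp2⟩
    have hsub : Set.Ioc (1/4) p.2 ⊆ I := fun t ht => ⟨ht.1.le, ht.2.trans hp2⟩
    have hF : Integrable (Function.uncurry fun (x : E₁ × E₂) (κ' : ℝ) => (a1 ‖x.2‖ κ' * f x) * pw x.1 (τ x.2) p)
        (volume.prod (volume.restrict (Set.Ioc (1/4) p.2))) := by
      have h1 : Integrable (fun x : E₁ × E₂ => D * ‖f x‖) := hfi.norm.const_mul _
      have h2 : Integrable (fun _ : ℝ => (1:ℝ)) (volume.restrict (Set.Ioc (1/4) p.2)) := integrable_const _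
      refine (h1.mul_prod h2).mono' ?_ ?_
      · apply Measurable.aestronglyMeasurable
        have m1 : Measurable (fun w : (E₁ × E₂) × ℝ => a1 ‖w.1.2‖ w.2) := by
          apply Continuous.measurable
          exact hca1.comp (g := Function.uncurry a1) (f := fun w : (E₁ × E₂) × ℝ => (‖w.1.2‖, w.2)) (by fun_prop)
        unfold Function.uncurry pw
        fun_prop
      · have : ∀ᵐ w ∂((volume : Measure (E₁ × E₂)).prod (volume.restrict (Set.Ioc (1/4) p.2))), w.2 ∈ Set.Ioc (1/4) p.2 := by
          have := (Measure.quasiMeasurePreserving_snd (μ := (volume : Measure (E₁ × E₂))) (ν := volume.restrict (Set.Ioc (1/4) p.2))).ae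
            (ae_restrict_mem measurableSet_Ioc)
          exact this
        filter_upwards [this] with w hw'
        simp only [Function.uncurry, norm_mul, norm_pw, mul_one]
        gcongr
        refine (ha1b _ _ (norm_nonneg _) hw'.1.le).trans ?_
        exact mul_le_of_le_one_right hD (hβ1 _)
    have e1 : ∫ x : E₁ × E₂, (a ‖x.2‖ p.2 * f x) * pw x.1 (τ x.2) p = T0 p + ∫ κ' in Set.Ioc (1/4) p.2, T1 κ' p := by
      have hx : ∀ x : E₁ × E₂, (a ‖x.2‖ p.2 * f x) * pw x.1 (τ x.2) p = (a ‖x.2‖ (1/4) * f x) * pw x.1 (τ x.2) p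
          + ∫ κ' in Set.Ioc (1/4) p.2, (a1 ‖x.2‖ κ' * f x) * pw x.1 (τ x.2) p := by
        intro x
        have := intervalIntegral.integral_eq_sub_of_hasDerivAt (a := 1/4) (b := p.2) (f := a ‖x.2‖) (f' := a1 ‖x.2‖) (fun t _ => hder _ t)
          (Continuous.intervalIntegrable (by fun_prop) _ _)
        rw [intervalIntegral.integral_of_le hp1] at this
        rw [integral_mul_const, integral_mul_const, this]
        ring
      simp only [hx]
      rw [integral_add, integral_integral_swap hF]
      · have hN : Nice (fun x : E₁ × E₂ => a ‖x.2‖ (1/4) * f x) := by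
          apply hf.mul (g := fun x : E₁ × E₂ => a ‖x.2‖ (1/4)) (by fun_prop) (B := D)
          intro x
          refine (hab _ _ (norm_nonneg _) le_rfl).trans ?_
          exact mul_le_of_le_one_right hD (hβ1 _)
        apply (hN.integrable (μ := volume)).mul_bdd (c := 1)
        · apply Measurable.aestronglyMeasurable; unfold pw; fun_prop
        · exact ae_of_all _ fun p => (norm_pw _ _ _).le
      · exact hF.integral_prod_left
    rw [e1]
    have hT1p : Measurable (fun κ' => ‖T1 κ' p‖ₑ) := (hT1m.measurable.comp (by fun_prop : Measurable fun κ' : ℝ => (κ', p))).enorm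
    calc _ ≤ (‖T0 p‖ₑ + ‖∫ κ' in Set.Ioc (1/4) p.2, T1 κ' p‖ₑ) ^ 2 := by gcongr; exact enorm_add_le _ _
      _ ≤ 2 * ‖T0 p‖ₑ ^ 2 + 2 * ‖∫ κ' in Set.Ioc (1/4) p.2, T1 κ' p‖ₑ ^ 2 := add_sq_le' _ _
      _ ≤ 2 * ‖T0 p‖ₑ ^ 2 + 2 * (∫⁻ κ' in I, ‖T1 κ' p‖ₑ) ^ 2 := by
          gcongr
          exact (enorm_integral_le_lintegral_enorm _).trans (lintegral_mono_set hsub)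
      _ ≤ _ := by
          gcongr
          refine (lint_sq_le _ _ hT1p.aemeasurable).trans ?_
          gcongr
          rw [Measure.restrict_apply_univ, hIdef, Real.volume_Icc]
          rw [← ENNReal.ofReal_ofNat]
          apply ENNReal.ofReal_le_ofReal
          norm_num
  have hwm : Measurable (wt h : E₁ × ℝ → ℝ) := wt_measurable hw
  have hms : MeasurableSet {p : E₁ × ℝ | 1/4 ≤ p.2 ∧ p.2 ≤ 3/2} :=
    (measurableSet_le measurable_const measurable_snd).inter (measurableSet_le measurable_snd measurable_const)
  have hT1e : Measurable (fun w : (E₁ × ℝ) × ℝ => ‖T1 w.2 w.1‖ₑ) := (hT1m.measurable.comp measurable_swap).enorm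
  have hT0e : Measurable (fun w : E₁ × ℝ => ‖T0 w‖ₑ) := by
    have : StronglyMeasurable T0 := by
      rw [hT0]
      apply StronglyMeasurable.integral_prod_right' (f := fun w : (E₁ × ℝ) × (E₁ × E₂) => (a ‖w.2.2‖ (1/4) * f w.2) * pw w.2.1 (τ w.2.2) w.1)
      apply Measurable.stronglyMeasurable
      unfold pw
      fun_prop
    exact this.measurable.enorm
  calc _ ≤ ∫⁻ p : E₁ × ℝ in {p | 1/4 ≤ p.2 ∧ p.2 ≤ 3/2}, ENNReal.ofReal (wt h p) * (2 * ‖T0 p‖ₑ ^ 2 + 2 * (2 * ∫⁻ κ' in I, ‖T1 κ' p‖ₑ ^ 2)) := by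
        apply setLIntegral_mono' hms
        intro p hp
        exact mul_le_mul_right (hpt p hp) _
    _ ≤ ∫⁻ p : E₁ × ℝ, ENNReal.ofReal (wt h p) * (2 * ‖T0 p‖ₑ ^ 2 + 2 * (2 * ∫⁻ κ' in I, ‖T1 κ' p‖ₑ ^ 2)) := setLIntegral_le_lintegral _ _
    _ = ∫⁻ p : E₁ × ℝ, (2 * (ENNReal.ofReal (wt h p) * ‖T0 p‖ₑ ^ 2) + 4 * ∫⁻ κ' in I, ENNReal.ofReal (wt h p) * ‖T1 κ' p‖ₑ ^ 2) := by
        congr with p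
        rw [lintegral_const_mul' _ _ ENNReal.ofReal_ne_top]
        ring
    _ = 2 * (∫⁻ p : E₁ × ℝ, ENNReal.ofReal (wt h p) * ‖T0 p‖ₑ ^ 2) + 4 * ∫⁻ κ' in I, ∫⁻ p : E₁ × ℝ, ENNReal.ofReal (wt h p) * ‖T1 κ' p‖ₑ ^ 2 := by
        rw [lintegral_add_left (by fun_prop), lintegral_const_mul' _ _ (by norm_num), lintegral_const_mul' _ _ (by norm_num), lintegral_lintegral_swap]
        apply Measurable.aemeasurable
        unfold Function.uncurry
        fun_prop
    _ ≤ 2 * ENNReal.ofReal B + 4 * ∫⁻ κ' in I, ENNReal.ofReal B := by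
        gcongr 2 * ?_ + 4 * ?_
        apply setLIntegral_mono' measurableSet_Icc
        intro κ' hκ'
        exact hb1 κ' hκ'.1
    _ ≤ 2 * ENNReal.ofReal B + 4 * (2 * ENNReal.ofReal B) := by
        gcongr 2 * _ + 4 * ?_
        rw [lintegral_const, mul_comm, Measure.restrict_apply_univ, hIdef, Real.volume_Icc, ← ENNReal.ofReal_ofNat 2]
        gcongr
        norm_num
    _ = _ := by
        rw [show 10 * (C0 * D ^ 2) * (∫ r, h r) * nq q f ^ 2 = 10 * B by rw [hB]; ring, ENNReal.ofReal_mul (p := 10) (q := B) (by norm_num)]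
        generalize ENNReal.ofReal B = Z
        rw [← mul_assoc, ← add_mul]
        norm_num

end Amp




section HB

variable (E₁ E₂ : Type*) [NormedAddCommGroup E₁] [InnerProductSpace ℝ E₁] [FiniteDimensional ℝ E₁]
    [MeasurableSpace E₁] [BorelSpace E₁] [Nontrivial E₁] [NormedAddCommGroup E₂] [InnerProductSpace ℝ E₂] [FiniteDimensional ℝ E₂]
    [MeasurableSpace E₂] [BorelSpace E₂] [Nontrivial E₂]

variable {E₁ E₂} in
def HH (e : E₂) (f : E₁ × E₂ → ℂ) (p : E₁ × ℝ) : ℂ :=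
  ∫ x : E₁ × E₂, f x * (Complex.exp ((2 * π * ⟪x.1, p.1⟫ : ℝ) * Complex.I) * (bes0 e (2 * π * ‖x.2‖ * p.2) : ℝ))

variable {E₁ E₂} in
lemma HH_meas (e : E₂) {f : E₁ × E₂ → ℂ} (hf : Measurable f) : Measurable (HH e f) := by
  apply StronglyMeasurable.measurable
  unfold HH
  apply StronglyMeasurable.integral_prod_right' (f := fun w : (E₁ × ℝ) × (E₁ × E₂) => f w.2 * (Complex.exp ((2 * π * ⟪w.2.1, w.1.1⟫ : ℝ) * Complex.I) * (bes0 e (2 * π * ‖w.2.2‖ * w.1.2) : ℝ)))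
  apply Measurable.stronglyMeasurable
  have := (bes0_continuous e).measurable
  fun_prop

lemma HHb {p q : ℝ} (hp : 2 < p) (hq : q = p / (p - 1))
    (hpk : 1 ≤ (2 * (Module.finrank ℝ E₂ : ℝ) + (Module.finrank ℝ E₁ : ℝ)) * (1/2 - 1/p)) :
    ∃ C : ℝ, 0 ≤ C ∧ ∀ h : ℝ → ℝ, IsW h → 0 < ∫ r, h r → ∀ e : E₂, ‖e‖ = 1 → 
      ∀ f : E₁ × E₂ → ℂ, Nice f →
      (∀ y z z', ‖z‖ = ‖z'‖ → ‖f (y, z)‖ = ‖f (y, z')‖) →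
      ∫⁻ p : E₁ × ℝ in {p | 1/4 ≤ p.2 ∧ p.2 ≤ 3/2}, ENNReal.ofReal (wt h p) * ‖HH e f p‖ₑ ^ 2
        ≤ ENNReal.ofReal (C * (∫ r, h r) * nq q f ^ 2) := by
  obtain ⟨D, hD, hdec⟩ := besA_decay E₂
  obtain ⟨C, hC, hamp⟩ := amp E₁ E₂ hp hq (show 0 ≤ 2 * π * D by positivity) hpk
  refine ⟨4 * C, by positivity, ?_⟩
  intro h hw hI e he f hf hrad
  set β := -(((Module.finrank ℝ E₂ : ℝ) - 1)/2) with hβ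
  have hβ0 : β ≤ 0 := by
    have : (1:ℝ) ≤ Module.finrank ℝ E₂ := by exact_mod_cast Module.finrank_pos
    rw [hβ]; linarith
  have hpi : 3 < π := Real.pi_gt_three
  have hcA := besA_continuous e
  have hcA1 := besA1_continuous e
  have hder : ∀ s κ : ℝ, HasDerivAt (fun κ => besA e (2 * π * s * κ)) ((2 * π * s : ℝ) * besA1 e (2 * π * s * κ)) κ := by
    intro s κ
    have h1 : HasDerivAt (fun κ : ℝ => 2 * π * s * κ) (2 * π * s) κ := by
      simpa using (hasDerivAt_id κ).const_mul (2 * π * s)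
    have := (besA_hasDerivAt e (2 * π * s * κ)).scomp κ h1
    exact this.congr_deriv (by simp)
  have hk : ∀ s κ : ℝ, 0 ≤ s → 1/4 ≤ κ → s ≤ 2 * π * s * κ := by
    intro s κ hs hκ
    have : 1 ≤ 2 * π * κ := by nlinarith
    nlinarith
  have hA : ∀ s κ : ℝ, 0 ≤ s → 1/4 ≤ κ → ‖besA e (2 * π * s * κ)‖ ≤ 2 * π * D * (1 + s) ^ β := by
    intro s κ hs hκ
    have h1 := hk s κ hs hκ
    calc _ ≤ D * (1 + 2 * π * s * κ) ^ β := (hdec e he _ (hs.trans h1)).1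
      _ ≤ D * (1 + s) ^ β := by
          gcongr ?_ * ?_
          exact Real.rpow_le_rpow_of_nonpos (by linarith) (by linarith) hβ0
      _ ≤ _ := by
          have : 0 ≤ (1 + s) ^ β := by positivity
          have : 0 ≤ D * (1 + s) ^ β := by positivity
          nlinarith
  have hA1 : ∀ s κ : ℝ, 0 ≤ s → 1/4 ≤ κ → ‖((2 * π * s : ℝ) : ℂ) * besA1 e (2 * π * s * κ)‖ ≤ 2 * π * D * (1 + s) ^ β := by
    intro s κ hs hκ
    have h1 := hk s κ hs hκ
    rw [norm_mul, Complex.norm_real, Real.norm_of_nonneg (by positivity)]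
    have hpos : 0 < 1 + 2 * π * s * κ := by linarith
    calc _ ≤ 2 * π * s * (D * (1 + 2 * π * s * κ) ^ (β - 1)) := by
          gcongr
          exact (hdec e he _ (hs.trans h1)).2
      _ = 2 * π * D * (1 + 2 * π * s * κ) ^ β * (s / (1 + 2 * π * s * κ)) := by
          rw [Real.rpow_sub_one hpos.ne']; ring
      _ ≤ 2 * π * D * (1 + s) ^ β * 1 := by
          gcongr ?_ * ?_ * ?_
          · exact Real.rpow_le_rpow_of_nonpos (by linarith) (by linarith) hβ0
          · rw [div_le_one hpos]; linarith
      _ = _ := mul_one _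
  have hplus := hamp h hw hI (fun z => ‖z‖) measurable_norm (fun z z' => rfl) (fun s κ => besA e (2 * π * s * κ))
    (fun s κ => (2 * π * s : ℝ) * besA1 e (2 * π * s * κ)) (by unfold Function.uncurry; fun_prop) (by unfold Function.uncurry; fun_prop) hder hA hA1 f hf hrad
  have hminus := hamp h hw hI (fun z => -‖z‖) measurable_norm.neg (fun z z' => by rw [neg_sub_neg, abs_sub_comm]) (fun s κ => (starRingEnd ℂ) (besA e (2 * π * s * κ)))
    (fun s κ => (starRingEnd ℂ) ((2 * π * s : ℝ) * besA1 e (2 * π * s * κ)))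
    (by unfold Function.uncurry; exact Complex.continuous_conj.comp (by fun_prop)) (by unfold Function.uncurry; exact Complex.continuous_conj.comp (by fun_prop))
    (fun s κ => Complex.conjCLE.toContinuousLinearMap.hasFDerivAt.comp_hasDerivAt κ (hder s κ))
    (fun s κ hs hκ => by rw [RCLike.norm_conj]; exact hA s κ hs hκ) (fun s κ hs hκ => by rw [RCLike.norm_conj]; exact hA1 s κ hs hκ) f hf hrad
  set P : E₁ × ℝ → ℂ := fun p => ∫ x : E₁ × E₂, (besA e (2 * π * ‖x.2‖ * p.2) * f x) * pw x.1 ‖x.2‖ p with hP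
  set Q : E₁ × ℝ → ℂ := fun p => ∫ x : E₁ × E₂, ((starRingEnd ℂ) (besA e (2 * π * ‖x.2‖ * p.2)) * f x) * pw x.1 (-‖x.2‖) p with hQ
  have hms : MeasurableSet {p : E₁ × ℝ | 1/4 ≤ p.2 ∧ p.2 ≤ 3/2} :=
    (measurableSet_le measurable_const measurable_snd).inter (measurableSet_le measurable_snd measurable_const)
  have hfm := hf.meas
  have hβ1 : ∀ z : E₂, (1 + ‖z‖) ^ β ≤ 1 := fun z => Real.rpow_le_one_of_one_le_of_nonpos (by linarith [norm_nonneg z]) hβ0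
  have hPm : Measurable P := by
    apply StronglyMeasurable.measurable
    apply StronglyMeasurable.integral_prod_right' (f := fun w : (E₁ × ℝ) × (E₁ × E₂) => (besA e (2 * π * ‖w.2.2‖ * w.1.2) * f w.2) * pw w.2.1 ‖w.2.2‖ w.1)
    apply Measurable.stronglyMeasurable
    have := hcA.measurable
    unfold pw
    fun_prop
  have heq : ∀ p : E₁ × ℝ, 1/4 ≤ p.2 → HH e f p = P p + Q p := by
    intro p hp
    have i1 : Integrable (fun x : E₁ × E₂ => (besA e (2 * π * ‖x.2‖ * p.2) * f x) * pw x.1 ‖x.2‖ p) := by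
      have hN : Nice (fun x : E₁ × E₂ => besA e (2 * π * ‖x.2‖ * p.2) * f x) := by
        apply hf.mul (g := fun x : E₁ × E₂ => besA e (2 * π * ‖x.2‖ * p.2)) (by apply Continuous.measurable; fun_prop) (B := 2 * π * D)
        intro x
        refine (hA _ _ (norm_nonneg _) hp).trans ?_
        exact mul_le_of_le_one_right (by positivity) (hβ1 _)
      apply (hN.integrable (μ := volume)).mul_bdd (c := 1)
      · apply Continuous.aestronglyMeasurable; unfold pw; fun_prop
      · exact ae_of_all _ fun p => (norm_pw _ _ _).le
    have i2 : Integrable (fun x : E₁ × E₂ => ((starRingEnd ℂ) (besA e (2 * π * ‖x.2‖ * p.2)) * f x) * pw x.1 (-‖x.2‖) p) := by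
      have hN : Nice (fun x : E₁ × E₂ => (starRingEnd ℂ) (besA e (2 * π * ‖x.2‖ * p.2)) * f x) := by
        apply hf.mul (g := fun x : E₁ × E₂ => (starRingEnd ℂ) (besA e (2 * π * ‖x.2‖ * p.2))) (by apply Continuous.measurable; exact Complex.continuous_conj.comp (by fun_prop)) (B := 2 * π * D)
        intro x
        rw [RCLike.norm_conj]
        refine (hA _ _ (norm_nonneg _) hp).trans ?_
        exact mul_le_of_le_one_right (by positivity) (hβ1 _)
      apply (hN.integrable (μ := volume)).mul_bdd (c := 1)
      · apply Continuous.aestronglyMeasurable; unfold pw; fun_prop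
      · exact ae_of_all _ fun p => (norm_pw _ _ _).le
    rw [hP, hQ]
    simp only
    rw [← integral_add i1 i2]
    unfold HH
    congr with x
    rw [bes0_eq_besA]
    have e1 : pw x.1 ‖x.2‖ p = Complex.exp ((2 * π * ⟪x.1, p.1⟫ : ℝ) * Complex.I) * Complex.exp ((2 * π * ‖x.2‖ * p.2 : ℝ) * Complex.I) := by
      unfold pw; rw [← Complex.exp_add]; congr 1; push_cast; ring
    have e2 : pw x.1 (-‖x.2‖) p = Complex.exp ((2 * π * ⟪x.1, p.1⟫ : ℝ) * Complex.I) * Complex.exp (-((2 * π * ‖x.2‖ * p.2 : ℝ) * Complex.I)) := by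
      unfold pw; rw [← Complex.exp_add]; congr 1; push_cast; ring
    rw [e1, e2]
    ring
  have hwm : Measurable (wt h : E₁ × ℝ → ℝ) := wt_measurable hw
  calc _ ≤ ∫⁻ p : E₁ × ℝ in {p | 1/4 ≤ p.2 ∧ p.2 ≤ 3/2}, (2 * (ENNReal.ofReal (wt h p) * ‖P p‖ₑ ^ 2) + 2 * (ENNReal.ofReal (wt h p) * ‖Q p‖ₑ ^ 2)) := by
        apply setLIntegral_mono' hms
        intro p hp
        rw [heq p hp.1]
        calc _ ≤ ENNReal.ofReal (wt h p) * (2 * ‖P p‖ₑ ^ 2 + 2 * ‖Q p‖ₑ ^ 2) := by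
              refine mul_le_mul_right ?_ _
              refine le_trans ?_ (add_sq_le' _ _)
              gcongr
              exact enorm_add_le _ _
          _ = _ := by ring
    _ ≤ 2 * ENNReal.ofReal (C * (∫ r, h r) * nq q f ^ 2) + 2 * ENNReal.ofReal (C * (∫ r, h r) * nq q f ^ 2) := by
        rw [lintegral_add_left (by fun_prop), lintegral_const_mul' _ _ (by norm_num), lintegral_const_mul' _ _ (by norm_num)]
        exact add_le_add (mul_le_mul_right hplus _) (mul_le_mul_right hminus _)
    _ = _ := by
        rw [show 4 * C * (∫ r, h r) * nq q f ^ 2 = 4 * (C * (∫ r, h r) * nq q f ^ 2) by ring, ENNReal.ofReal_mul (p := 4) (by norm_num), ← add_mul]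
        norm_num

lemma HHb2 {p q : ℝ} (hp : 2 < p) (hq : q = p / (p - 1))
    (hpk : 1 ≤ (2 * (Module.finrank ℝ E₂ : ℝ) + (Module.finrank ℝ E₁ : ℝ)) * (1/2 - 1/p)) :
    ∃ C : ℝ, 0 ≤ C ∧ ∀ h : ℝ → ℝ, IsW h → 0 < ∫ r, h r → ∀ e : E₂, ‖e‖ = 1 → 
      ∀ f : E₁ × E₂ → ℂ, Nice f →
      (∀ y z z', ‖z‖ = ‖z'‖ → ‖f (y, z)‖ = ‖f (y, z')‖) →
      ∫⁻ x : E₁ × E₂ in {x | 1/4 ≤ ‖x.2‖ ∧ ‖x.2‖ ≤ 3/2}, ENNReal.ofReal (h (√(‖x.1‖ ^ 2 + ‖x.2‖ ^ 2))) * ‖HH e f (x.1, ‖x.2‖)‖ₑ ^ 2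
        ≤ ENNReal.ofReal (C * (∫ r, h r) * nq q f ^ 2) := by
  obtain ⟨C, hC, hb⟩ := HHb E₁ E₂ hp hq hpk
  set b := Module.finrank ℝ E₂ with hbdef
  refine ⟨((sph E₂) Set.univ).toReal * (16 * (3/2) ^ (b - 1)) * C, by positivity, ?_⟩
  intro h hw hI e he f hf hrad
  have hres := hb h hw hI e he f hf hrad
  have hHm := HH_meas e hf.meas
  have hwm : Measurable (wt h : E₁ × ℝ → ℝ) := wt_measurable hw
  have hhm := hw.meas
  have hms : MeasurableSet {p : E₁ × ℝ | 1/4 ≤ p.2 ∧ p.2 ≤ 3/2} :=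
    (measurableSet_le measurable_const measurable_snd).inter (measurableSet_le measurable_snd measurable_const)
  set Ψ : E₁ × ℝ → ℝ≥0∞ := {p : E₁ × ℝ | 1/4 ≤ p.2 ∧ p.2 ≤ 3/2}.indicator (fun p => ENNReal.ofReal (h (√(‖p.1‖ ^ 2 + p.2 ^ 2))) * ‖HH e f p‖ₑ ^ 2) with hΨ
  have hΨm : Measurable Ψ := by
    apply Measurable.indicator _ hms
    fun_prop
  have e1 : ∫⁻ x : E₁ × E₂ in {x | 1/4 ≤ ‖x.2‖ ∧ ‖x.2‖ ≤ 3/2}, ENNReal.ofReal (h (√(‖x.1‖ ^ 2 + ‖x.2‖ ^ 2))) * ‖HH e f (x.1, ‖x.2‖)‖ₑ ^ 2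
      = ∫⁻ x : E₁ × E₂, Ψ (x.1, ‖x.2‖) := by
    rw [← lintegral_indicator]
    · congr with x
    · exact (measurableSet_le measurable_const measurable_snd.norm).inter (measurableSet_le measurable_snd.norm measurable_const)
  have e2 : ∫⁻ x : E₁ × E₂, Ψ (x.1, ‖x.2‖) = ∫⁻ η : E₁, ∫⁻ ζ : E₂, Ψ (η, ‖ζ‖) := by
    rw [Measure.volume_eq_prod, lintegral_prod _ (Measurable.aemeasurable (by fun_prop))]
  have e3 : ∀ η : E₁, ∫⁻ ζ : E₂, Ψ (η, ‖ζ‖) ≤ ENNReal.ofReal (((sph E₂) Set.univ).toReal * (16 * (3/2) ^ (b - 1))) *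
      ∫⁻ κ : ℝ, {p : E₁ × ℝ | 1/4 ≤ p.2 ∧ p.2 ≤ 3/2}.indicator (fun p => ENNReal.ofReal (wt h p) * ‖HH e f p‖ₑ ^ 2) (η, κ) := by
    intro η
    rw [lintegral_radial (F := E₂) (f := fun r => Ψ (η, r)) (by fun_prop), ENNReal.ofReal_mul (by positivity), ENNReal.ofReal_toReal (measure_ne_top _ _), mul_assoc]
    refine mul_le_mul_right ?_ _
    rw [← lintegral_const_mul' _ _ ENNReal.ofReal_ne_top]
    refine le_trans ?_ (setLIntegral_le_lintegral (Set.Ioi 0) _)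
    apply setLIntegral_mono' measurableSet_Ioi
    intro κ _
    by_cases hκ : 1/4 ≤ κ ∧ κ ≤ 3/2
    · simp only [hΨ]
      rw [Set.indicator_of_mem (by exact hκ), Set.indicator_of_mem (by exact hκ), ← mul_assoc, ← mul_assoc]
      refine mul_le_mul_left ?_ _
      rw [← ENNReal.ofReal_mul (by have := hκ.1; positivity), ← ENNReal.ofReal_mul (by positivity)]
      apply ENNReal.ofReal_le_ofReal
      unfold wt
      simp only
      rw [← mul_assoc]
      refine mul_le_mul_of_nonneg_right ?_ (hw.nn _)
      have h1 : κ ^ (b - 1) ≤ (3/2) ^ (b - 1) := pow_le_pow_left₀ (by linarith [hκ.1]) hκ.2 _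
      have h2 : 1 ≤ 16 * κ ^ 2 := by nlinarith [hκ.1]
      have h3 : (0:ℝ) ≤ (3/2) ^ (b - 1) := by positivity
      nlinarith
    · simp only [hΨ]
      rw [Set.indicator_of_notMem (by exact hκ)]
      simp
  rw [e1, e2]
  refine (lintegral_mono e3).trans ?_
  rw [lintegral_const_mul' _ _ ENNReal.ofReal_ne_top]
  rw [← lintegral_indicator hms, Measure.volume_eq_prod, lintegral_prod _ (Measurable.aemeasurable (Measurable.indicator (by fun_prop) hms))] at hres
  refine (mul_le_mul_right hres _).trans (le_of_eq ?_)
  rw [← ENNReal.ofReal_mul (by positivity)]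
  congr 1
  ring

end HB




section PieceA

variable {E₁ E₂ : Type*} [NormedAddCommGroup E₁] [InnerProductSpace ℝ E₁] [FiniteDimensional ℝ E₁]
    [MeasurableSpace E₁] [BorelSpace E₁] [Nontrivial E₁] [NormedAddCommGroup E₂] [InnerProductSpace ℝ E₂] [FiniteDimensional ℝ E₂]
    [MeasurableSpace E₂] [BorelSpace E₂] [Nontrivial E₂]

def uu (V : E₁ × E₂ → ℂ) (w : E₁ × E₂) : ℂ :=
  ∫ x : E₁ × E₂, V x * Complex.exp ((2 * π * (⟪w.1, x.1⟫ + ⟪w.2, x.2⟫) : ℝ) * Complex.I)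

lemma uu_bound (V : E₁ × E₂ → ℂ) (w : E₁ × E₂) : ‖uu V w‖ ≤ ∫ x, ‖V x‖ := by
  unfold uu
  refine (norm_integral_le_integral_norm _).trans (le_of_eq ?_)
  simp only [norm_mul, Complex.norm_exp_ofReal_mul_I, mul_one]

lemma uu_cont {V : E₁ × E₂ → ℂ} (hV : Integrable V) : Continuous (uu V) := by
  unfold uu
  apply continuous_of_dominated (bound := fun x => ‖V x‖)
  · intro w
    exact hV.1.mul (Continuous.aestronglyMeasurable (by fun_prop))
  · intro w
    refine ae_of_all _ fun x => ?_
    rw [norm_mul, Complex.norm_exp_ofReal_mul_I, mul_one]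
  · exact hV.norm
  · refine ae_of_all _ fun x => ?_
    fun_prop

lemma bes0_bound (e : E₂) (t : ℝ) : |bes0 e t| ≤ (sph E₂).real Set.univ := by
  have := sph_bound (F := E₂) (f := fun ω => cos (t * ⟪e, (ω : E₂)⟫)) (B := 1) (fun ω => Real.abs_cos_le_one _)
  simpa [bes0] using this

lemma uu_sph {V : E₁ × E₂ → ℂ} (hV : Integrable V) (hr : ∀ y z z', ‖z‖ = ‖z'‖ → uu V (y, z) = uu V (y, z')) (e : E₂) (he : ‖e‖ = 1)
    (y : E₁) (z : E₂) : ((sph E₂).real Set.univ : ℂ) * uu V (y, z) =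
      ∫ x : E₁ × E₂, V x * (Complex.exp ((2 * π * ⟪y, x.1⟫ : ℝ) * Complex.I) * (bes0 e (2 * π * ‖z‖ * ‖x.2‖) : ℝ)) := by
  have h1 : ((sph E₂).real Set.univ : ℂ) * uu V (y, z) = ∫ ω : Metric.sphere (0:E₂) 1, uu V (y, ‖z‖ • (ω : E₂)) ∂(sph E₂) := by
    have : ∀ ω : Metric.sphere (0:E₂) 1, uu V (y, ‖z‖ • (ω : E₂)) = uu V (y, z) := fun ω => by
      apply hr
      rw [norm_smul]; simp
    simp only [this, integral_const, Complex.real_smul]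
  rw [h1]
  unfold uu
  have hF : Integrable (Function.uncurry fun (ω : Metric.sphere (0:E₂) 1) (x : E₁ × E₂) => V x * Complex.exp ((2 * π * (⟪y, x.1⟫ + ⟪‖z‖ • (ω : E₂), x.2⟫) : ℝ) * Complex.I))
      ((sph E₂).prod volume) := by
    have h2 : Integrable (fun _ : Metric.sphere (0:E₂) 1 => (1:ℂ)) (sph E₂) := integrable_const _
    have h3 := (h2.mul_prod hV).mul_bdd (c := 1) (g := fun w : Metric.sphere (0:E₂) 1 × (E₁ × E₂) => Complex.exp ((2 * π * (⟪y, w.2.1⟫ + ⟪‖z‖ • (w.1 : E₂), w.2.2⟫) : ℝ) * Complex.I))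
      (Continuous.aestronglyMeasurable (by fun_prop)) (ae_of_all _ fun w => by rw [Complex.norm_exp_ofReal_mul_I])
    refine h3.congr (ae_of_all _ fun w => ?_)
    simp [Function.uncurry]
  rw [integral_integral_swap hF]
  congr with x
  rw [integral_const_mul]
  congr 1
  have h4 := sph_exp e ((2 * π * ‖z‖) • x.2) he
  rw [norm_smul, Real.norm_of_nonneg (by positivity)] at h4
  rw [← h4, ← integral_const_mul]
  congr with ω
  rw [← Complex.exp_add]
  congr 1
  rw [real_inner_smul_left, real_inner_smul_left, real_inner_comm]
  rw [real_inner_comm (ω : E₂)]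
  push_cast
  ring

lemma pair_HH {V : E₁ × E₂ → ℂ} (hV : Integrable V) (hr : ∀ y z z', ‖z‖ = ‖z'‖ → uu V (y, z) = uu V (y, z')) (e : E₂) (he : ‖e‖ = 1)
    {f : E₁ × E₂ → ℂ} (hf : Nice f) : 
    ((sph E₂).real Set.univ : ℂ) * ∫ w, f w * uu V w = ∫ x, V x * HH e f (x.1, ‖x.2‖) := by
  have e1 : ((sph E₂).real Set.univ : ℂ) * ∫ w, f w * uu V w
      = ∫ w : E₁ × E₂, ∫ x : E₁ × E₂, f w * (V x * (Complex.exp ((2 * π * ⟪w.1, x.1⟫ : ℝ) * Complex.I) * (bes0 e (2 * π * ‖w.2‖ * ‖x.2‖) : ℝ))) := by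
    rw [← integral_const_mul]
    congr with w
    rw [integral_const_mul, ← uu_sph hV hr e he]
    ring
  have hcb := bes0_continuous e
  have hfi : Integrable f (volume : Measure (E₁ × E₂)) := hf.integrable
  have hF : Integrable (Function.uncurry fun (w : E₁ × E₂) (x : E₁ × E₂) => f w * (V x * (Complex.exp ((2 * π * ⟪w.1, x.1⟫ : ℝ) * Complex.I) * (bes0 e (2 * π * ‖w.2‖ * ‖x.2‖) : ℝ))))
      ((volume : Measure (E₁ × E₂)).prod volume) := by
    have h3 := (hfi.mul_prod hV).mul_bdd (c := (sph E₂).real Set.univ) (g := fun w : (E₁ × E₂) × (E₁ × E₂) =>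
       (Complex.exp ((2 * π * ⟪w.1.1, w.2.1⟫ : ℝ) * Complex.I) * (bes0 e (2 * π * ‖w.1.2‖ * ‖w.2.2‖) : ℝ)))
      (Continuous.aestronglyMeasurable (by fun_prop)) (ae_of_all _ fun w => by
        rw [norm_mul, Complex.norm_exp_ofReal_mul_I, one_mul, Complex.norm_real]; exact bes0_bound _ _)
    refine h3.congr (ae_of_all _ fun w => ?_)
    simp only [Function.uncurry]
    ring
  rw [e1, integral_integral_swap hF]
  congr with x
  unfold HH
  rw [← integral_const_mul]
  congr with w
  ring

end PieceA




section PieceB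

lemma cs_weight {X : Type*} [MeasurableSpace X] (μ : Measure X) {A B w : X → ℝ≥0∞} (hA : AEMeasurable A μ) (hB : AEMeasurable B μ) (hw : Measurable w)
    (hwt : ∀ x, w x ≠ ∞) (h0 : ∀ᵐ x ∂μ, A x ≠ 0 → w x ≠ 0) :
    (∫⁻ x, A x * B x ∂μ) ^ 2 ≤ (∫⁻ x, A x ^ 2 * (w x)⁻¹ ∂μ) * ∫⁻ x, w x * B x ^ 2 ∂μ := by
  have h := ENNReal.lintegral_mul_le_Lp_mul_Lq μ (p := 2) (q := 2) Real.HolderConjugate.two_two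
    (f := fun x => A x * (w x ^ (1/2:ℝ))⁻¹) (g := fun x => w x ^ (1/2:ℝ) * B x) (by fun_prop) (by fun_prop)
  have hsq : ∀ x, (w x ^ (1/2:ℝ)) ^ 2 = w x := fun x => by
    rw [← ENNReal.rpow_two, ← ENNReal.rpow_mul]; norm_num
  have e0 : ∫⁻ x, A x * B x ∂μ = ∫⁻ x, ((fun x => A x * (w x ^ (1/2:ℝ))⁻¹) * (fun x => w x ^ (1/2:ℝ) * B x)) x ∂μ := by
    apply lintegral_congr_ae
    filter_upwards [h0] with x hx
    simp only [Pi.mul_apply]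
    by_cases hAx : A x = 0
    · simp [hAx]
    · have h1 : w x ^ (1/2:ℝ) ≠ 0 := by
        intro h2
        rw [ENNReal.rpow_eq_zero_iff_of_pos (by norm_num)] at h2
        exact hx hAx h2
      have h2 : w x ^ (1/2:ℝ) ≠ ∞ := ENNReal.rpow_ne_top_of_nonneg (by norm_num) (hwt x)
      calc A x * B x = A x * ((w x ^ (1/2:ℝ))⁻¹ * w x ^ (1/2:ℝ)) * B x := by rw [ENNReal.inv_mul_cancel h1 h2, mul_one]
        _ = _ := by ring
  rw [e0]
  simp only [ENNReal.rpow_two, mul_pow, ENNReal.inv_pow.symm, hsq] at h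
  calc _ ≤ ((∫⁻ x, A x ^ 2 * (w x)⁻¹ ∂μ) ^ (1/2:ℝ) * (∫⁻ x, w x * B x ^ 2 ∂μ) ^ (1/2:ℝ)) ^ 2 := by
        gcongr
    _ = _ := by
      rw [mul_pow, ← ENNReal.rpow_two, ← ENNReal.rpow_two, ← ENNReal.rpow_mul, ← ENNReal.rpow_mul]
      norm_num

variable (E₁ E₂ : Type*) [NormedAddCommGroup E₁] [InnerProductSpace ℝ E₁] [FiniteDimensional ℝ E₁]
    [MeasurableSpace E₁] [BorelSpace E₁] [Nontrivial E₁] [NormedAddCommGroup E₂] [InnerProductSpace ℝ E₂] [FiniteDimensional ℝ E₂]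
    [MeasurableSpace E₂] [BorelSpace E₂] [Nontrivial E₂]

lemma sph_pos : 0 < (sph E₂).real Set.univ := by
  apply ENNReal.toReal_pos _ (measure_ne_top _ _)
  rw [Measure.toSphere_apply_univ]
  have h1 : (Module.finrank ℝ E₂ : ℝ≥0∞) ≠ 0 := by
    have : Module.finrank ℝ E₂ ≠ 0 := Module.finrank_pos.ne'
    exact_mod_cast this
  exact mul_ne_zero h1 (Metric.measure_ball_pos volume (0:E₂) one_pos).ne'

lemma piece {p : ℝ} (hp : 2 < p)
    (hpk : 1 ≤ (2 * (Module.finrank ℝ E₂ : ℝ) + (Module.finrank ℝ E₁ : ℝ)) * (1/2 - 1/p)) :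
    ∃ C : ℝ, 0 ≤ C ∧ ∀ h : ℝ → ℝ, IsW h → 0 < ∫ r, h r → ∀ V : E₁ × E₂ → ℂ, Integrable V →
      (∀ᵐ x, V x ≠ 0 → 1/4 ≤ ‖x.2‖ ∧ ‖x.2‖ ≤ 3/2 ∧ 0 < h (√(‖x.1‖ ^ 2 + ‖x.2‖ ^ 2))) →
      (∀ y z z', ‖z‖ = ‖z'‖ → uu V (y, z) = uu V (y, z')) →
      eLpNorm (uu V) (ENNReal.ofReal p) volume ^ 2 ≤ ENNReal.ofReal (C * ∫ r, h r) *
        ∫⁻ x, ‖V x‖ₑ ^ 2 * (ENNReal.ofReal (h (√(‖x.1‖ ^ 2 + ‖x.2‖ ^ 2))))⁻¹ := by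
  set q := p / (p - 1) with hq
  obtain ⟨C0, hC0, hHH⟩ := HHb2 E₁ E₂ hp hq hpk
  have hp1 : 0 < p - 1 := by linarith
  have hp0 : 0 < p := by linarith
  have hq1 : 1 < q := by rw [hq, lt_div_iff₀ hp1]; linarith
  have hq0 : 0 < q := by linarith
  set σ := (sph E₂).real Set.univ with hσ
  have hσ0 : 0 < σ := sph_pos E₂
  refine ⟨C0 / σ ^ 2, by positivity, ?_⟩
  intro h hw hI V hV hsupp hr
  obtain ⟨e, he⟩ := exists_norm_eq E₂ (zero_le_one (α := ℝ))
  set M := ∫ r, h r with hM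
  set Qv := ∫⁻ x, ‖V x‖ₑ ^ 2 * (ENNReal.ofReal (h (√(‖x.1‖ ^ 2 + ‖x.2‖ ^ 2))))⁻¹ with hQv
  set u := uu V with hu
  have huc : Continuous u := uu_cont hV
  set L := ∫ x, ‖V x‖ with hL
  have hub : ∀ w, ‖u w‖ ≤ L := uu_bound V
  set K := ENNReal.ofReal (C0 / σ ^ 2 * M) * Qv with hK
  have hball : ∀ N : ℕ, (∫⁻ w in Metric.closedBall (0 : E₁ × E₂) N, ‖u w‖ₑ ^ p) ^ (2/p) ≤ K := by
    intro N
    set f : E₁ × E₂ → ℂ := (Metric.closedBall (0 : E₁ × E₂) N).indicator (fun w => (starRingEnd ℂ) (u w) * ((‖u w‖ ^ (p - 2) : ℝ) : ℂ)) with hf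
    have hfn : ∀ w, ‖f w‖ = (Metric.closedBall (0 : E₁ × E₂) N).indicator (fun w => ‖u w‖ ^ (p - 1)) w := by
      intro w
      by_cases hw : w ∈ Metric.closedBall (0 : E₁ × E₂) N
      · simp only [hf, Set.indicator_of_mem hw]
        rw [norm_mul, RCLike.norm_conj, Complex.norm_real, Real.norm_of_nonneg (by positivity)]
        have := Real.rpow_add_of_nonneg (norm_nonneg (u w)) zero_le_one (show 0 ≤ p - 2 by linarith)
        rw [Real.rpow_one] at this
        rw [← this]; congr 1; ring
      · simp only [hf, Set.indicator_of_notMem hw, norm_zero]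
    have hfN : Nice f := by
      refine ⟨?_, ⟨L ^ (p - 1), fun w => ?_⟩, N, fun w hw => ?_⟩
      · apply Measurable.indicator _ measurableSet_closedBall
        have h1 := huc.measurable
        have h2 : Measurable fun w => (starRingEnd ℂ) (u w) := Complex.continuous_conj.measurable.comp h1
        fun_prop
      · rw [hfn]
        refine (Set.indicator_le_self' (fun _ _ => by positivity) w).trans ?_
        exact Real.rpow_le_rpow (norm_nonneg _) (hub w) hp1.le
      · apply Set.indicator_of_notMem
        simpa using hw
    have hfrad : ∀ y z z', ‖z‖ = ‖z'‖ → f (y, z) = f (y, z') := by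
      intro y z z' hz
      have hm : (y, z) ∈ Metric.closedBall (0 : E₁ × E₂) N ↔ (y, z') ∈ Metric.closedBall (0 : E₁ × E₂) N := by
        simp [Prod.norm_def, hz]
      have huz := hr y z z' hz
      by_cases hx : (y, z') ∈ Metric.closedBall (0 : E₁ × E₂) N
      · rw [hf, Set.indicator_of_mem hx, Set.indicator_of_mem (hm.2 hx), huz]
      · rw [hf, Set.indicator_of_notMem hx, Set.indicator_of_notMem (fun h' => hx (hm.1 h'))]
    set J := ∫ w in Metric.closedBall (0 : E₁ × E₂) N, ‖u w‖ ^ p with hJ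
    have hJ0 : 0 ≤ J := integral_nonneg fun w => by positivity
    have hup : ∀ w, f w * u w = (((Metric.closedBall (0 : E₁ × E₂) N).indicator (fun w => ‖u w‖ ^ p) w : ℝ) : ℂ) := by
      intro w
      by_cases hw : w ∈ Metric.closedBall (0 : E₁ × E₂) N
      · simp only [hf, Set.indicator_of_mem hw]
        rw [mul_right_comm, mul_comm ((starRingEnd ℂ) _), Complex.mul_conj, Complex.normSq_eq_norm_sq, ← Complex.ofReal_mul]
        congr 1
        have := Real.rpow_add_of_nonneg (norm_nonneg (u w)) zero_le_two (show 0 ≤ p - 2 by linarith)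
        rw [Real.rpow_two] at this
        rw [← this]; congr 1; ring
      · simp only [hf, Set.indicator_of_notMem hw, zero_mul, Complex.ofReal_zero]
    have e1 : ∫ w, f w * u w = (J : ℂ) := by
      simp only [hup]
      rw [integral_complex_ofReal, integral_indicator measurableSet_closedBall]
    have e2 : nq q f = J ^ (1/q) := by
      unfold nq
      congr 1
      rw [hJ, ← integral_indicator measurableSet_closedBall]
      congr with w
      rw [hfn]
      by_cases hw : w ∈ Metric.closedBall (0 : E₁ × E₂) N
      · simp only [Set.indicator_of_mem hw]
        rw [← Real.rpow_mul (norm_nonneg _)]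
        congr 1
        rw [hq]; field_simp
      · simp only [Set.indicator_of_notMem hw]
        exact Real.zero_rpow hq0.ne'
    have hpair := pair_HH hV hr e he hfN
    rw [e1] at hpair
    set S : Set (E₁ × E₂) := {x | 1/4 ≤ ‖x.2‖ ∧ ‖x.2‖ ≤ 3/2} with hS
    have hSm : MeasurableSet S := (measurableSet_le measurable_const measurable_snd.norm).inter (measurableSet_le measurable_snd.norm measurable_const)
    have hHm := HH_meas e hfN.meas
    have hhm := hw.meas
    set ww : E₁ × E₂ → ℝ≥0∞ := fun x => ENNReal.ofReal (h (√(‖x.1‖ ^ 2 + ‖x.2‖ ^ 2))) with hww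
    set B : E₁ × E₂ → ℝ≥0∞ := S.indicator (fun x => ‖HH e f (x.1, ‖x.2‖)‖ₑ) with hB
    have hBm : Measurable B := Measurable.indicator (by fun_prop) hSm
    have hwwm : Measurable ww := by fun_prop
    have e3 : ENNReal.ofReal (σ * J) ≤ ∫⁻ x, ‖V x‖ₑ * B x := by
      calc ENNReal.ofReal (σ * J) = ‖∫ x, V x * HH e f (x.1, ‖x.2‖)‖ₑ := by
            rw [← hpair, ← Complex.ofReal_mul, ← ofReal_norm, Complex.norm_real, Real.norm_of_nonneg (by positivity)]
        _ ≤ ∫⁻ x, ‖V x * HH e f (x.1, ‖x.2‖)‖ₑ := enorm_integral_le_lintegral_enorm _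
        _ = _ := by
            apply lintegral_congr_ae
            filter_upwards [hsupp] with x hx
            rw [enorm_mul]
            by_cases hVx : V x = 0
            · simp [hVx]
            · obtain ⟨x1, x2, _⟩ := hx hVx
              rw [hB, Set.indicator_of_mem (by exact ⟨x1, x2⟩)]
    have e4 := cs_weight (volume : Measure (E₁ × E₂)) (A := fun x => ‖V x‖ₑ) (B := B) (w := ww) hV.1.enorm hBm.aemeasurable hwwm
      (fun x => ENNReal.ofReal_ne_top) (by
        filter_upwards [hsupp] with x hx hx0
        have := (hx (by simpa using hx0)).2.2
        simpa [hww] using this)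
    have e5 : ∫⁻ x, ww x * B x ^ 2 ≤ ENNReal.ofReal (C0 * M * (J ^ (1/q)) ^ 2) := by
      rw [← e2]
      refine le_trans (le_of_eq ?_) (hHH h hw hI e he f hfN (fun y z z' hz => by rw [hfrad y z z' hz]))
      rw [← lintegral_indicator hSm]
      congr with x
      by_cases hx : x ∈ S
      · simp only [hB, Set.indicator_of_mem hx, hww]
      · simp only [hB, Set.indicator_of_notMem hx]
        simp
    have e6 : ENNReal.ofReal (σ * J) ^ 2 ≤ Qv * ENNReal.ofReal (C0 * M * (J ^ (1/q)) ^ 2) := by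
      calc _ ≤ (∫⁻ x, ‖V x‖ₑ * B x) ^ 2 := by gcongr
        _ ≤ _ := e4
        _ ≤ _ := by gcongr
    have e7 : ∫⁻ w in Metric.closedBall (0 : E₁ × E₂) N, ‖u w‖ₑ ^ p = ENNReal.ofReal J := by
      rw [hJ, ofReal_integral_eq_lintegral_ofReal]
      · congr with w
        rw [← ENNReal.ofReal_rpow_of_nonneg (norm_nonneg _) hp0.le, ofReal_norm]
      · apply ContinuousOn.integrableOn_compact (isCompact_closedBall _ _)
        exact (huc.norm.rpow_const (fun _ => Or.inr hp0.le)).continuousOn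
      · exact ae_of_all _ fun w => by positivity
    rw [e7]
    rcases eq_or_lt_of_le hJ0 with hJz | hJp
    · rw [← hJz]; simp [ENNReal.zero_rpow_of_pos (show 0 < 2 / p by positivity)]
    · have e8 : C0 * M * (J ^ (1/q)) ^ 2 = (C0 / σ ^ 2 * M) * (σ ^ 2 * J ^ (2/q)) := by
        rw [← Real.rpow_two, ← Real.rpow_mul hJ0]
        field_simp
      have e9 : ENNReal.ofReal (σ * J) ^ 2 = ENNReal.ofReal (J ^ (2/p)) * ENNReal.ofReal (σ ^ 2 * J ^ (2/q)) := by
        rw [← ENNReal.ofReal_pow (by positivity), ← ENNReal.ofReal_mul (by positivity)]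
        congr 1
        have : J ^ 2 = J ^ (2/p) * J ^ (2/q) := by
          rw [← Real.rpow_add hJp, ← Real.rpow_two]
          congr 1
          rw [hq]; field_simp; ring
        rw [mul_pow, this]; ring
      rw [e8, e9, ENNReal.ofReal_mul (p := C0 / σ ^ 2 * M) (q := σ ^ 2 * J ^ (2/q)) (by positivity), ← mul_assoc, mul_comm Qv] at e6
      have hne : ENNReal.ofReal (σ ^ 2 * J ^ (2/q)) ≠ 0 := by
        simp only [ne_eq, ENNReal.ofReal_eq_zero, not_le]
        positivity
      rw [ENNReal.mul_le_mul_iff_left hne ENNReal.ofReal_ne_top] at e6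
      rw [ENNReal.ofReal_rpow_of_nonneg hJ0 (by positivity)]
      exact e6
  have hall : ∫⁻ w, ‖u w‖ₑ ^ p = ⨆ N : ℕ, ∫⁻ w in Metric.closedBall (0 : E₁ × E₂) N, ‖u w‖ₑ ^ p := by
    rw [← setLIntegral_iUnion_of_directed, Metric.iUnion_closedBall_nat, setLIntegral_univ]
    exact Monotone.directed_le (fun m n hmn => Metric.closedBall_subset_closedBall (by exact_mod_cast hmn))
  have hfin : ∫⁻ w, ‖u w‖ₑ ^ p ≤ K ^ (p/2) := by
    rw [hall]
    apply iSup_le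
    intro N
    have := ENNReal.rpow_le_rpow (hball N) (show 0 ≤ p / 2 by positivity)
    rwa [← ENNReal.rpow_mul, show 2 / p * (p / 2) = 1 by field_simp, ENNReal.rpow_one] at this
  rw [eLpNorm_eq_lintegral_rpow_enorm_toReal (by simpa using hp0) ENNReal.ofReal_ne_top, ENNReal.toReal_ofReal hp0.le, ← ENNReal.rpow_two, ← ENNReal.rpow_mul]
  refine (ENNReal.rpow_le_rpow hfin (by positivity)).trans (le_of_eq ?_)
  rw [← ENNReal.rpow_mul, show p / 2 * (1 / p * 2) = 1 by field_simp, ENNReal.rpow_one]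

end PieceB





section Red
variable {d : ℕ}

lemma fourierInv_isom (A : Rd d ≃ₗᵢ[ℝ] Rd d) (f : Rd d → ℂ) (w : Rd d) :
    𝓕⁻ (fun x => f (A x)) w = 𝓕⁻ f (A w) := by
  rw [Real.fourierInv_eq_fourier_neg, Real.fourierInv_eq_fourier_neg, ← map_neg]
  exact Real.fourier_comp_linearIsometry A f (-w)

lemma fourierInv_integrand {f : Rd d → ℂ} (hf : Integrable f) (w : Rd d) :
    Integrable (fun x : Rd d => Complex.exp ((↑(2 * π * ⟪x, w⟫) * Complex.I)) • f x) := by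
  refine hf.bdd_mul (c := 1) (f := fun x : Rd d => Complex.exp ((↑(2 * π * ⟪x, w⟫) * Complex.I))) ?_ ?_
  · exact (by fun_prop : Continuous _).aestronglyMeasurable
  · exact ae_of_all _ fun x => (Complex.norm_exp_ofReal_mul_I _).le

lemma fourierInv_sub' {f g : Rd d → ℂ} (hf : Integrable f) (hg : Integrable g) (w : Rd d) :
    𝓕⁻ (f - g) w = 𝓕⁻ f w - 𝓕⁻ g w := by
  rw [Real.fourierInv_eq', Real.fourierInv_eq', Real.fourierInv_eq', ← integral_sub (fourierInv_integrand hf w) (fourierInv_integrand hg w)]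
  congr with x
  rw [Pi.sub_apply, smul_sub]

lemma fourierInv_add' {f g : Rd d → ℂ} (hf : Integrable f) (hg : Integrable g) (w : Rd d) :
    𝓕⁻ (f + g) w = 𝓕⁻ f w + 𝓕⁻ g w := by
  rw [Real.fourierInv_eq', Real.fourierInv_eq', Real.fourierInv_eq', ← integral_add (fourierInv_integrand hf w) (fourierInv_integrand hg w)]
  congr with x
  rw [Pi.add_apply, smul_add]

lemma inv_ae {v V : Rd d → ℂ} (hV : Integrable V) (hV2 : MemLp V 2 volume) (hvV : v =ᵐ[volume] 𝓕⁻ V)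
    (A : Rd d ≃ₗᵢ[ℝ] Rd d) (hA : ∀ x, v (A x) = v x) : (fun x => V (A x)) =ᵐ[volume] V := by
  have hmp := A.measurePreserving
  have h1 : (fun x => 𝓕⁻ V (A x)) =ᵐ[volume] 𝓕⁻ V := by
    have h2 := hmp.quasiMeasurePreserving.ae hvV
    filter_upwards [hvV, h2] with x hx hx2
    rw [← hx, ← hx2, hA]
  have hc := fourierInv_cont hV
  have h3 : (fun x => 𝓕⁻ V (A x)) = 𝓕⁻ V :=
    Continuous.ae_eq_iff_eq volume (hc.comp A.continuous) hc |>.1 h1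
  have hVA : Integrable (fun x => V (A x)) := hmp.integrable_comp_of_integrable hV
  have hVA2 : MemLp (fun x => V (A x)) 2 volume := hV2.comp_measurePreserving hmp
  have h4 := fourierInv_inj (hVA.sub hV) (hVA2.sub hV2) (fun x => by
    have e1 := fourierInv_isom A V x
    have e2 := congrFun h3 x
    rw [fourierInv_sub' hVA hV, e1]
    simpa [sub_eq_zero] using e2)
  filter_upwards [h4] with x hx
  simpa [sub_eq_zero] using hx

lemma inv_ind {v V : Rd d → ℂ} (hV : Integrable V) (hV2 : MemLp V 2 volume) (hvV : v =ᵐ[volume] 𝓕⁻ V)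
    (A : Rd d ≃ₗᵢ[ℝ] Rd d) (hA : ∀ x, v (A x) = v x) (S : Set (Rd d)) (hS : ∀ x, A x ∈ S ↔ x ∈ S) (w : Rd d) :
    𝓕⁻ (S.indicator V) (A w) = 𝓕⁻ (S.indicator V) w := by
  rw [← fourierInv_isom, Real.fourierInv_eq, Real.fourierInv_eq]
  apply integral_congr_ae
  filter_upwards [inv_ae hV hV2 hvV A hA] with x hx
  congr 1
  by_cases h : x ∈ S
  · rw [Set.indicator_of_mem h, Set.indicator_of_mem ((hS x).2 h), hx]
  · rw [Set.indicator_of_notMem h, Set.indicator_of_notMem (fun h' => h ((hS x).1 h'))]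

variable {E₁ E₂ : Type*} [NormedAddCommGroup E₁] [InnerProductSpace ℝ E₁] [FiniteDimensional ℝ E₁]
    [MeasurableSpace E₁] [BorelSpace E₁] [Nontrivial E₁] [NormedAddCommGroup E₂] [InnerProductSpace ℝ E₂] [FiniteDimensional ℝ E₂]
    [MeasurableSpace E₂] [BorelSpace E₂] [Nontrivial E₂]

def Phi (L : Rd d ≃ₗᵢ[ℝ] WithLp 2 (E₁ × E₂)) (x : E₁ × E₂) : Rd d := L.symm (WithLp.toLp 2 x)

lemma Phi_mp (L : Rd d ≃ₗᵢ[ℝ] WithLp 2 (E₁ × E₂)) : MeasurePreserving (Phi L) volume volume :=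
  (L.symm.measurePreserving).comp (WithLp.volume_preserving_toLp E₁ E₂)

lemma Phi_me (L : Rd d ≃ₗᵢ[ℝ] WithLp 2 (E₁ × E₂)) : MeasurableEmbedding (Phi L) :=
  (L.symm.toHomeomorph.measurableEmbedding).comp (WithLp.homeomorphProd 2 E₁ E₂).symm.measurableEmbedding

lemma L_Phi (L : Rd d ≃ₗᵢ[ℝ] WithLp 2 (E₁ × E₂)) (x : E₁ × E₂) : (L (Phi L x)) = WithLp.toLp 2 x := by
  simp [Phi]

lemma Phi_norm (L : Rd d ≃ₗᵢ[ℝ] WithLp 2 (E₁ × E₂)) (x : E₁ × E₂) : ‖Phi L x‖ = √(‖x.1‖ ^ 2 + ‖x.2‖ ^ 2) := by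
  rw [Phi, LinearIsometryEquiv.norm_map, WithLp.prod_norm_eq_of_L2]
  rfl

lemma Phi_inner (L : Rd d ≃ₗᵢ[ℝ] WithLp 2 (E₁ × E₂)) (x w : E₁ × E₂) : ⟪Phi L x, Phi L w⟫ = ⟪w.1, x.1⟫ + ⟪w.2, x.2⟫ := by
  rw [Phi, Phi, LinearIsometryEquiv.inner_map_map, WithLp.prod_inner_apply, real_inner_comm, real_inner_comm w.2]

lemma uu_Phi (L : Rd d ≃ₗᵢ[ℝ] WithLp 2 (E₁ × E₂)) (V : Rd d → ℂ) (w : E₁ × E₂) :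
    uu (fun x => V (Phi L x)) w = 𝓕⁻ V (Phi L w) := by
  rw [Real.fourierInv_eq', ← (Phi_mp L).integral_comp (Phi_me L), uu]
  congr with x
  rw [Phi_inner, smul_eq_mul, mul_comm]

lemma half (L : Rd d ≃ₗᵢ[ℝ] WithLp 2 (E₁ × E₂)) {p : ℝ} (hp : 2 < p)
    (hpk : 1 ≤ (2 * (Module.finrank ℝ E₂ : ℝ) + (Module.finrank ℝ E₁ : ℝ)) * (1/2 - 1/p)) :
    ∃ C : ℝ, 0 ≤ C ∧ ∀ h : ℝ → ℝ, IsW h → 0 < ∫ r, h r → (∀ r, 1/2 ≤ r → r ≤ 3/2 → 0 < h r) →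
      ∀ v V : Rd d → ℂ, Integrable V → MemLp V 2 volume → v =ᵐ[volume] 𝓕⁻ V →
      (∀ᵐ ξ : Rd d, ¬ (1/2 ≤ ‖ξ‖ ∧ ‖ξ‖ ≤ 3/2) → V ξ = 0) →
      (∀ x y, ‖(L x).fst‖ = ‖(L y).fst‖ → ‖(L x).snd‖ = ‖(L y).snd‖ → v x = v y) →
      ∀ S : Set (Rd d), MeasurableSet S → (∀ x ∈ S, ‖(L x).fst‖ ≤ ‖(L x).snd‖) →
      (∀ x y, ‖(L x).fst‖ = ‖(L y).fst‖ → ‖(L x).snd‖ = ‖(L y).snd‖ → (x ∈ S ↔ y ∈ S)) →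
      eLpNorm (𝓕⁻ (S.indicator V)) (ENNReal.ofReal p) volume ^ 2 ≤ ENNReal.ofReal (C * ∫ r, h r) *
        ∫⁻ x, ‖V x‖ₑ ^ 2 * (ENNReal.ofReal (h ‖x‖))⁻¹ := by
  obtain ⟨C, hC, H⟩ := piece E₁ E₂ hp hpk
  refine ⟨C, hC, fun h hw hI hpos v V hV hV2 hvV hsupp hsym S hSm hS hSs => ?_⟩
  set W := S.indicator V with hW
  have hWi : Integrable W := hV.indicator hSm
  have hmp := Phi_mp L
  have hme := Phi_me L
  have huu : uu (fun x => W (Phi L x)) = fun w => 𝓕⁻ W (Phi L w) := by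
    ext w; exact uu_Phi L W w
  have key := H h hw hI (fun x => W (Phi L x)) (hmp.integrable_comp_of_integrable hWi) (by
    have h2 := hmp.quasiMeasurePreserving.ae hsupp
    filter_upwards [h2] with x hx hx0
    have hxS : Phi L x ∈ S := by
      by_contra hc
      exact hx0 (Set.indicator_of_notMem hc V)
    have hx1 : V (Phi L x) ≠ 0 := by
      rwa [hW, Set.indicator_of_mem hxS] at hx0
    have hx2 : 1/2 ≤ ‖Phi L x‖ ∧ ‖Phi L x‖ ≤ 3/2 := by
      by_contra hc
      exact hx1 (hx hc)
    have hx3 := hS _ hxS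
    rw [L_Phi] at hx3
    change ‖x.1‖ ≤ ‖x.2‖ at hx3
    have hx4 : ‖Phi L x‖ ^ 2 = ‖x.1‖ ^ 2 + ‖x.2‖ ^ 2 := by
      rw [Phi_norm, Real.sq_sqrt (by positivity)]
    refine ⟨?_, ?_, ?_⟩
    · nlinarith [norm_nonneg x.1, norm_nonneg x.2]
    · nlinarith [norm_nonneg x.1, norm_nonneg x.2]
    · rw [← Phi_norm L]; exact hpos _ hx2.1 hx2.2) (by
    intro y z z' hz
    rw [huu]
    let R := Submodule.reflection (ℝ ∙ (z - z'))ᗮ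
    have hR : R z = z' := Submodule.reflection_sub hz
    let A : Rd d ≃ₗᵢ[ℝ] Rd d := (L.trans (LinearIsometryEquiv.withLpProdCongr 2 (LinearIsometryEquiv.refl ℝ E₁) R)).trans L.symm
    have hLA1 : ∀ x, ‖(L (A x)).fst‖ = ‖(L x).fst‖ := by
      intro x
      simp [A, LinearIsometryEquiv.withLpProdCongr]
    have hLA2 : ∀ x, ‖(L (A x)).snd‖ = ‖(L x).snd‖ := by
      intro x
      simp [A, LinearIsometryEquiv.withLpProdCongr]
    have hAx : A (Phi L (y, z)) = Phi L (y, z') := by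
      simp [A, Phi, LinearIsometryEquiv.withLpProdCongr, hR]
    change 𝓕⁻ W (Phi L (y, z)) = 𝓕⁻ W (Phi L (y, z'))
    rw [← hAx]
    exact (inv_ind hV hV2 hvV A (fun x => hsym _ _ (hLA1 x) (hLA2 x)) S (fun x => hSs _ _ (hLA1 x) (hLA2 x)) _).symm)
  rw [huu] at key
  have e1 : eLpNorm (fun w => 𝓕⁻ W (Phi L w)) (ENNReal.ofReal p) volume = eLpNorm (𝓕⁻ W) (ENNReal.ofReal p) volume :=
    eLpNorm_comp_measurePreserving (fourierInv_cont hWi).aestronglyMeasurable hmp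
  rw [e1] at key
  refine key.trans ?_
  gcongr
  rw [← hmp.lintegral_comp_emb hme]
  apply lintegral_mono
  intro x
  simp only [Phi_norm]
  gcongr
  rw [hW]
  by_cases hx : Phi L x ∈ S
  · rw [Set.indicator_of_mem hx]
  · rw [Set.indicator_of_notMem hx]; simp

end Red





section Wt

lemma wt_int {γ : ℝ} (hγ : 1 < γ) : Integrable (fun u : ℝ => (1 + |u| ^ γ)⁻¹) := by
  have h1 : Integrable (fun u : ℝ => (1 + ‖u‖) ^ (-γ)) := by
    apply integrable_one_add_norm
    simpa using hγ
  refine (h1.const_mul (2 ^ γ)).mono' (by fun_prop : Measurable fun u : ℝ => (1 + |u| ^ γ)⁻¹).aestronglyMeasurable (ae_of_all _ fun u => ?_)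
  rw [Real.norm_of_nonneg (by positivity), Real.rpow_neg (by positivity), ← div_eq_mul_inv, ← one_div, div_le_div_iff₀ (by positivity) (by positivity), one_mul, Real.norm_eq_abs]
  rcases le_total |u| 1 with h | h
  · have a1 : (1 + |u|) ^ γ ≤ 2 ^ γ := Real.rpow_le_rpow (by positivity) (by linarith) (by linarith)
    have a2 : 0 ≤ (2:ℝ) ^ γ * |u| ^ γ := by positivity
    nlinarith
  · have a1 : (1 + |u|) ^ γ ≤ (2 * |u|) ^ γ := Real.rpow_le_rpow (by positivity) (by linarith) (by linarith)
    rw [Real.mul_rpow (by positivity) (by positivity)] at a1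
    have a2 : 0 ≤ (2:ℝ) ^ γ := by positivity
    nlinarith

lemma wt_scale {γ ε : ℝ} (hγ : 1 < γ) (hε : 0 < ε) :
    Integrable (fun r : ℝ => (ε + |r - 1| ^ γ)⁻¹) ∧
    ∫ r : ℝ, (ε + |r - 1| ^ γ)⁻¹ = ε ^ (1/γ - 1) * ∫ u : ℝ, (1 + |u| ^ γ)⁻¹ := by
  have hγ0 : 0 < γ := by linarith
  set lam := ε ^ (1/γ) with hlam
  have hl : 0 < lam := by positivity
  have hlg : lam ^ γ = ε := by
    rw [hlam, ← Real.rpow_mul hε.le]; field_simp; simp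
  have e : ∀ r : ℝ, (ε + |r| ^ γ)⁻¹ = ε⁻¹ * (1 + |lam⁻¹ * r| ^ γ)⁻¹ := by
    intro r
    rw [← mul_inv, abs_mul, abs_of_pos (inv_pos.2 hl), Real.mul_rpow (by positivity) (by positivity), Real.inv_rpow hl.le, hlg]
    congr 1
    field_simp
  have i1 : Integrable (fun r : ℝ => (ε + |r| ^ γ)⁻¹) := by
    simp only [e]
    exact ((wt_int hγ).comp_mul_left' (inv_ne_zero hl.ne')).const_mul _
  constructor
  · exact i1.comp_sub_right 1
  · rw [integral_sub_right_eq_self (fun r : ℝ => (ε + |r| ^ γ)⁻¹) 1]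
    simp only [e]
    rw [integral_const_mul, Measure.integral_comp_mul_left (fun r : ℝ => (1 + |r| ^ γ)⁻¹), inv_inv, abs_of_pos hl, smul_eq_mul, ← mul_assoc]
    congr 1
    rw [hlam, Real.rpow_sub hε, Real.rpow_one]; field_simp

lemma weight {s γ c C : ℝ} (hγ : 1 < γ) (hc : 0 < c) {g : ℝ → ℝ → ℝ} (hg : IsAdmissible s γ c C g) {ε : ℝ} (hε : ε ∈ Set.Ioo (0:ℝ) 1) :
    ∃ h : ℝ → ℝ, IsW h ∧ 0 < ∫ r, h r ∧ (∀ r, 1/2 ≤ r → r ≤ 3/2 → 0 < h r ∧ h r = (g ε r)⁻¹) ∧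
      ∫ r, h r ≤ c⁻¹ * (∫ u : ℝ, (1 + |u| ^ γ)⁻¹) * ε ^ (1/γ - 1) := by
  obtain ⟨g1, g2, g3, g4⟩ := hg
  have gm := g1 ε hε
  have gp := g2 ε hε
  have gb := g4 ε hε
  have hε0 := hε.1
  obtain ⟨i1, i2⟩ := wt_scale hγ hε0
  have hle : ∀ r, (Set.Icc (1/2:ℝ) (3/2)).indicator (fun r => (g ε r)⁻¹) r ≤ c⁻¹ * (ε + |r - 1| ^ γ)⁻¹ := by
    intro r
    by_cases hr : r ∈ Set.Icc (1/2:ℝ) (3/2)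
    · rw [Set.indicator_of_mem hr, ← mul_inv]
      have := (gb r (by rw [abs_le]; constructor <;> linarith [hr.1, hr.2])).1
      gcongr
    · rw [Set.indicator_of_notMem hr]; positivity
  have hnn : ∀ r, 0 ≤ (Set.Icc (1/2:ℝ) (3/2)).indicator (fun r => (g ε r)⁻¹) r := fun r =>
    Set.indicator_nonneg (fun r _ => (inv_pos.2 (gp r)).le) r
  have hm : Measurable ((Set.Icc (1/2:ℝ) (3/2)).indicator (fun r => (g ε r)⁻¹)) := gm.inv.indicator measurableSet_Icc
  have hintq : Integrable ((Set.Icc (1/2:ℝ) (3/2)).indicator (fun r => (g ε r)⁻¹)) :=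
    (i1.const_mul c⁻¹).mono' hm.aestronglyMeasurable (ae_of_all _ fun r => by
      rw [Real.norm_of_nonneg (hnn r)]; exact hle r)
  refine ⟨_, ⟨hm, hnn, fun r hr => Set.indicator_of_notMem (s := Set.Icc (1/2:ℝ) (3/2)) (a := r) (fun h' => hr h') _, hintq⟩, ?_, ?_, ?_⟩
  · rw [integral_pos_iff_support_of_nonneg hnn hintq]
    refine lt_of_lt_of_le ?_ (measure_mono (s := Set.Icc (1/2:ℝ) (3/2)) ?_)
    · rw [Real.volume_Icc]; norm_num
    · intro r hr
      rw [Function.mem_support, Set.indicator_of_mem hr]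
      exact (inv_pos.2 (gp r)).ne'
  · intro r h1 h2
    rw [Set.indicator_of_mem (by exact ⟨h1, h2⟩)]
    exact ⟨inv_pos.2 (gp r), rfl⟩
  · refine (integral_mono hintq (i1.const_mul c⁻¹) hle).trans (le_of_eq ?_)
    rw [integral_const_mul, i2]; ring

end Wt

section Blk

lemma block_equiv (d k : ℕ) (hkd : k ≤ d) : ∃ L : Rd d ≃ₗᵢ[ℝ] WithLp 2 (Rd (d - k) × Rd k),
    ∀ x, blockSq d k x = ‖(L x).fst‖ ^ 2 := by
  let e : Fin d ≃ Fin (d - k) ⊕ Fin k := (finCongr (show d = d - k + k by omega)).trans finSumFinEquiv.symm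
  let L := (LinearIsometryEquiv.piLpCongrLeft 2 ℝ ℝ e).trans (PiLp.sumPiLpEquivProdLpPiLp 2 (𝕜 := ℝ) (fun _ : Fin (d - k) ⊕ Fin k => ℝ))
  refine ⟨L, fun x => ?_⟩
  have h1 : ∀ i, (L x).fst i = x (e.symm (Sum.inl i)) := fun i => rfl
  rw [EuclideanSpace.norm_sq_eq, blockSq, ← e.symm.sum_comp, Fintype.sum_sum_type]
  have h2 : ∀ i : Fin (d - k), ((e.symm (Sum.inl i) : Fin d) : ℕ) = i := fun i => by simp [e]
  have h3 : ∀ i : Fin k, ((e.symm (Sum.inr i) : Fin d) : ℕ) = (d - k) + i := fun i => by simp [e]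
  simp [h1, h2, h3]

end Blk





section Fin

lemma arith {d k : ℕ} (hd : 2 ≤ d) (hk1 : 1 ≤ k) (hkd : k ≤ d - 1) {p : ℝ} (hpk : twoStarK d k ≤ p) :
    2 < p ∧ 1 ≤ (2 * (k : ℝ) + ((d - k : ℕ) : ℝ)) * (1/2 - 1/p) ∧
      1 ≤ (2 * ((d - k : ℕ) : ℝ) + (k : ℝ)) * (1/2 - 1/p) := by
  unfold twoStarK at hpk
  set m := min k (d - k) with hm
  have hm1 : 1 ≤ m := by omega
  have hmk : (m : ℝ) ≤ k := by exact_mod_cast min_le_left _ _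
  have hmk' : (m : ℝ) ≤ (d - k : ℕ) := by exact_mod_cast min_le_right _ _
  have hcast : ((d - k : ℕ) : ℝ) + k = d := by
    rw [← Nat.cast_add]; congr 1; omega
  have hd' : (2:ℝ) ≤ d := by exact_mod_cast hd
  have hm' : (1:ℝ) ≤ m := by exact_mod_cast hm1
  rw [div_le_iff₀ (by linarith)] at hpk
  have hp2 : 2 < p := by
    by_contra hc
    push Not at hc
    nlinarith
  have hx : 1 ≤ ((d:ℝ) + m) * (1/2 - 1/p) := by
    have hp0 : 0 < p := by linarith
    have : ((d:ℝ) + m) * (1/2 - 1/p) = ((d:ℝ) + m) * (p - 2) / (2 * p) := by field_simp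
    rw [this, le_div_iff₀ (by positivity)]
    nlinarith
  have hx0 : 0 ≤ 1/2 - 1/p := by
    by_contra hc
    push Not at hc
    nlinarith
  refine ⟨hp2, ?_, ?_⟩
  · refine hx.trans ?_
    apply mul_le_mul_of_nonneg_right _ hx0
    linarith
  · refine hx.trans ?_
    apply mul_le_mul_of_nonneg_right _ hx0
    linarith

end Fin

/-- estimate (2.4), via the `G_k`-symmetric Stein–Tomas inequality:
for `p ≥ 2_⋆^k` and a `G_k`-symmetric `v` with Fourier support in the shell
`1/2 ≤ |ξ| ≤ 3/2`, `‖v‖_p² ≲ ε^{1/γ-1} q_ε(v)` uniformly in `ε ∈ (0,1)`. -/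
theorem stmt18 (d k : ℕ) (hd : 2 ≤ d) (hk1 : 1 ≤ k) (hkd : k ≤ d - 1)
    (s γ p c C : ℝ)
    (hs : (d : ℝ) / ((d : ℝ) + 1) < s) (hγ : 1 < γ)
    (hpk : twoStarK d k ≤ p) (hps : s < (d : ℝ) / 2 → p < 2 * (d : ℝ) / ((d : ℝ) - 2 * s))
    (hc : 0 < c) (hcC : c ≤ C) :
    ∃ C' : ℝ, 0 < C' ∧
      ∀ g : ℝ → ℝ → ℝ, IsAdmissible s γ c C g →
        ∀ ε ∈ Set.Ioo (0:ℝ) 1,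
          ∀ v V : Rd d → ℂ,
            MemLp v 2 volume → MemLp V 2 volume → IsFT V v →
            GkSymmetric d k v →
            (∀ᵐ ξ : Rd d, ¬ (1/2 ≤ ‖ξ‖ ∧ ‖ξ‖ ≤ 3/2) → V ξ = 0) →
            Integrable (fun ξ : Rd d => ‖V ξ‖ ^ 2 * g ε ‖ξ‖) volume →
            eLpNorm v (ENNReal.ofReal p) volume ^ 2
              ≤ ENNReal.ofReal (C' * ε ^ (1/γ - 1) * ∫ ξ : Rd d, ‖V ξ‖ ^ 2 * g ε ‖ξ‖) := by
  obtain ⟨hp2, hx1, hx2⟩ := arith hd hk1 hkd hpk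
  obtain ⟨L, hL⟩ := block_equiv d k (by omega)
  haveI : Nonempty (Fin k) := ⟨⟨0, by omega⟩⟩
  haveI : Nonempty (Fin (d - k)) := ⟨⟨0, by omega⟩⟩
  let L' : Rd d ≃ₗᵢ[ℝ] WithLp 2 (Rd k × Rd (d - k)) := L.trans (LinearIsometryEquiv.withLpProdComm 2 ℝ (Rd (d - k)) (Rd k))
  have hL'1 : ∀ x, (L' x).fst = (L x).snd := fun x => rfl
  have hL'2 : ∀ x, (L' x).snd = (L x).fst := fun x => rfl
  obtain ⟨C1, hC1, H1⟩ := half L hp2 (by simpa using hx1)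
  obtain ⟨C2, hC2, H2⟩ := half L' hp2 (by simpa using hx2)
  set K := ∫ u : ℝ, (1 + |u| ^ γ)⁻¹ with hK
  have hK0 : 0 ≤ K := integral_nonneg fun u => by positivity
  refine ⟨(2 * C1 + 2 * C2) * (c⁻¹ * K) + 1, by positivity, ?_⟩
  intro g hg ε hε v V hv hV2 hFT hsym hsupp hintq
  obtain ⟨h, hw, hI, hh, hhle⟩ := weight hγ hc hg hε
  have hV : Integrable V := by
    have hVB : V =ᵐ[volume] (Metric.closedBall (0 : Rd d) (3/2)).indicator V := by
      filter_upwards [hsupp] with ξ hξ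
      by_cases h' : ξ ∈ Metric.closedBall (0 : Rd d) (3/2)
      · rw [Set.indicator_of_mem h']
      · rw [Set.indicator_of_notMem h']
        apply hξ
        intro h2
        exact h' (by simpa using h2.2)
    rw [integrable_congr hVB, integrable_indicator_iff measurableSet_closedBall]
    haveI : IsFiniteMeasure ((volume : Measure (Rd d)).restrict (Metric.closedBall (0 : Rd d) (3/2))) :=
      ⟨by rw [Measure.restrict_apply_univ]; exact measure_closedBall_lt_top⟩
    exact (hV2.restrict _).integrable (by norm_num)
  have hvV := isFT_inv hv hV hFT
  have hnorm : ∀ x, ‖x‖ ^ 2 = ‖(L x).fst‖ ^ 2 + ‖(L x).snd‖ ^ 2 := by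
    intro x
    rw [← L.norm_map x, WithLp.prod_norm_sq_eq_of_L2]
  have hsymL : ∀ x y, ‖(L x).fst‖ = ‖(L y).fst‖ → ‖(L x).snd‖ = ‖(L y).snd‖ → v x = v y := by
    intro x y h1 h2
    apply hsym x y
    · rw [hL, hL, h1]
    · have := (hnorm x).trans ((congrArg₂ (fun a b => a ^ 2 + b ^ 2) h1 h2).trans (hnorm y).symm)
      exact (sq_eq_sq₀ (norm_nonneg _) (norm_nonneg _)).1 this
  have hLc1 : Continuous fun x => (L x).fst := by
    have : Continuous fun x => (WithLp.ofLp (L x)).1 := by fun_prop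
    exact this
  have hLc2 : Continuous fun x => (L x).snd := by
    have : Continuous fun x => (WithLp.ofLp (L x)).2 := by fun_prop
    exact this
  set S : Set (Rd d) := {x | ‖(L x).fst‖ ≤ ‖(L x).snd‖} with hS
  have hSm : MeasurableSet S := measurableSet_le hLc1.norm.measurable hLc2.norm.measurable
  set Q := ∫ ξ : Rd d, ‖V ξ‖ ^ 2 * g ε ‖ξ‖ with hQ
  have hgp := hg.2.1 ε hε
  have hQe : ∫⁻ x, ‖V x‖ₑ ^ 2 * (ENNReal.ofReal (h ‖x‖))⁻¹ = ENNReal.ofReal Q := by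
    rw [hQ, ofReal_integral_eq_lintegral_ofReal hintq (ae_of_all _ fun x => mul_nonneg (by positivity) (hgp _).le)]
    apply lintegral_congr_ae
    filter_upwards [hsupp] with x hx
    by_cases hx0 : V x = 0
    · simp [hx0]
    · have hx2 : 1/2 ≤ ‖x‖ ∧ ‖x‖ ≤ 3/2 := by
        by_contra hcon
        exact hx0 (hx hcon)
      rw [(hh _ hx2.1 hx2.2).2, ENNReal.ofReal_inv_of_pos (hgp _), inv_inv, ENNReal.ofReal_mul (by positivity), ENNReal.ofReal_pow (norm_nonneg _), ofReal_norm]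
  have hpos : ∀ r, 1/2 ≤ r → r ≤ 3/2 → 0 < h r := fun r h1 h2 => (hh r h1 h2).1
  have B1 := H1 h hw hI hpos v V hV hV2 hvV hsupp hsymL S hSm (fun x hx => hx)
    (fun x y h1 h2 => by simp only [hS, Set.mem_setOf_eq, h1, h2])
  have B2 := H2 h hw hI hpos v V hV hV2 hvV hsupp (fun x y h1 h2 => hsymL x y h2 h1) Sᶜ hSm.compl
    (fun x hx => by
      simp only [hS, Set.mem_compl_iff, Set.mem_setOf_eq, not_le] at hx
      exact hx.le)
    (fun x y h1 h2 => by
      rw [hL'1, hL'1] at h1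
      rw [hL'2, hL'2] at h2
      simp only [hS, Set.mem_compl_iff, Set.mem_setOf_eq, h1, h2])
  rw [hQe] at B1 B2
  have hi1 : Integrable (S.indicator V) := hV.indicator hSm
  have hi2 : Integrable (Sᶜ.indicator V) := hV.indicator hSm.compl
  have hsplit : 𝓕⁻ V = 𝓕⁻ (S.indicator V) + 𝓕⁻ (Sᶜ.indicator V) := by
    ext w
    rw [Pi.add_apply, ← fourierInv_add' hi1 hi2, Set.indicator_self_add_compl]
  have hQ0 : 0 ≤ Q := integral_nonneg fun x => mul_nonneg (by positivity) (hgp _).le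
  have hε0 : 0 < ε := hε.1
  set I := ∫ r, h r with hIdef
  calc eLpNorm v (ENNReal.ofReal p) volume ^ 2
      = eLpNorm (𝓕⁻ (S.indicator V) + 𝓕⁻ (Sᶜ.indicator V)) (ENNReal.ofReal p) volume ^ 2 := by
        rw [eLpNorm_congr_ae hvV, hsplit]
    _ ≤ (eLpNorm (𝓕⁻ (S.indicator V)) (ENNReal.ofReal p) volume + eLpNorm (𝓕⁻ (Sᶜ.indicator V)) (ENNReal.ofReal p) volume) ^ 2 := by
        gcongr
        exact eLpNorm_add_le (fourierInv_cont hi1).aestronglyMeasurable (fourierInv_cont hi2).aestronglyMeasurable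
          (ENNReal.one_le_ofReal.2 (by linarith))
    _ ≤ 2 * eLpNorm (𝓕⁻ (S.indicator V)) (ENNReal.ofReal p) volume ^ 2 + 2 * eLpNorm (𝓕⁻ (Sᶜ.indicator V)) (ENNReal.ofReal p) volume ^ 2 := add_sq_le' _ _
    _ ≤ 2 * (ENNReal.ofReal (C1 * I) * ENNReal.ofReal Q) + 2 * (ENNReal.ofReal (C2 * I) * ENNReal.ofReal Q) := by
        gcongr
    _ = ENNReal.ofReal (2 * (C1 * I * Q) + 2 * (C2 * I * Q)) := by
        rw [ENNReal.ofReal_add (by positivity) (by positivity), ENNReal.ofReal_mul (p := 2) (by norm_num), ENNReal.ofReal_mul (p := 2) (by norm_num), ENNReal.ofReal_mul (p := C1 * I) (by positivity), ENNReal.ofReal_mul (p := C2 * I) (by positivity)]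
        simp
    _ ≤ _ := by
        apply ENNReal.ofReal_le_ofReal
        have e1 : 2 * (C1 * I * Q) + 2 * (C2 * I * Q) = (2 * C1 + 2 * C2) * I * Q := by ring
        rw [e1]
        apply mul_le_mul_of_nonneg_right _ hQ0
        have e2 : (2 * C1 + 2 * C2) * I ≤ (2 * C1 + 2 * C2) * (c⁻¹ * K * ε ^ (1/γ - 1)) := by gcongr
        have e3 : 0 < ε ^ (1/γ - 1) := by positivity
        nlinarith
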